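/- arXiv:0803.0477 — 2 statements merged into one kernel-verified Lean document; each statement's English description precedes it below -/
import Mathlib

section
/- Put m(k) = ⌊exp(4000 (log log log k)^3)⌋. The set of odd positive integers k such that k ∈ 𝒞_{m(k)} has asymptotic density 1/2; that is, #{k ≤ x : k odd and k ∈ 𝒞_{m(k)}}/x → 1/2 as x → ∞. Moreover, the number of odd k ≤ x with k ∉ 𝒞_{m(k)} is O(x/log log log x). -/
open Filter

/-- `plog x = max (ln x) 1`, the variant of the logarithm used in the paper. -/
noncomputable def plog (x : ℝ) : ℝ := max (Real.log x) 1

/-- `mfun k = ⌊exp(4000 (log log log k)^3)⌋`. -/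
noncomputable def mfun (k : ℕ) : ℕ :=
  ⌊Real.exp (4000 * (plog (plog (plog (k : ℝ)))) ^ 3)⌋₊

/-- `memC m k` says that the odd positive integer `k` belongs to the set `𝒞_m`:
`2^(k+m) - 1` is congruent modulo `k` to a sum of `m` distinct powers of two
`2^(j_1) + ⋯ + 2^(j_m)` with `0 ≤ j_1 < ⋯ < j_m ≤ m + k - 2`. -/
def memC (m k : ℕ) : Prop :=
  Odd k ∧ 0 < k ∧ ∃ S : Finset ℕ, S.card = m ∧ (∀ j ∈ S, j ≤ m + k - 2) ∧
    2 ^ (k + m) - 1 ≡ (∑ j ∈ S, 2 ^ j) [MOD k]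

/-- Merging repeated exponents turns a nonempty sum of powers of two into a sum of powers of two
with distinct exponents below a period `t`. -/
theorem exists_finset_sum_two_pow_eq {R : Type*} [Semiring R] {t : ℕ} (ht : 0 < t)
    (h2 : (2 : R) ^ t = 1) (s : Multiset ℕ) (hs : s ≠ 0) :
    ∃ J : Finset ℕ, J ⊆ Finset.range t ∧ J.Nonempty ∧ J.card ≤ s.card ∧
      ∑ j ∈ J, (2 : R) ^ j = (s.map fun e => (2 : R) ^ e).sum := by
  have hmod : ∀ e, (2 : R) ^ (e % t) = 2 ^ e := fun e => by
    conv_rhs => rw [← Nat.mod_add_div e t, pow_add, pow_mul, h2, one_pow, mul_one]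
  induction hn : s.card using Nat.strong_induction_on generalizing s with
  | _ n ih =>
    subst hn
    have hsum : ((s.map (· % t)).map fun e => (2 : R) ^ e).sum
        = (s.map fun e => (2 : R) ^ e).sum := by
      simp [Multiset.map_map, hmod]
    by_cases hd : (s.map (· % t)).Nodup
    · refine ⟨⟨s.map (· % t), hd⟩, ?_, ?_, ?_, ?_⟩
      · intro a ha
        simp only [Finset.mem_mk, Multiset.mem_map] at ha
        obtain ⟨b, -, rfl⟩ := ha
        exact Finset.mem_range.2 (Nat.mod_lt _ ht)
      · obtain ⟨a, ha⟩ := Multiset.exists_mem_of_ne_zero hs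
        exact ⟨a % t, by simpa using ⟨a, ha, rfl⟩⟩
      · simp
      · rw [← hsum]; rfl
    · rw [Multiset.nodup_iff_le] at hd
      push Not at hd
      obtain ⟨a, ha⟩ := hd
      obtain ⟨r, hr⟩ := Multiset.le_iff_exists_add.1 ha
      have hcard : s.card = r.card + 2 := by
        rw [← Multiset.card_map (· % t) s, hr]; simp
      obtain ⟨J, h1, h3, h4, h5⟩ := ih (r.card + 1) (by omega) ((a + 1) ::ₘ r) (by simp) (by simp)
      refine ⟨J, h1, h3, by omega, ?_⟩
      rw [h5, ← hsum, hr]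
      simp [pow_succ, mul_two, add_assoc]

/-- Splitting one power of two into two equal halves increases the number of distinct exponents
by one. -/
theorem exists_finset_card_succ {R : Type*} [Semiring R] {t N : ℕ} (ht : 0 < t)
    (h2 : (2 : R) ^ t = 1) (hN : 2 * t ≤ N) {J : Finset ℕ} (hJ : J ⊆ Finset.range N)
    (hne : J.Nonempty) (hcard : J.card + t < N) :
    ∃ J' : Finset ℕ, J' ⊆ Finset.range N ∧ J'.card = J.card + 1 ∧
      ∑ j ∈ J', (2 : R) ^ j = ∑ j ∈ J, (2 : R) ^ j := by
  have hmod : ∀ e, (2 : R) ^ (e % t) = 2 ^ e := fun e => by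
    conv_rhs => rw [← Nat.mod_add_div e t, pow_add, pow_mul, h2, one_pow, mul_one]
  by_contra! hcon
  let P : ℕ → Prop := fun c => ∃ i ∈ Finset.range N \ J, ∃ i' ∈ Finset.range N \ J,
    i ≠ i' ∧ i % t = c % t ∧ i' % t = c % t
  have hfree : ∀ c, P c → ∀ j ∈ J, j % t ≠ (c + 1) % t := by
    rintro c ⟨i, hi, i', hi', hii, hic, hic'⟩ j hj hjc
    simp only [Finset.mem_sdiff] at hi hi'
    refine hcon (insert i (insert i' (J.erase j))) ?_ ?_ ?_
    · intro a ha
      simp only [Finset.mem_insert, Finset.mem_erase] at ha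
      rcases ha with rfl | rfl | ha
      · exact hi.1
      · exact hi'.1
      · exact hJ ha.2
    · have hpos := Finset.card_pos.2 ⟨j, hj⟩
      rw [Finset.card_insert_of_notMem, Finset.card_insert_of_notMem, Finset.card_erase_of_mem hj]
      · omega
      · simp [hi'.2]
      · simp [hi.2, hii]
    · rw [Finset.sum_insert, Finset.sum_insert, ← Finset.add_sum_erase J _ hj, ← add_assoc]
      · congr 1
        rw [← hmod i, ← hmod i', ← hmod j, hic, hic', hjc, hmod, hmod, pow_succ, mul_two]
      · simp [hi'.2]
      · simp [hi.2, hii]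
  have hstep : ∀ c, P c → P (c + 1) := by
    intro c hc
    have hlt := Nat.mod_lt (c + 1) ht
    have hf := hfree c hc
    refine ⟨(c + 1) % t, ?_, (c + 1) % t + t, ?_, by omega, by simp, by simp⟩
    · simp only [Finset.mem_sdiff, Finset.mem_range]
      exact ⟨by omega, fun h => hf _ h (by simp)⟩
    · simp only [Finset.mem_sdiff, Finset.mem_range]
      exact ⟨by omega, fun h => hf _ h (by simp)⟩
  obtain ⟨c, hc⟩ : ∃ c, P c := by
    have hF : (Finset.range t).card < (Finset.range N \ J).card := by
      rw [Finset.card_sdiff_of_subset hJ, Finset.card_range, Finset.card_range]; omega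
    obtain ⟨i, hi, i', hi', hii, h⟩ := Finset.exists_ne_map_eq_of_card_lt_of_maps_to hF
      (f := (· % t)) (fun a _ => by simpa using Nat.mod_lt _ ht)
    exact ⟨i, i, hi, i', hi', hii, rfl, h.symm⟩
  have hall : ∀ n, P (c + n) := by
    intro n
    induction n with
    | zero => exact hc
    | succ n ih => exact hstep _ ih
  obtain ⟨j, hj⟩ := hne
  refine hfree _ (hall (j + (t * (c + 1) - (c + 1)))) j hj ?_
  have h1 : c + 1 ≤ t * (c + 1) := Nat.le_mul_of_pos_left _ ht
  have h3 : c + (j + (t * (c + 1) - (c + 1))) + 1 = j + t * (c + 1) := by omega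
  rw [h3, Nat.add_mul_mod_self_left]

/-- If `0` is a nonempty sum of at most `m` powers of two modulo `k`, then `k ∈ 𝒞_m`, provided that
the multiplicative order of `2` modulo `k` is at most `k / 2`. -/
theorem memC_of_sum_two_pow_eq_zero {k m t : ℕ} (hk : Odd k) (ht : 0 < t) (htk : 2 * t ≤ k)
    (h2 : (2 : ZMod k) ^ t = 1) (s : Multiset ℕ) (hs : s ≠ 0) (hcard : s.card ≤ m)
    (hsum : (s.map fun e => (2 : ZMod k) ^ e).sum = 0) : memC m k := by
  have hk0 : 0 < k := hk.pos
  obtain ⟨c, hc⟩ := Multiset.exists_mem_of_ne_zero hs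
  obtain ⟨r, rfl⟩ := Multiset.exists_cons_of_mem hc
  have hm : 1 ≤ m := le_trans (by simp) hcard
  have hrsum : ((r.map (· + (t * c - c))).map fun e => (2 : ZMod k) ^ e).sum = -1 := by
    have h3 : (2 : ZMod k) ^ c * 2 ^ (t * c - c) = 1 := by
      rw [← pow_add, Nat.add_sub_cancel' (Nat.le_mul_of_pos_left _ ht), pow_mul, h2, one_pow]
    simp only [Multiset.map_cons, Multiset.sum_cons] at hsum
    simp only [Multiset.map_map, Function.comp_def, pow_add, Multiset.sum_map_mul_right]
    rw [eq_neg_of_add_eq_zero_right hsum, neg_mul, h3]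
  obtain ⟨J, hJt, hJne, hJc, hJs⟩ := exists_finset_sum_two_pow_eq ht h2
    ((k + m) ::ₘ r.map (· + (t * c - c))) (by simp)
  have hJm : J.card ≤ m := hJc.trans (by simpa using hcard)
  have key : ∀ n, J.card ≤ n → n ≤ m → ∃ J' : Finset ℕ, J' ⊆ Finset.range (k + m - 1) ∧
      J'.card = n ∧ ∑ j ∈ J', (2 : ZMod k) ^ j = ∑ j ∈ J, (2 : ZMod k) ^ j := by
    intro n hn
    induction n, hn using Nat.le_induction with
    | base =>
      intro _
      exact ⟨J, hJt.trans (Finset.range_subset_range.2 (by omega)), rfl, rfl⟩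
    | succ n hn ih =>
      intro hnm
      obtain ⟨J', h1, h3, h4⟩ := ih (by omega)
      obtain ⟨J'', h5, h6, h7⟩ := exists_finset_card_succ ht h2 (N := k + m - 1) (by omega) h1
        (Finset.card_pos.1 (by have := Finset.card_pos.2 hJne; omega)) (by omega)
      exact ⟨J'', h5, by omega, h7.trans h4⟩
  obtain ⟨J', h1, h3, h4⟩ := key m hJm le_rfl
  refine ⟨hk, hk0, J', h3, fun j hj => ?_, ?_⟩
  · have := Finset.mem_range.1 (h1 hj); omega
  · rw [← ZMod.natCast_eq_natCast_iff]
    rw [Nat.cast_sub Nat.one_le_two_pow]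
    push_cast
    rw [h4, hJs]
    simp only [Multiset.map_cons, Multiset.sum_cons, hrsum]
    ring

section SumsOfSubgroups

open scoped Pointwise

/-- The number of representations `c = a + ξ * b` with `a ∈ A` and `b ∈ B`. -/
def dilateRep {F : Type*} [Field F] [DecidableEq F] (A B : Finset F) (ξ c : F) : ℕ :=
  ((A ×ˢ B).filter fun x => x.1 + ξ * x.2 = c).card

variable {F : Type*} [Field F] [Fintype F] [DecidableEq F]

theorem sum_dilateRep (A B : Finset F) (ξ : F) :
    ∑ c, dilateRep A B ξ c = A.card * B.card := by
  rw [← Finset.card_product]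
  exact (Finset.card_eq_sum_card_fiberwise (t := Finset.univ) fun _ _ => by simp).symm

theorem sum_dilateRep_sq_eq (A B : Finset F) (ξ : F) :
    ∑ c, dilateRep A B ξ c ^ 2 = ∑ x ∈ A ×ˢ B, ∑ y ∈ A ×ˢ B,
      if x.1 + ξ * x.2 = y.1 + ξ * y.2 then 1 else 0 := by
  have h : ∀ c, dilateRep A B ξ c ^ 2 = ∑ x ∈ A ×ˢ B, ∑ y ∈ A ×ˢ B,
      (if x.1 + ξ * x.2 = c then 1 else 0) * (if y.1 + ξ * y.2 = c then 1 else 0) := by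
    intro c
    rw [sq, dilateRep, Finset.card_filter, Finset.sum_mul_sum]
  simp_rw [h]
  rw [Finset.sum_comm]
  refine Finset.sum_congr rfl fun x _ => ?_
  rw [Finset.sum_comm]
  refine Finset.sum_congr rfl fun y _ => ?_
  simp [eq_comm]

/-- The second moment of the number of representations `c = a + ξ * b` over all `ξ` and `c`. -/
theorem sum_sum_dilateRep_sq_le (A B : Finset F) :
    ∑ ξ, ∑ c, dilateRep A B ξ c ^ 2
      ≤ Fintype.card F * (A.card * B.card) + (A.card * B.card) ^ 2 := by
  simp_rw [sum_dilateRep_sq_eq]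
  rw [Finset.sum_comm]
  have h : ∀ x ∈ A ×ˢ B, ∑ ξ : F, ∑ y ∈ A ×ˢ B,
      (if x.1 + ξ * x.2 = y.1 + ξ * y.2 then 1 else 0)
      ≤ Fintype.card F + (A.card * B.card) := by
    intro x hx
    rw [Finset.sum_comm, ← Finset.add_sum_erase _ _ hx]
    gcongr
    · simp
    · rw [← Finset.card_product]
      refine (Finset.sum_le_card_nsmul _ _ 1 ?_).trans ?_
      · intro y hy
        rw [← Finset.card_filter, Finset.card_le_one]
        intro ξ hξ η hη
        simp only [Finset.mem_filter, Finset.mem_univ, true_and] at hξ hη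
        have hne := (Finset.mem_erase.1 hy).1
        have h2 : x.2 - y.2 ≠ 0 := by
          intro h0
          have h0' := sub_eq_zero.1 h0
          rw [h0'] at hξ
          exact hne (Prod.ext (add_right_cancel hξ).symm h0'.symm)
        apply mul_right_cancel₀ h2
        linear_combination hξ - hη
      · rw [smul_eq_mul, mul_one]
        exact Finset.card_le_card (Finset.erase_subset _ _)
  refine (Finset.sum_le_sum h).trans ?_
  rw [Finset.sum_const, Finset.card_product, smul_eq_mul]
  apply le_of_eq; ring

/-- If `|A| |B| |D| |E| > |F| ^ 3` then some `c ∈ E` is of the form `a + ξ * b` with `a ∈ A`,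
`b ∈ B` and `ξ ∈ D`. -/
theorem exists_add_mul_eq {A B D E : Finset F}
    (h : Fintype.card F ^ 3 < D.card * E.card * (A.card * B.card)) :
    ∃ a ∈ A, ∃ b ∈ B, ∃ ξ ∈ D, a + ξ * b ∈ E := by
  by_contra! hcon
  set q := Fintype.card F with hq
  set n := A.card * B.card with hn
  have hq0 : (0 : ℝ) < q := by exact_mod_cast Fintype.card_pos
  have hn0 : (0 : ℝ) < n := by
    rcases Nat.eq_zero_or_pos n with h0 | h0
    · rw [h0] at h; omega
    · exact_mod_cast h0
  have hr : ∀ ξ ∈ D, ∀ c ∈ E, dilateRep A B ξ c = 0 := by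
    intro ξ hξ c hc
    rw [dilateRep, Finset.card_eq_zero, Finset.filter_eq_empty_iff]
    rintro ⟨a, b⟩ hab rfl
    rw [Finset.mem_product] at hab
    exact hcon a hab.1 b hab.2 ξ hξ hc
  have hvar : ∑ ξ : F, ∑ c : F, ((dilateRep A B ξ c : ℝ) - n / q) ^ 2 ≤ q * n := by
    have h1 : ∀ ξ : F, ∑ c : F, ((dilateRep A B ξ c : ℝ) - n / q) ^ 2
        = ∑ c : F, (dilateRep A B ξ c : ℝ) ^ 2 - n ^ 2 / q := by
      intro ξ
      have h2 : (∑ c : F, (dilateRep A B ξ c : ℝ)) = n := by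
        exact_mod_cast sum_dilateRep A B ξ
      simp_rw [sub_sq]
      rw [Finset.sum_add_distrib, Finset.sum_sub_distrib, ← Finset.sum_mul, ← Finset.mul_sum, h2]
      simp only [Finset.sum_const, Finset.card_univ, ← hq, nsmul_eq_mul]
      field_simp
      ring
    simp_rw [h1]
    rw [Finset.sum_sub_distrib]
    simp only [Finset.sum_const, Finset.card_univ, ← hq, nsmul_eq_mul]
    have h3 : (∑ ξ : F, ∑ c : F, (dilateRep A B ξ c : ℝ) ^ 2) ≤ q * n + n ^ 2 := by
      exact_mod_cast sum_sum_dilateRep_sq_le A B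
    have h4 : (q : ℝ) * (n ^ 2 / q) = n ^ 2 := by field_simp
    linarith
  have hlow : (D.card : ℝ) * E.card * (n / q) ^ 2
      ≤ ∑ ξ : F, ∑ c : F, ((dilateRep A B ξ c : ℝ) - n / q) ^ 2 := by
    calc (D.card : ℝ) * E.card * (n / q) ^ 2
        = ∑ ξ ∈ D, ∑ c ∈ E, ((dilateRep A B ξ c : ℝ) - n / q) ^ 2 := by
          have : ∀ ξ ∈ D, ∑ c ∈ E, ((dilateRep A B ξ c : ℝ) - n / q) ^ 2
              = E.card * (n / q : ℝ) ^ 2 := by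
            intro ξ hξ
            rw [Finset.sum_congr rfl fun c hc => by rw [hr ξ hξ c hc]]
            simp
          rw [Finset.sum_congr rfl this]
          simp [mul_assoc]
      _ ≤ ∑ ξ ∈ D, ∑ c, ((dilateRep A B ξ c : ℝ) - n / q) ^ 2 := by
          gcongr
          exact Finset.subset_univ _
      _ ≤ _ := Finset.sum_le_sum_of_subset_of_nonneg (Finset.subset_univ _)
          fun _ _ _ => Finset.sum_nonneg fun _ _ => sq_nonneg _
  have h' : (q : ℝ) ^ 3 < D.card * E.card * n := by exact_mod_cast h
  have h5 := hlow.trans hvar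
  rw [div_pow, ← mul_div_assoc, div_le_iff₀ (by positivity)] at h5
  nlinarith

/-- Some dilate `ξ * B` has a large sumset with `A`. -/
theorem exists_card_image_add_mul_ge (A B : Finset F) :
    ∃ ξ : F, Fintype.card F * (A.card * B.card) ^ 2 ≤
      ((A ×ˢ B).image fun x => x.1 + ξ * x.2).card *
        (Fintype.card F * (A.card * B.card) + (A.card * B.card) ^ 2) := by
  obtain ⟨ξ, -, hξ⟩ := Finset.exists_le_of_sum_le (s := (Finset.univ : Finset F))
    (f := fun ξ => Fintype.card F * ∑ c, dilateRep A B ξ c ^ 2)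
    (g := fun _ => Fintype.card F * (A.card * B.card) + (A.card * B.card) ^ 2)
    Finset.univ_nonempty (by
      rw [← Finset.mul_sum, Finset.sum_const, Finset.card_univ, smul_eq_mul]
      exact Nat.mul_le_mul_left _ (sum_sum_dilateRep_sq_le A B))
  refine ⟨ξ, le_trans ?_ (Nat.mul_le_mul_left _ hξ)⟩
  rw [mul_left_comm]
  refine Nat.mul_le_mul_left _ ?_
  set T := (A ×ˢ B).image fun x => x.1 + ξ * x.2 with hT
  have h1 : ∑ c ∈ T, dilateRep A B ξ c = A.card * B.card := by
    rw [← sum_dilateRep A B ξ]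
    refine Finset.sum_subset (Finset.subset_univ _) fun c _ hc => ?_
    rw [dilateRep, Finset.card_eq_zero, Finset.filter_eq_empty_iff]
    rintro x hx rfl
    exact hc (Finset.mem_image_of_mem _ hx)
  rw [← h1]
  refine (sq_sum_le_card_mul_sum_sq (s := T)).trans ?_
  exact Nat.mul_le_mul_left _ (Finset.sum_le_sum_of_subset (Finset.subset_univ _))

theorem nsmul_mul_nsmul_subset {K : Type*} [Field K] [DecidableEq K] {G : Finset K}
    (hG : G * G ⊆ G) (n m : ℕ) :
    (n • G) * (m • G) ⊆ (n * m) • G := by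
  have h1 : ∀ m : ℕ, G * (m • G) ⊆ m • G := by
    intro m
    induction m with
    | zero =>
      intro x hx
      obtain ⟨a, -, b, hb, rfl⟩ := Finset.mem_mul.1 hx
      simp at hb
      simp [hb]
    | succ m ih =>
      rw [succ_nsmul]
      exact (Finset.mul_add_subset _ _ _).trans (Finset.add_subset_add ih hG)
  induction n with
  | zero =>
    intro x hx
    obtain ⟨a, ha, b, hb, rfl⟩ := Finset.mem_mul.1 hx
    simp at ha
    simp [ha]
  | succ n ih =>
    rw [succ_nsmul, Nat.succ_mul, add_nsmul]
    exact (Finset.add_mul_subset _ _ _).trans (Finset.add_subset_add ih (h1 m))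

end SumsOfSubgroups

section PrimeField

open scoped Pointwise

variable {p : ℕ} [Fact p.Prime]

/-- A multiplicatively closed subset of a prime field grows under bounded sums and differences. -/
theorem min_card_sq_le_card_nsmul_sub {G : Finset (ZMod p)} (hG : G * G ⊆ G)
    (h2 : 2 ≤ G.card) :
    min p (G.card ^ 2) ≤ 2 * (3 • G - 3 • G).card := by
  have hmul : ∀ {a b}, a ∈ G → b ∈ G → a * b ∈ G := fun ha hb => hG (Finset.mul_mem_mul ha hb)
  have h3 : ∀ {a b c}, a ∈ G → b ∈ G → c ∈ G → a + b + c ∈ 3 • G := by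
    intro a b c ha hb hc
    rw [succ_nsmul, two_nsmul]
    exact Finset.add_mem_add (Finset.add_mem_add ha hb) hc
  have hinj : ∀ (T : Finset (ZMod p)) (c : ZMod p), c ≠ 0 →
      (∀ x ∈ T, c * x ∈ 3 • G - 3 • G) → T.card ≤ (3 • G - 3 • G).card := by
    intro T c hc hT
    exact Finset.card_le_card_of_injOn (c * ·) hT fun a _ b _ hab => mul_left_cancel₀ hc hab
  by_cases hQ : ∀ ξ : ZMod p, ∃ a ∈ G, ∃ b ∈ G, ∃ c ∈ G, ∃ d ∈ G, c ≠ d ∧ ξ * (c - d) = a - b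
  · obtain ⟨ξ, hξ⟩ := exists_card_image_add_mul_ge G G
    obtain ⟨a, ha, b, hb, c, hc, d, hd, hcd, he⟩ := hQ ξ
    have hT := hinj (c := c - d) (sub_ne_zero.2 hcd) (T := (G ×ˢ G).image fun x => x.1 + ξ * x.2) (by
      intro x hx
      obtain ⟨⟨u, v⟩, huv, rfl⟩ := Finset.mem_image.1 hx
      obtain ⟨hu, hv⟩ := Finset.mem_product.1 huv
      refine Finset.mem_sub.2 ⟨_, h3 (hmul hc hu) (hmul ha hv) hu, _,
        h3 (hmul hd hu) (hmul hb hv) hu, ?_⟩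
      simp only
      linear_combination (-v) * he)
    rw [ZMod.card] at hξ
    set g := G.card
    have hg : 0 < g * g := by positivity
    have h5 : p * (g * g) ≤ (3 • G - 3 • G).card * (p + g * g) := by
      refine le_trans ?_ (Nat.mul_le_mul_right _ hT)
      refine Nat.le_of_mul_le_mul_right ?_ hg
      calc _ = _ := ?_
        _ ≤ _ := hξ
        _ = _ := ?_
      · ring
      · ring
    rw [sq]
    rcases le_total p (g * g) with hle | hle
    · rw [min_eq_left hle]
      refine Nat.le_of_mul_le_mul_right (h5.trans ?_) hg
      calc _ ≤ (3 • G - 3 • G).card * (g * g + g * g) := by gcongr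
        _ = _ := by ring
    · rw [min_eq_right hle]
      have hp : 0 < p := (Fact.out : p.Prime).pos
      refine Nat.le_of_mul_le_mul_left (h5.trans ?_) hp
      calc _ ≤ (3 • G - 3 • G).card * (p + p) := by gcongr
        _ = _ := by ring
  · obtain ⟨g₁, hg₁, g₂, hg₂, hne⟩ := Finset.one_lt_card.1 h2
    obtain ⟨ξ, ⟨a, ha, b, hb, c, hc, d, hd, hcd, he⟩, hη⟩ : ∃ ξ : ZMod p,
        (∃ a ∈ G, ∃ b ∈ G, ∃ c ∈ G, ∃ d ∈ G, c ≠ d ∧ ξ * (c - d) = a - b) ∧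
        ¬ (∃ a ∈ G, ∃ b ∈ G, ∃ c ∈ G, ∃ d ∈ G, c ≠ d ∧ (ξ + 1) * (c - d) = a - b) := by
      by_contra! hcon
      refine hQ fun ξ => ?_
      have hall : ∀ n : ℕ, ∃ a ∈ G, ∃ b ∈ G, ∃ c ∈ G, ∃ d ∈ G, c ≠ d ∧
          (n : ZMod p) * (c - d) = a - b := by
        intro n
        induction n with
        | zero => exact ⟨g₁, hg₁, g₁, hg₁, g₁, hg₁, g₂, hg₂, hne, by simp⟩
        | succ n ih => simpa using hcon _ ih
      simpa using hall ξ.val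
    have himg : ((G ×ˢ G).image fun x => x.1 + (ξ + 1) * x.2).card = G.card ^ 2 := by
      rw [Finset.card_image_of_injOn, Finset.card_product, sq]
      rintro ⟨u, v⟩ huv ⟨u', v'⟩ huv' heq
      simp only [Finset.coe_product, Set.mem_prod, Finset.mem_coe] at huv huv'
      simp only at heq
      have hv : v = v' := by
        by_contra hv
        exact hη ⟨u', huv'.1, u, huv.1, v, huv.2, v', huv'.2, hv, by linear_combination heq⟩
      subst hv
      simpa using heq
    have hT := hinj (c := c - d) (sub_ne_zero.2 hcd)
      (T := (G ×ˢ G).image fun x => x.1 + (ξ + 1) * x.2) (by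
      intro x hx
      obtain ⟨⟨u, v⟩, huv, rfl⟩ := Finset.mem_image.1 hx
      obtain ⟨hu, hv⟩ := Finset.mem_product.1 huv
      refine Finset.mem_sub.2 ⟨_, h3 (hmul hc hu) (hmul ha hv) (hmul hc hv), _,
        h3 (hmul hd hu) (hmul hb hv) (hmul hd hv), ?_⟩
      simp only
      linear_combination (-v) * he)
    rw [himg] at hT
    exact (min_le_right _ _).trans (by omega)

/-- A multiplicatively closed set of at least `p ^ (9 / 20)` residues modulo a large prime `p`
has `0` as a sum of exactly `168` of its elements. -/
theorem exists_sum_eq_zero_of_card {G : Finset (ZMod p)} (hG : G * G ⊆ G) (hp : 2 ^ 20 < p)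
    (hc : p ^ 9 ≤ G.card ^ 20) : ∃ f : Fin 168 → ZMod p, (∀ i, f i ∈ G) ∧ ∑ i, f i = 0 := by
  suffices h : ∀ n : ℕ, n = 168 → 0 ∈ n • G by
    generalize 168 = n at h ⊢
    obtain ⟨f, hf⟩ := Finset.mem_nsmul.1 (h n rfl)
    exact ⟨fun i => f i, fun i => (f i).2, by rwa [List.sum_ofFn] at hf⟩
  intro n hn
  set g := G.card with hg
  have hg9 : 8 < g := by
    by_contra! hlt
    have h1 : (2 ^ 20) ^ 9 < p ^ 9 := Nat.pow_lt_pow_left hp (by norm_num)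
    have h2 : g ^ 20 ≤ 8 ^ 20 := Nat.pow_le_pow_left hlt _
    have h3 : (8 : ℕ) ^ 20 ≤ (2 ^ 20) ^ 9 := by norm_num
    exact absurd (h1.trans_le (hc.trans h2)) h3.not_gt
  obtain ⟨e, he⟩ : G.Nonempty := Finset.card_pos.1 (lt_trans (by norm_num) hg9)
  have hd := min_card_sq_le_card_nsmul_sub hG (le_trans (by norm_num) hg9)
  set d := (3 • G - 3 • G).card with hdd
  have hgX : g ≤ (3 • G).card := by
    refine Finset.card_le_card_of_injOn (· + (e + e)) ?_ fun a _ b _ hab => add_right_cancel hab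
    intro a ha
    rw [succ_nsmul', two_nsmul]
    exact Finset.add_mem_add ha (Finset.add_mem_add he he)
  have hX6 : (6 : ℕ) • G = 3 • G + 3 • G := by rw [← add_nsmul]
  have hX12 : (12 : ℕ) • G = 6 • G + 6 • G := by rw [← add_nsmul]
  have hY : d * g ≤ (6 • G).card ^ 2 := by
    have h := Finset.ruzsa_triangle_inequality_sub_add_add (3 • G) (3 • G) (3 • G)
    rw [← hX6, ← sq, ← hdd] at h
    exact (Nat.mul_le_mul_left _ hgX).trans h
  have hdY : d ≤ (6 • G - 6 • G).card := by
    refine Finset.card_le_card fun x hx => ?_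
    obtain ⟨a, ha, b, hb, rfl⟩ := Finset.mem_sub.1 hx
    rw [hX6]
    exact Finset.mem_sub.2 ⟨a + b, Finset.add_mem_add ha hb, b + b, Finset.add_mem_add hb hb,
      by ring⟩
  have hZ : d * (6 • G).card ≤ (12 • G).card ^ 2 := by
    have h := Finset.ruzsa_triangle_inequality_sub_add_add (6 • G) (6 • G) (6 • G)
    rw [← hX12, ← sq] at h
    exact (Nat.mul_le_mul_right _ hdY).trans h
  have hZ4 : d ^ 3 * g ≤ (12 • G).card ^ 4 := by
    calc d ^ 3 * g = d ^ 2 * (d * g) := by ring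
      _ ≤ d ^ 2 * (6 • G).card ^ 2 := by gcongr
      _ = (d * (6 • G).card) ^ 2 := by ring
      _ ≤ ((12 • G).card ^ 2) ^ 2 := by gcongr
      _ = _ := by ring
  have hbig : p ^ 3 < (12 • G).card ^ 4 := by
    have h8 : (min p (g ^ 2)) ^ 3 * g ≤ 8 * (12 • G).card ^ 4 := by
      calc (min p (g ^ 2)) ^ 3 * g ≤ (2 * d) ^ 3 * g := by gcongr
        _ = 8 * (d ^ 3 * g) := by ring
        _ ≤ _ := by gcongr
    rcases le_total p (g ^ 2) with hle | hle
    · rw [min_eq_left hle] at h8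
      have : p ^ 3 * 8 < p ^ 3 * g := by gcongr
      omega
    · rw [min_eq_right hle] at h8
      by_contra! hcon
      have h1 : (g ^ 20) ^ 7 ≤ (8 * p ^ 3) ^ 20 := by
        calc (g ^ 20) ^ 7 = ((g ^ 2) ^ 3 * g) ^ 20 := by ring
          _ ≤ (8 * (12 • G).card ^ 4) ^ 20 := by gcongr
          _ ≤ _ := by gcongr
      have h2 : (p ^ 9) ^ 7 ≤ (g ^ 20) ^ 7 := by gcongr
      have h3 : (2 ^ 20) ^ 3 * p ^ 60 < p ^ 3 * p ^ 60 := by gcongr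
      have h4 : (p ^ 9) ^ 7 = p ^ 3 * p ^ 60 := by ring
      have h5 : (8 * p ^ 3) ^ 20 = (2 ^ 20) ^ 3 * p ^ 60 := by ring
      omega
  obtain ⟨a, ha, b, hb, ξ, hξ, hmem⟩ := exists_add_mul_eq (F := ZMod p) (A := 12 • G)
    (B := 12 • G) (D := 12 • G) (E := -(12 • G)) (by
      rw [ZMod.card, Finset.card_neg]
      calc p ^ 3 < _ := hbig
        _ = _ := by ring)
  have h1 : ∀ r : ℕ, n = r + r * r + r → a ∈ r • G → b ∈ r • G → ξ ∈ r • G →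
      a + ξ * b ∈ -(r • G) → 0 ∈ n • G := by
    rintro r rfl ha hb hξ hmem
    rw [add_nsmul, add_nsmul]
    exact Finset.mem_add.2 ⟨a + ξ * b, Finset.add_mem_add ha
      (nsmul_mul_nsmul_subset hG r r (Finset.mul_mem_mul hξ hb)), -(a + ξ * b),
      Finset.mem_neg'.1 hmem, by ring⟩
  exact h1 12 hn ha hb hξ hmem

end PrimeField

theorem exists_mem_smoothNumbers_mul_eq (y : ℕ) {n : ℕ} (hn : n ≠ 0) :
    ∃ a b, a ∈ Nat.smoothNumbers y ∧ (∀ p, p.Prime → p ∣ b → y ≤ p) ∧ a * b = n := by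
  induction n using induction_on_primes with
  | zero => exact absurd rfl hn
  | one =>
    exact ⟨1, 1, Nat.mem_smoothNumbers'.2 fun p hp h => absurd (Nat.dvd_one.1 h) hp.ne_one,
      fun p hp h => absurd (Nat.dvd_one.1 h) hp.ne_one, rfl⟩
  | prime_mul p n hp ih =>
    obtain ⟨a, b, ha, hb, rfl⟩ := ih (right_ne_zero_of_mul hn)
    rcases lt_or_ge p y with h | h
    · refine ⟨p * a, b, Nat.mem_smoothNumbers'.2 fun q hq hqd => ?_, hb, by ring⟩
      rcases (Nat.Prime.dvd_mul hq).1 hqd with h' | h'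
      · rwa [(Nat.prime_dvd_prime_iff_eq hq hp).1 h']
      · exact Nat.mem_smoothNumbers'.1 ha q hq h'
    · refine ⟨a, p * b, ha, fun q hq hqd => ?_, by ring⟩
      rcases (Nat.Prime.dvd_mul hq).1 hqd with h' | h'
      · rwa [(Nat.prime_dvd_prime_iff_eq hq hp).1 h']
      · exact hb q hq h'

theorem exists_sum_two_pow_mul_eq_zero {p : ℕ} [Fact p.Prime] (hp : 2 ^ 20 < p) (u : ℕ)
    (h : p ^ 9 ≤ orderOf ((2 : ZMod p) ^ u) ^ 20) :
    ∃ e : Fin 168 → ℕ, ∑ i, ((2 : ZMod p) ^ u) ^ e i = 0 := by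
  set x := (2 : ZMod p) ^ u
  have hpos : 0 < orderOf x := by
    rcases Nat.eq_zero_or_pos (orderOf x) with h0 | h0
    · rw [h0, zero_pow (by norm_num), Nat.le_zero] at h
      exact absurd (eq_zero_of_pow_eq_zero h) (Fact.out : p.Prime).ne_zero
    · exact h0
  have hcard : ((Finset.range (orderOf x)).image (x ^ ·)).card = orderOf x := by
    rw [Finset.card_image_of_injOn, Finset.card_range]
    intro a ha b hb hab
    exact pow_injOn_Iio_orderOf (by simpa using ha) (by simpa using hb) hab
  open scoped Pointwise in
  have hmul : (Finset.range (orderOf x)).image (x ^ ·) * (Finset.range (orderOf x)).image (x ^ ·)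
      ⊆ (Finset.range (orderOf x)).image (x ^ ·) := by
    intro a ha
    obtain ⟨b, hb, c, hc, rfl⟩ := Finset.mem_mul.1 ha
    obtain ⟨i, -, rfl⟩ := Finset.mem_image.1 hb
    obtain ⟨j, -, rfl⟩ := Finset.mem_image.1 hc
    refine Finset.mem_image.2 ⟨(i + j) % orderOf x, Finset.mem_range.2 (Nat.mod_lt _ hpos), ?_⟩
    simp only [pow_mod_orderOf, pow_add]
  obtain ⟨f, hf, hsum⟩ := exists_sum_eq_zero_of_card hmul hp (by rwa [hcard])
  have hf' : ∀ i, ∃ e, x ^ e = f i := fun i => by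
    obtain ⟨e, -, he⟩ := Finset.mem_image.1 (hf i)
    exact ⟨e, he⟩
  choose e he using hf'
  exact ⟨e, by simpa [he] using hsum⟩

theorem Nat.exists_forall_modEq_of_pairwise_coprime (a m : ℕ → ℕ) (s : Finset ℕ)
    (hm : ∀ p ∈ s, m p ≠ 0) (hs : Set.Pairwise (s : Set ℕ) (Function.onFun Nat.Coprime m)) :
    ∃ k, ∀ p ∈ s, k ≡ a p [MOD m p] :=
  ⟨_, (Nat.chineseRemainderOfFinset a m s hm hs).2⟩

/-- If for each prime factor `p` of a squarefree number `n` zero is a sum of powers of `2 ^ u`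
modulo `p`, and the orders of `2 ^ u` modulo these `p` are pairwise coprime, then the sums can be
combined to a sum modulo `n`. -/
theorem exists_dvd_sum_two_pow {ι : Type*} [Fintype ι] {n : ℕ} (hn : Squarefree n) (u : ℕ)
    (hne : ∀ p ∈ n.primeFactors, orderOf ((2 : ZMod p) ^ u) ≠ 0)
    (hsum : ∀ p ∈ n.primeFactors, ∃ e : ι → ℕ, ∑ i, ((2 : ZMod p) ^ u) ^ e i = 0)
    (hcop : Set.Pairwise (n.primeFactors : Set ℕ)
      (Function.onFun Nat.Coprime fun p => orderOf ((2 : ZMod p) ^ u))) :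
    ∃ e : ι → ℕ, n ∣ ∑ i, 2 ^ e i := by
  have h1 : ∀ p, ∃ e : ι → ℕ, p ∈ n.primeFactors → ∑ i, ((2 : ZMod p) ^ u) ^ e i = 0 := by
    intro p
    by_cases hp : p ∈ n.primeFactors
    · obtain ⟨e, he⟩ := hsum p hp
      exact ⟨e, fun _ => he⟩
    · exact ⟨0, fun h => absurd h hp⟩
  choose e he using h1
  have hE : ∀ i, ∃ E, ∀ p ∈ n.primeFactors, E ≡ e p i [MOD orderOf ((2 : ZMod p) ^ u)] := fun i =>
    Nat.exists_forall_modEq_of_pairwise_coprime (fun p => e p i) _ _ hne hcop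
  choose E hE using hE
  refine ⟨fun i => u * E i, ?_⟩
  rw [← Nat.prod_primeFactors_of_squarefree hn]
  refine Finset.prod_primes_dvd _ (fun p hp => (Nat.prime_of_mem_primeFactors hp).prime) ?_
  intro p hp
  rw [← CharP.cast_eq_zero_iff (ZMod p) p]
  push_cast
  rw [← he p hp]
  refine Finset.sum_congr rfl fun i _ => ?_
  rw [pow_mul]
  exact pow_eq_pow_of_modEq (hE i p hp) (pow_orderOf_eq_one _)

theorem orderOf_dvd_pred {p : ℕ} (hp : p.Prime) (h2 : 2 < p) : orderOf (2 : ZMod p) ∣ p - 1 := by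
  have : Fact p.Prime := ⟨hp⟩
  refine ZMod.orderOf_dvd_card_sub_one fun h => ?_
  have h' : ((2 : ℕ) : ZMod p) = 0 := by exact_mod_cast h
  rw [CharP.cast_eq_zero_iff (ZMod p) p] at h'
  exact absurd (Nat.le_of_dvd two_pos h') (by omega)

/-- A squarefree number divides a sum of `168` powers of two if, for its prime factors `p`, the
order of `2` modulo `p` is large, the `z`-smooth parts of the `p - 1` are small, and the `p - 1`
do not share prime factors which are at least `z`. -/
theorem exists_dvd_sum_two_pow_of_smooth {n z W : ℕ} (hn : Squarefree n)
    (hlarge : ∀ p ∈ n.primeFactors, 2 ^ 20 < p ∧ W ^ 100 ≤ p)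
    (hord : ∀ p ∈ n.primeFactors, p ^ 6 ≤ orderOf (2 : ZMod p) ^ 13)
    (hsmooth : ∀ p ∈ n.primeFactors, ∀ s ∈ Nat.smoothNumbers z, s ∣ p - 1 → s ≤ W)
    (hshare : ∀ p ∈ n.primeFactors, ∀ q ∈ n.primeFactors, p ≠ q →
      ∀ l, l.Prime → z ≤ l → l ∣ p - 1 → ¬ l ∣ q - 1) :
    ∃ e : Fin 168 → ℕ, n ∣ ∑ i, 2 ^ e i := by
  have hex : ∀ p, ∃ ab : ℕ × ℕ, p ∈ n.primeFactors → ab.1 ∈ Nat.smoothNumbers z ∧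
      (∀ q, q.Prime → q ∣ ab.2 → z ≤ q) ∧ ab.1 * ab.2 = orderOf (2 : ZMod p) := by
    intro p
    by_cases hp : p ∈ n.primeFactors
    · have hne : orderOf (2 : ZMod p) ≠ 0 := by
        intro h0
        have h := hord p hp
        rw [h0, zero_pow (by norm_num), Nat.le_zero] at h
        exact absurd (eq_zero_of_pow_eq_zero h) (Nat.prime_of_mem_primeFactors hp).ne_zero
      obtain ⟨a, b, h⟩ := exists_mem_smoothNumbers_mul_eq z hne
      exact ⟨(a, b), fun _ => h⟩
    · exact ⟨0, fun h => absurd h hp⟩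
  choose ab hab using hex
  have hdvd : ∀ p ∈ n.primeFactors, orderOf (2 : ZMod p) ∣ p - 1 := fun p hp =>
    orderOf_dvd_pred (Nat.prime_of_mem_primeFactors hp)
      (lt_trans (by norm_num) (hlarge p hp).1)
  set u := ∏ p ∈ n.primeFactors, (ab p).1 with hu
  have hu0 : u ≠ 0 := Finset.prod_ne_zero_iff.2 fun p hp =>
    Nat.ne_zero_of_mem_smoothNumbers (hab p hp).1
  have hus : ∀ q, q.Prime → q ∣ u → q < z := by
    intro q hq hqu
    obtain ⟨p, hp, hqp⟩ := (Prime.dvd_finsetProd_iff hq.prime _).1 hqu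
    exact Nat.mem_smoothNumbers'.1 (hab p hp).1 q hq hqp
  have horder : ∀ p ∈ n.primeFactors, orderOf ((2 : ZMod p) ^ u) = (ab p).2 := by
    intro p hp
    obtain ⟨h1, h2, h3⟩ := hab p hp
    have hcop : Nat.Coprime (ab p).2 u := Nat.coprime_of_dvd fun q hq hqb hqu =>
      absurd (hus q hq hqu) (h2 q hq hqb).not_gt
    rw [orderOf_pow' _ hu0, ← h3, Nat.Coprime.gcd_mul_right_cancel _ hcop,
      Nat.gcd_eq_left (Finset.dvd_prod_of_mem (fun p => (ab p).1) hp),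
      Nat.mul_div_cancel_left _ (Nat.pos_of_ne_zero (Nat.ne_zero_of_mem_smoothNumbers h1))]
  have hord' : ∀ p ∈ n.primeFactors, p ^ 9 ≤ orderOf ((2 : ZMod p) ^ u) ^ 20 := by
    intro p hp
    rw [horder p hp]
    obtain ⟨h1, h2, h3⟩ := hab p hp
    have haW : (ab p).1 ≤ W :=
      hsmooth p hp _ h1 ((Dvd.intro _ h3).trans (hdvd p hp))
    set a := (ab p).1
    set b := (ab p).2
    have hp0 : 0 < p := (Nat.prime_of_mem_primeFactors hp).pos
    have h4 : p ^ 13 * (p ^ 9) ^ 65 ≤ p ^ 13 * (b ^ 20) ^ 65 := by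
      calc p ^ 13 * (p ^ 9) ^ 65 ≤ (p ^ 6) ^ 100 := by
            rw [← pow_mul, ← pow_add, ← pow_mul]
            exact Nat.pow_le_pow_right hp0 (by norm_num)
        _ ≤ ((a * b) ^ 13) ^ 100 := by rw [h3]; exact Nat.pow_le_pow_left (hord p hp) _
        _ = (a ^ 100) ^ 13 * (b ^ 20) ^ 65 := by
          rw [mul_pow, mul_pow, ← pow_mul, ← pow_mul, ← pow_mul, ← pow_mul]
        _ ≤ (W ^ 100) ^ 13 * (b ^ 20) ^ 65 := by gcongr
        _ ≤ _ := by gcongr; exact (hlarge p hp).2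
    exact (Nat.pow_le_pow_iff_left (by norm_num)).1 (Nat.le_of_mul_le_mul_left h4 (by positivity))
  refine exists_dvd_sum_two_pow hn u ?_ ?_ ?_
  · intro p hp h0
    have h := hord' p hp
    rw [h0, zero_pow (by norm_num), Nat.le_zero] at h
    exact absurd (eq_zero_of_pow_eq_zero h) (Nat.prime_of_mem_primeFactors hp).ne_zero
  · intro p hp
    have : Fact p.Prime := ⟨Nat.prime_of_mem_primeFactors hp⟩
    exact exists_sum_two_pow_mul_eq_zero (hlarge p hp).1 u (hord' p hp)
  · intro p hp q hq hpq
    simp only [Function.onFun]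
    rw [horder p hp, horder q hq]
    refine Nat.coprime_of_dvd fun l hl hlp hlq => ?_
    exact hshare p hp q hq hpq l hl ((hab p hp).2.1 l hl hlp)
      ((hlp.trans (Dvd.intro_left _ (hab p hp).2.2)).trans (hdvd p hp))
      ((hlq.trans (Dvd.intro_left _ (hab q hq).2.2)).trans (hdvd q hq))

theorem exists_multiset_sum_two_pow_eq (D n : ℕ) (h : n < 2 ^ D) :
    ∃ s : Multiset ℕ, s.card ≤ D ∧ (s.map fun e => 2 ^ e).sum = n := by
  induction D generalizing n with
  | zero => exact ⟨0, by simp, by simp at h; simp [h]⟩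
  | succ D ih =>
    obtain ⟨s, hs, hsum⟩ := ih (n / 2) (by rw [pow_succ] at h; omega)
    have hs2 : ((s.map (· + 1)).map fun e => 2 ^ e).sum = n / 2 * 2 := by
      simp [Multiset.map_map, pow_succ, Multiset.sum_map_mul_right, hsum]
    rcases Nat.mod_two_eq_zero_or_one n with h0 | h0
    · exact ⟨s.map (· + 1), by rw [Multiset.card_map]; omega, by rw [hs2]; omega⟩
    · refine ⟨0 ::ₘ s.map (· + 1), by rw [Multiset.card_cons, Multiset.card_map]; omega, ?_⟩
      rw [Multiset.map_cons, Multiset.sum_cons, hs2]; omega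

theorem exists_two_pow_eq_one_of_coprime {a b : ℕ} (hab : a.Coprime b) (hodd : Odd (a * b))
    (ha : a ≠ 1) (hb : b ≠ 1) :
    ∃ t, 0 < t ∧ 2 * t ≤ a * b ∧ (2 : ZMod (a * b)) ^ t = 1 := by
  obtain ⟨hoa, hob⟩ := Nat.odd_mul.1 hodd
  have h2a : 2 < a := by rcases hoa with ⟨c, rfl⟩; omega
  have h2b : 2 < b := by rcases hob with ⟨c, rfl⟩; omega
  obtain ⟨c, hc⟩ := (Nat.totient_even h2a).two_dvd
  obtain ⟨d, hd⟩ := (Nat.totient_even h2b).two_dvd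
  have hca := Nat.totient_le a
  have hdb := Nat.totient_le b
  have hc0 := Nat.totient_pos.2 (show 0 < a by omega)
  have hd0 := Nat.totient_pos.2 (show 0 < b by omega)
  refine ⟨2 * c * d, Nat.mul_pos (by omega) (by omega), ?_, ?_⟩
  · calc 2 * (2 * c * d) = (2 * c) * (2 * d) := by ring
      _ ≤ a * b := Nat.mul_le_mul (by omega) (by omega)
  · have h1 : 2 ^ (2 * c * d) ≡ 1 [MOD a] := by
      rw [pow_mul, ← hc]
      simpa using (Nat.ModEq.pow_totient (Nat.coprime_two_left.2 hoa)).pow d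
    have h3 : 2 ^ (2 * c * d) ≡ 1 [MOD b] := by
      rw [show 2 * c * d = 2 * d * c by ring, pow_mul, ← hd]
      simpa using (Nat.ModEq.pow_totient (Nat.coprime_two_left.2 hob)).pow c
    have h4 := (Nat.modEq_and_modEq_iff_modEq_mul hab).1 ⟨h1, h3⟩
    rw [← ZMod.natCast_eq_natCast_iff] at h4
    exact_mod_cast h4

/-- If `k` is odd and not a prime power, and the cofactor `n` of a divisor `a < 2 ^ D` of `k`
divides a sum of `168` powers of two, then `k ∈ 𝒞_m` for all `m ≥ 168 * D`. -/
theorem memC_of_dvd_sum_two_pow {k m a n D t : ℕ} (hk : Odd k) (ht : 0 < t) (htk : 2 * t ≤ k)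
    (h2 : (2 : ZMod k) ^ t = 1) (han : a * n = k) (haD : a < 2 ^ D) (hm : 168 * D ≤ m)
    {e : Fin 168 → ℕ} (he : n ∣ ∑ i, 2 ^ e i) : memC m k := by
  obtain ⟨s, hs, hsum⟩ := exists_multiset_sum_two_pow_eq D a haD
  have ha0 : a ≠ 0 := by rintro rfl; simp at han; exact hk.pos.ne han
  have hs0 : s.card ≠ 0 := by
    intro h0
    rw [Multiset.card_eq_zero.1 h0] at hsum
    exact ha0 (by simpa using hsum.symm)
  have hcard : (∑ i : Fin 168, s.map (e i + ·)).card = 168 * s.card := by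
    simp [Multiset.card_sum]
  refine memC_of_sum_two_pow_eq_zero hk ht htk h2 (∑ i : Fin 168, s.map (e i + ·)) ?_ ?_ ?_
  · rw [← Multiset.card_pos, hcard]; omega
  · rw [hcard]; exact (Nat.mul_le_mul_left _ hs).trans hm
  · have h3 : (((∑ i : Fin 168, s.map (e i + ·)).map fun e => 2 ^ e).sum : ℕ)
        = (∑ i, 2 ^ e i) * a := by
      rw [← hsum, Finset.sum_mul, ← Multiset.coe_mapAddMonoidHom, map_sum,
        ← Multiset.coe_sumAddMonoidHom, map_sum]
      refine Finset.sum_congr rfl fun i _ => ?_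
      simp [Multiset.map_map, pow_add, Multiset.sum_map_mul_left]
    have h4 : k ∣ ((∑ i : Fin 168, s.map (e i + ·)).map fun e => 2 ^ e).sum := by
      rw [h3, ← han, mul_comm]
      exact mul_dvd_mul_right he a
    rw [← CharP.cast_eq_zero_iff (ZMod k) k, Nat.cast_multiset_sum, Multiset.map_map] at h4
    simpa using h4

/-- The completely multiplicative function `n ↦ (3 / 2) ^ Ω n / n`. -/
noncomputable def powCardFactorsDiv : ℕ →* ℝ where
  toFun n := (3 / 2) ^ ArithmeticFunction.cardFactors n / n
  map_one' := by simp
  map_mul' a b := by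
    rcases eq_or_ne a 0 with rfl | ha
    · simp
    rcases eq_or_ne b 0 with rfl | hb
    · simp
    rw [ArithmeticFunction.cardFactors_mul ha hb, pow_add, Nat.cast_mul, mul_div_mul_comm]

theorem powCardFactorsDiv_apply (n : ℕ) :
    powCardFactorsDiv n = (3 / 2) ^ ArithmeticFunction.cardFactors n / n := rfl

theorem powCardFactorsDiv_prime {p : ℕ} (hp : p.Prime) : powCardFactorsDiv p = 3 / 2 / p := by
  rw [powCardFactorsDiv_apply, ArithmeticFunction.cardFactors_apply_prime hp, pow_one]

theorem prod_primesBelow_inv_one_sub_le {z : ℕ} (hz : 2 ≤ z) :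
    ∏ p ∈ Nat.primesBelow z, (1 - powCardFactorsDiv p)⁻¹ ≤ (z : ℝ) ^ 2 := by
  have h1 : ∏ n ∈ Finset.Ico 2 z, ((1 : ℝ) - 1 / n)⁻¹ ^ 2 = ((z : ℝ) - 1) ^ 2 := by
    induction z, hz using Nat.le_induction with
    | base => norm_num
    | succ n hn ih =>
      rw [Finset.prod_Ico_succ_top hn, ih, ← mul_pow]
      have h2 : (2 : ℝ) ≤ n := by exact_mod_cast hn
      have h3 : (n : ℝ) - 1 ≠ 0 := by linarith
      have h4 : (n : ℝ) ≠ 0 := by linarith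
      congr 1
      push_cast
      field_simp
      ring
  have h2 : (2 : ℝ) ≤ z := by exact_mod_cast hz
  calc ∏ p ∈ Nat.primesBelow z, (1 - powCardFactorsDiv p)⁻¹
      ≤ ∏ p ∈ Nat.primesBelow z, ((1 : ℝ) - 1 / p)⁻¹ ^ 2 := by
        have key : ∀ p ∈ Nat.primesBelow z, 0 < ((1 : ℝ) - 1 / p) ^ 2 ∧
            ((1 : ℝ) - 1 / p) ^ 2 ≤ 1 - powCardFactorsDiv p := by
          intro p hp
          have hp' := Nat.prime_of_mem_primesBelow hp
          have hp2 : (2 : ℝ) ≤ p := by exact_mod_cast hp'.two_le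
          rw [powCardFactorsDiv_prime hp']
          have h5 : (1 : ℝ) / p ≤ 1 / 2 := one_div_le_one_div_of_le two_pos hp2
          have h6 : (0 : ℝ) < 1 / p := by positivity
          refine ⟨by apply pow_pos; linarith, ?_⟩
          rw [show (3 : ℝ) / 2 / p = 3 / 2 * (1 / p) by ring]
          nlinarith
        refine Finset.prod_le_prod (fun p hp => ?_) fun p hp => ?_
        · exact inv_nonneg.2 ((key p hp).1.le.trans (key p hp).2)
        · rw [inv_pow]
          exact inv_anti₀ (key p hp).1 (key p hp).2
    _ ≤ ∏ n ∈ Finset.Ico 2 z, ((1 : ℝ) - 1 / n)⁻¹ ^ 2 := by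
        refine Finset.prod_le_prod_of_subset_of_one_le (fun p hp => ?_) (fun n _ => by positivity) ?_
        · exact Finset.mem_Ico.2 ⟨(Nat.prime_of_mem_primesBelow hp).two_le,
            Nat.lt_of_mem_primesBelow hp⟩
        · intro n hn _
          have hn2 : (2 : ℝ) ≤ n := by exact_mod_cast (Finset.mem_Ico.1 hn).1
          have h5 : (1 : ℝ) / n ≤ 1 / 2 := one_div_le_one_div_of_le two_pos hn2
          have h6 : (0 : ℝ) < 1 / n := by positivity
          exact one_le_pow₀ ((one_le_inv₀ (by linarith)).2 (by linarith))
    _ ≤ (z : ℝ) ^ 2 := by rw [h1]; nlinarith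

theorem le_pow_cardFactors_of_mem_smoothNumbers {z s : ℕ} (hs : s ∈ Nat.smoothNumbers z) :
    s ≤ z ^ ArithmeticFunction.cardFactors s := by
  rw [ArithmeticFunction.cardFactors_apply]
  conv_lhs => rw [← Nat.prod_primeFactorsList (Nat.ne_zero_of_mem_smoothNumbers hs)]
  exact List.prod_le_pow_card _ _ fun p hp => (hs.2 p hp).le

/-- Rankin's trick: reciprocals of the `z`-smooth numbers from `z ^ R` on have a small sum. -/
theorem sum_one_div_smoothNumbers_le {z : ℕ} (hz : 2 ≤ z) (R : ℕ) (T : Finset ℕ)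
    (hT : ∀ s ∈ T, s ∈ Nat.smoothNumbers z ∧ z ^ R ≤ s) :
    ∑ s ∈ T, (1 : ℝ) / s ≤ z ^ 2 * (2 / 3) ^ R := by
  have hlt : ∀ {p : ℕ}, p.Prime → ‖powCardFactorsDiv p‖ < 1 := by
    intro p hp
    have hp2 : (2 : ℝ) ≤ p := by exact_mod_cast hp.two_le
    rw [powCardFactorsDiv_prime hp, Real.norm_of_nonneg (by positivity), div_lt_one (by linarith)]
    linarith
  have h1 := (EulerProduct.summable_and_hasSum_smoothNumbers_prod_primesBelow_geometric
    (f := powCardFactorsDiv) hlt z).2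
  have h2 : ∑ s ∈ T, powCardFactorsDiv s ≤ (z : ℝ) ^ 2 := by
    refine le_trans ?_ (prod_primesBelow_inv_one_sub_le hz)
    rw [← Finset.sum_subtype_of_mem (fun s => powCardFactorsDiv s) fun s hs => (hT s hs).1]
    exact sum_le_hasSum _ (fun s _ => by rw [powCardFactorsDiv_apply]; positivity) h1
  calc ∑ s ∈ T, (1 : ℝ) / s ≤ ∑ s ∈ T, (2 / 3) ^ R * powCardFactorsDiv s := by
        refine Finset.sum_le_sum fun s hs => ?_
        have hR : R ≤ ArithmeticFunction.cardFactors s :=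
          (Nat.pow_le_pow_iff_right hz).1
            ((hT s hs).2.trans (le_pow_cardFactors_of_mem_smoothNumbers (hT s hs).1))
        rw [powCardFactorsDiv_apply, ← mul_div_assoc]
        gcongr
        calc (1 : ℝ) = (2 / 3) ^ R * (3 / 2) ^ R := by rw [← mul_pow]; norm_num
          _ ≤ _ := by gcongr; norm_num
    _ = (2 / 3) ^ R * ∑ s ∈ T, powCardFactorsDiv s := by rw [Finset.mul_sum]
    _ ≤ (2 / 3) ^ R * z ^ 2 := by gcongr
    _ = _ := mul_comm _ _

theorem card_filter_le_of_exists_dvd {ι : Type*} {N : ℕ} {P : ℕ → Prop} [DecidablePred P]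
    (T : Finset ι) (f : ι → ℕ) (h : ∀ k, 0 < k → k ≤ N → P k → ∃ i ∈ T, f i ∣ k) :
    (((Finset.Ioc 0 N).filter P).card : ℝ) ≤ N * ∑ i ∈ T, (1 : ℝ) / f i := by
  have h1 : (Finset.Ioc 0 N).filter P ⊆ T.biUnion fun i => (Finset.Ioc 0 N).filter (f i ∣ ·) := by
    intro k hk
    obtain ⟨hk1, hk2⟩ := Finset.mem_filter.1 hk
    obtain ⟨i, hi, hd⟩ := h k (Finset.mem_Ioc.1 hk1).1 (Finset.mem_Ioc.1 hk1).2 hk2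
    exact Finset.mem_biUnion.2 ⟨i, hi, Finset.mem_filter.2 ⟨hk1, hd⟩⟩
  calc (((Finset.Ioc 0 N).filter P).card : ℝ)
      ≤ ((∑ i ∈ T, ((Finset.Ioc 0 N).filter (f i ∣ ·)).card : ℕ) : ℝ) := by
        exact_mod_cast (Finset.card_le_card h1).trans Finset.card_biUnion_le
    _ = ∑ i ∈ T, ((N / f i : ℕ) : ℝ) := by
        push_cast
        exact Finset.sum_congr rfl fun i _ => by rw [Nat.Ioc_filter_dvd_card_eq_div]
    _ ≤ ∑ i ∈ T, (N : ℝ) * (1 / f i) := by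
        refine Finset.sum_le_sum fun i _ => ?_
        rw [mul_one_div]
        exact Nat.cast_div_le
    _ = _ := by rw [Finset.mul_sum]

open Classical in
theorem card_exists_smooth_dvd_le {N y : ℕ} (hy : 2 ≤ y) (R : ℕ) :
    (((Finset.Ioc 0 N).filter fun k => ∃ s ∈ Nat.smoothNumbers y, y ^ R ≤ s ∧ s ∣ k).card : ℝ)
      ≤ N * (y ^ 2 * (2 / 3) ^ R) := by
  refine (card_filter_le_of_exists_dvd
    ((Finset.Ioc 0 N).filter fun s => s ∈ Nat.smoothNumbers y ∧ y ^ R ≤ s) id ?_).trans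
    (mul_le_mul_of_nonneg_left (sum_one_div_smoothNumbers_le hy R _ fun s hs =>
      (Finset.mem_filter.1 hs).2) (Nat.cast_nonneg N))
  rintro k hk hkN ⟨s, hs, hsy, hsk⟩
  exact ⟨s, Finset.mem_filter.2 ⟨Finset.mem_Ioc.2 ⟨Nat.pos_of_dvd_of_pos hsk hk,
    (Nat.le_of_dvd hk hsk).trans hkN⟩, hs, hsy⟩, hsk⟩

theorem sum_Ioo_one_div_sq_le {y : ℕ} (hy : 0 < y) (N : ℕ) :
    ∑ p ∈ Finset.Ioo (y - 1) N, (1 : ℝ) / (p : ℝ) ^ 2 ≤ 2 / y := by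
  have h := sum_Ioo_inv_sq_le (α := ℝ) (y - 1) N
  rw [Nat.cast_pred hy, sub_add_cancel] at h
  simpa [one_div] using h

open Classical in
theorem card_exists_prime_sq_dvd_le {N y : ℕ} (hy : 0 < y) :
    (((Finset.Ioc 0 N).filter fun k => ∃ p, p.Prime ∧ y ≤ p ∧ p ^ 2 ∣ k).card : ℝ)
      ≤ N * (2 / y) := by
  refine (card_filter_le_of_exists_dvd (Finset.Ioo (y - 1) (N + 1)) (· ^ 2) ?_).trans
    (mul_le_mul_of_nonneg_left ?_ (Nat.cast_nonneg N))
  · rintro k hk hkN ⟨p, hp, hyp, hpk⟩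
    have := (Nat.le_of_dvd hk ((dvd_pow_self p two_ne_zero).trans hpk))
    exact ⟨p, Finset.mem_Ioo.2 ⟨by omega, by omega⟩, hpk⟩
  · simpa using sum_Ioo_one_div_sq_le hy (N + 1)

open Classical in
theorem card_exists_primes_dvd_pred_le {N z : ℕ} (hz : 0 < z) :
    (((Finset.Ioc 0 N).filter fun k => ∃ l p q, p.Prime ∧ q.Prime ∧ p ≠ q ∧ z ≤ l ∧
      l ∣ p - 1 ∧ l ∣ q - 1 ∧ p ∣ k ∧ q ∣ k).card : ℝ)
      ≤ N * (2 / z * (∑ i ∈ Finset.Ioc 0 N, (1 : ℝ) / i) ^ 2) := by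
  refine (card_filter_le_of_exists_dvd
    (Finset.Ioo (z - 1) (N + 1) ×ˢ Finset.Ioc 0 N ×ˢ Finset.Ioc 0 N)
    (fun x => (1 + x.1 * x.2.1) * (1 + x.1 * x.2.2)) ?_).trans
    (mul_le_mul_of_nonneg_left ?_ (Nat.cast_nonneg N))
  · rintro k hk hkN ⟨l, p, q, hp, hq, hpq, hzl, ⟨i, hi⟩, ⟨j, hj⟩, hpk, hqk⟩
    have hp2 := hp.two_le
    have hq2 := hq.two_le
    have hpN := (Nat.le_of_dvd hk hpk).trans hkN
    have hqN := (Nat.le_of_dvd hk hqk).trans hkN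
    have hi0 : 0 < i := Nat.pos_of_ne_zero (by rintro rfl; omega)
    have hj0 : 0 < j := Nat.pos_of_ne_zero (by rintro rfl; omega)
    have hl : l ≤ l * i := Nat.le_mul_of_pos_right _ hi0
    have hil : i ≤ l * i := Nat.le_mul_of_pos_left _ (by omega)
    have hjl : j ≤ l * j := Nat.le_mul_of_pos_left _ (by omega)
    refine ⟨(l, i, j), ?_, ?_⟩
    · simp only [Finset.mem_product, Finset.mem_Ioo, Finset.mem_Ioc]
      omega
    · rw [show 1 + (l, i, j).1 * (l, i, j).2.1 = p by simp only; omega,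
        show 1 + (l, i, j).1 * (l, i, j).2.2 = q by simp only; omega]
      exact ((Nat.coprime_primes hp hq).2 hpq).mul_dvd_of_dvd_of_dvd hpk hqk
  · have h0 : (0 : ℝ) ≤ (∑ i ∈ Finset.Ioc 0 N, (1 : ℝ) / i) ^ 2 := sq_nonneg _
    refine le_trans ?_ (mul_le_mul_of_nonneg_right (sum_Ioo_one_div_sq_le hz (N + 1)) h0)
    rw [sq (∑ i ∈ _, _), Finset.sum_mul_sum, ← Finset.sum_product', Finset.sum_mul_sum,
      ← Finset.sum_product']
    refine Finset.sum_le_sum fun x hx => ?_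
    simp only [Finset.mem_product, Finset.mem_Ioo, Finset.mem_Ioc] at hx
    have h1 : (0 : ℝ) < x.1 := by exact_mod_cast (show 0 < x.1 by omega)
    have h2 : (0 : ℝ) < x.2.1 := by exact_mod_cast hx.2.1.1
    have h3 : (0 : ℝ) < x.2.2 := by exact_mod_cast hx.2.2.1
    rw [one_div_mul_one_div, one_div_mul_one_div]
    refine one_div_le_one_div_of_le (by positivity) ?_
    push_cast
    nlinarith [mul_pos h1 h2, mul_pos h1 h3]

open Classical in
theorem card_exists_prime_dvd_smooth_dvd_pred_le {N z : ℕ} (hz : 2 ≤ z) (R : ℕ) :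
    (((Finset.Ioc 0 N).filter fun k => ∃ p, p.Prime ∧ p ∣ k ∧ ∃ s ∈ Nat.smoothNumbers z,
      z ^ R ≤ s ∧ s ∣ p - 1).card : ℝ)
      ≤ N * (z ^ 2 * (2 / 3) ^ R * ∑ i ∈ Finset.Ioc 0 N, (1 : ℝ) / i) := by
  refine (card_filter_le_of_exists_dvd
    (((Finset.Ioc 0 N).filter fun s => s ∈ Nat.smoothNumbers z ∧ z ^ R ≤ s) ×ˢ Finset.Ioc 0 N)
    (fun x => 1 + x.1 * x.2) ?_).trans
    (mul_le_mul_of_nonneg_left ?_ (Nat.cast_nonneg N))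
  · rintro k hk hkN ⟨p, hp, hpk, s, hs, hsz, i, hi⟩
    have hp2 := hp.two_le
    have hpN := (Nat.le_of_dvd hk hpk).trans hkN
    have hi0 : 0 < i := Nat.pos_of_ne_zero (by rintro rfl; omega)
    have hs0 := Nat.pos_of_ne_zero (Nat.ne_zero_of_mem_smoothNumbers hs)
    have hl : s ≤ s * i := Nat.le_mul_of_pos_right _ hi0
    have hil : i ≤ s * i := Nat.le_mul_of_pos_left _ hs0
    refine ⟨(s, i), ?_, ?_⟩
    · simp only [Finset.mem_product, Finset.mem_filter, Finset.mem_Ioc]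
      exact ⟨⟨by omega, hs, hsz⟩, by omega⟩
    · rwa [show 1 + (s, i).1 * (s, i).2 = p by simp only; omega]
  · refine le_trans ?_ (mul_le_mul_of_nonneg_right (sum_one_div_smoothNumbers_le hz R
      ((Finset.Ioc 0 N).filter fun s => s ∈ Nat.smoothNumbers z ∧ z ^ R ≤ s) fun s hs =>
      (Finset.mem_filter.1 hs).2) (Finset.sum_nonneg fun i _ => by positivity))
    rw [Finset.sum_mul_sum, ← Finset.sum_product']
    refine Finset.sum_le_sum fun x hx => ?_
    simp only [Finset.mem_product, Finset.mem_filter, Finset.mem_Ioc] at hx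
    have h1 : (0 : ℝ) < x.1 := by exact_mod_cast hx.1.1.1
    have h2 : (0 : ℝ) < x.2 := by exact_mod_cast hx.2.1
    rw [one_div_mul_one_div]
    refine one_div_le_one_div_of_le (by positivity) ?_
    push_cast
    linarith

theorem card_le_of_orderOf_eq {n : ℕ} (hn : n ≠ 0) (T : Finset ℕ)
    (hT : ∀ p ∈ T, p.Prime ∧ orderOf (2 : ZMod p) = n) : T.card ≤ n := by
  have h1 : ∏ p ∈ T, p ∣ 2 ^ n - 1 := by
    refine Finset.prod_primes_dvd _ (fun p hp => (hT p hp).1.prime) fun p hp => ?_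
    rw [← CharP.cast_eq_zero_iff (ZMod p) p, Nat.cast_sub Nat.one_le_two_pow]
    push_cast
    rw [← (hT p hp).2, pow_orderOf_eq_one, sub_self]
  have h2 : 2 ^ T.card ≤ ∏ p ∈ T, p := Finset.pow_card_le_prod _ _ _ fun p hp => (hT p hp).1.two_le
  have h3 : 1 < 2 ^ n := Nat.one_lt_two_pow hn
  have h4 := Nat.le_of_dvd (by omega) h1
  exact (Nat.pow_le_pow_iff_right (a := 2) one_lt_two).1 (by omega)

open Classical in
theorem card_exists_prime_orderOf_sq_le {N B : ℕ} (hB : 0 < B) :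
    (((Finset.Ioc 0 N).filter fun k => ∃ p, p.Prime ∧ 2 < p ∧ p ∣ k ∧
      B * orderOf (2 : ZMod p) ^ 2 ≤ p).card : ℝ)
      ≤ N * (1 / B * ∑ i ∈ Finset.Ioc 0 N, (1 : ℝ) / i) := by
  set T := (Finset.Ioc 0 N).filter fun p => p.Prime ∧ 2 < p ∧
    B * orderOf (2 : ZMod p) ^ 2 ≤ p
  refine (card_filter_le_of_exists_dvd T id ?_).trans
    (mul_le_mul_of_nonneg_left ?_ (Nat.cast_nonneg N))
  · rintro k hk hkN ⟨p, hp, hp2, hpk, hpB⟩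
    exact ⟨p, Finset.mem_filter.2 ⟨Finset.mem_Ioc.2 ⟨hp.pos,
      (Nat.le_of_dvd hk hpk).trans hkN⟩, hp, hp2, hpB⟩, hpk⟩
  · have hmaps : ∀ p ∈ T, orderOf (2 : ZMod p) ∈ Finset.Ioc 0 N := by
      intro p hp
      obtain ⟨h1, h2, h3, -⟩ := Finset.mem_filter.1 hp
      have h4 := orderOf_dvd_pred h2 h3
      have h5 := Nat.le_of_dvd (by omega) h4
      have h6 := Nat.pos_of_dvd_of_pos h4 (by omega)
      have h7 := (Finset.mem_Ioc.1 h1).2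
      exact Finset.mem_Ioc.2 ⟨h6, by omega⟩
    rw [← Finset.sum_fiberwise_of_maps_to hmaps, Finset.mul_sum]
    refine Finset.sum_le_sum fun n hn => ?_
    have hn0 : 0 < n := (Finset.mem_Ioc.1 hn).1
    have hnR : (0 : ℝ) < n := by exact_mod_cast hn0
    have hBR : (0 : ℝ) < B := by exact_mod_cast hB
    calc ∑ p ∈ T with orderOf (2 : ZMod p) = n, (1 : ℝ) / (id p : ℕ)
        ≤ ∑ p ∈ T with orderOf (2 : ZMod p) = n, (1 : ℝ) / (B * n ^ 2) := by
          refine Finset.sum_le_sum fun p hp => ?_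
          obtain ⟨h1, rfl⟩ := Finset.mem_filter.1 hp
          refine one_div_le_one_div_of_le (by positivity) ?_
          exact_mod_cast (Finset.mem_filter.1 h1).2.2.2
      _ = (T.filter fun p => orderOf (2 : ZMod p) = n).card * ((1 : ℝ) / (B * n ^ 2)) := by
          rw [Finset.sum_const, nsmul_eq_mul]
      _ ≤ n * ((1 : ℝ) / (B * n ^ 2)) := by
          refine mul_le_mul_of_nonneg_right ?_ (by positivity)
          refine Nat.cast_le.2 (card_le_of_orderOf_eq hn0.ne' _ fun p hp => ?_)
          obtain ⟨h1, h2⟩ := Finset.mem_filter.1 hp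
          exact ⟨(Finset.mem_filter.1 h1).2.1, h2⟩
      _ = 1 / B * (1 / n) := by field_simp

theorem exists_coprime_mul_eq {k y : ℕ} (hk1 : 1 < k) (hk : ¬ k.Prime)
    (hsmooth : k ∉ Nat.smoothNumbers y)
    (hsq : ∀ p, p.Prime → y ≤ p → ¬ p ^ 2 ∣ k) :
    ∃ a b, a.Coprime b ∧ a ≠ 1 ∧ b ≠ 1 ∧ a * b = k := by
  have hp := Nat.minFac_prime hk1.ne'
  have hpk := Nat.minFac_dvd k
  set p := k.minFac
  have hk0 : k ≠ 0 := by omega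
  have hmul := Nat.ordProj_mul_ordCompl_eq_self k p
  have hpos := hp.factorization_pos_of_dvd hk0 hpk
  refine ⟨_, _, (Nat.coprime_ordCompl hp hk0).pow_left _, ?_, ?_, hmul⟩
  · exact (Nat.one_lt_pow hpos.ne' hp.one_lt).ne'
  · intro h1
    rw [h1, mul_one] at hmul
    rcases lt_or_ge p y with h | h
    · refine hsmooth (Nat.mem_smoothNumbers'.2 fun q hq hqk => ?_)
      rw [← hmul] at hqk
      rwa [(Nat.prime_dvd_prime_iff_eq hq hp).1 (hq.dvd_of_dvd_pow hqk)]
    · refine hsq p hp h ?_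
      have h2 : k.factorization p ≠ 1 := by
        intro h2
        rw [h2, pow_one] at hmul
        exact hk (hmul ▸ hp)
      conv_rhs => rw [← hmul]
      exact pow_dvd_pow p (by omega)

theorem memC_of_forall {k m y z R R' D B : ℕ} (hk : Odd k) (hprime : ¬ k.Prime)
    (hy : 2 ^ 20 < y) (hyz : (z ^ R') ^ 100 ≤ y) (hyB : B ^ 13 ≤ y) (hB : 0 < B)
    (hyk : y ^ R ≤ k) (hR : 0 < R) (hD : y ^ R ≤ 2 ^ D) (hm : 168 * D ≤ m)
    (hsmooth : ∀ s ∈ Nat.smoothNumbers y, s ∣ k → s < y ^ R)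
    (hsq : ∀ p, p.Prime → y ≤ p → ¬ p ^ 2 ∣ k)
    (hshare : ∀ l p q, p.Prime → q.Prime → p ≠ q → z ≤ l → l ∣ p - 1 → l ∣ q - 1 →
      p ∣ k → ¬ q ∣ k)
    (hord : ∀ p, p.Prime → 2 < p → p ∣ k → p < B * orderOf (2 : ZMod p) ^ 2)
    (hpred : ∀ p, p.Prime → p ∣ k → ∀ s ∈ Nat.smoothNumbers z, s ∣ p - 1 → s < z ^ R') :
    memC m k := by
  have hk1 : 1 < k := by
    have := Nat.le_self_pow hR.ne' y
    omega
  have hks : k ∉ Nat.smoothNumbers y := fun h => (hsmooth k h dvd_rfl).not_ge hyk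
  obtain ⟨c, d, hcd, hc, hd, hcdk⟩ := exists_coprime_mul_eq hk1 hprime hks hsq
  obtain ⟨t, ht0, ht, h2t⟩ := exists_two_pow_eq_one_of_coprime hcd (hcdk ▸ hk) hc hd
  rw [hcdk] at ht h2t
  obtain ⟨a, n, ha, hn, han⟩ := exists_mem_smoothNumbers_mul_eq y (show k ≠ 0 by omega)
  have hnk : n ∣ k := Dvd.intro_left _ han
  have hfac : ∀ p ∈ n.primeFactors, p.Prime ∧ p ∣ k ∧ y ≤ p := fun p hp =>
    ⟨Nat.prime_of_mem_primeFactors hp, (Nat.dvd_of_mem_primeFactors hp).trans hnk,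
      hn p (Nat.prime_of_mem_primeFactors hp) (Nat.dvd_of_mem_primeFactors hp)⟩
  have hnsq : Squarefree n := by
    refine Nat.squarefree_iff_prime_squarefree.2 fun p hp hpn => ?_
    exact hsq p hp (hn p hp ((Dvd.intro _ rfl).trans hpn)) (by rw [sq]; exact hpn.trans hnk)
  obtain ⟨e, he⟩ := exists_dvd_sum_two_pow_of_smooth (z := z) (W := z ^ R') hnsq
    (fun p hp => by
      obtain ⟨h1, h2, h3⟩ := hfac p hp
      exact ⟨by omega, hyz.trans h3⟩)
    (fun p hp => by
      obtain ⟨h1, h2, h3⟩ := hfac p hp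
      have h4 := hord p h1 (by omega) h2
      set n := orderOf (2 : ZMod p)
      have h5 : p ^ 12 * B ^ 13 ≤ n ^ 26 * B ^ 13 := by
        calc p ^ 12 * B ^ 13 ≤ p ^ 12 * p := by gcongr; exact hyB.trans h3
          _ = p ^ 13 := by ring
          _ ≤ (B * n ^ 2) ^ 13 := by gcongr
          _ = _ := by ring
      have h6 : (p ^ 6) ^ 2 ≤ (n ^ 13) ^ 2 := by
        rw [← pow_mul, ← pow_mul]
        exact Nat.le_of_mul_le_mul_right h5 (by positivity)
      exact (Nat.pow_le_pow_iff_left two_ne_zero).1 h6)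
    (fun p hp s hs hsp => (hpred p (hfac p hp).1 (hfac p hp).2.1 s hs hsp).le)
    (fun p hp q hq hpq l _ hzl hlp hlq => hshare l p q (hfac p hp).1 (hfac q hq).1 hpq hzl hlp hlq
      (hfac p hp).2.1 (hfac q hq).2.1)
  exact memC_of_dvd_sum_two_pow hk ht0 ht h2t han
    ((hsmooth a ha (Dvd.intro _ han)).trans_le hD) hm he

open Classical in
/-- With the exception of few values, odd numbers `k ≤ N` lie in `𝒞_m` for all `m` which are at
least a constant times `(log log N) ^ 4`. -/
theorem card_not_forall_memC_le {N v : ℕ} (hv : 0 < v)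
    (hH : ∑ i ∈ Finset.Ioc 0 N, (1 : ℝ) / i ≤ 2 ^ v) :
    (((Finset.Ioc 0 N).filter fun k => Odd k ∧ ¬ k.Prime ∧ 2 ^ (96000000 * v ^ 4) ≤ k ∧
      ¬ ∀ m, 2 ^ 34 * v ^ 4 ≤ m → memC m k).card : ℝ) ≤ 6 * (N / 2 ^ v) := by
  set y := 2 ^ (4800 * v ^ 2) with hy
  set z := 2 ^ (3 * v) with hz
  set R := 20000 * v ^ 2 with hR
  set R' := 16 * v with hR'
  set B := 2 ^ (2 * v) with hB
  have hv2 : v ≤ v ^ 2 := Nat.le_self_pow two_ne_zero v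
  have hyR : y ^ R = 2 ^ (96000000 * v ^ 4) := by
    rw [hy, hR, ← pow_mul]; congr 1; ring
  have hyv : 2 * 2 ^ v ≤ y := by
    rw [← pow_succ', hy]; exact Nat.pow_le_pow_right two_pos (by omega)
  have hy2 : 2 ≤ y := le_trans (by have := Nat.one_le_two_pow (n := v); omega) hyv
  have hz2 : 2 ≤ z := Nat.le_self_pow (by omega) 2
  have hsub : ((Finset.Ioc 0 N).filter fun k => Odd k ∧ ¬ k.Prime ∧ 2 ^ (96000000 * v ^ 4) ≤ k ∧
      ¬ ∀ m, 2 ^ 34 * v ^ 4 ≤ m → memC m k) ⊆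
      ((Finset.Ioc 0 N).filter fun k => ∃ s ∈ Nat.smoothNumbers y, y ^ R ≤ s ∧ s ∣ k) ∪
      (((Finset.Ioc 0 N).filter fun k => ∃ p, p.Prime ∧ y ≤ p ∧ p ^ 2 ∣ k) ∪
      (((Finset.Ioc 0 N).filter fun k => ∃ l p q, p.Prime ∧ q.Prime ∧ p ≠ q ∧ z ≤ l ∧
        l ∣ p - 1 ∧ l ∣ q - 1 ∧ p ∣ k ∧ q ∣ k) ∪
      (((Finset.Ioc 0 N).filter fun k => ∃ p, p.Prime ∧ p ∣ k ∧ ∃ s ∈ Nat.smoothNumbers z,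
        z ^ R' ≤ s ∧ s ∣ p - 1) ∪
      ((Finset.Ioc 0 N).filter fun k => ∃ p, p.Prime ∧ 2 < p ∧ p ∣ k ∧
        B * orderOf (2 : ZMod p) ^ 2 ≤ p)))) := by
    intro k hk
    obtain ⟨hkN, hodd, hprime, hbig, hmem⟩ := Finset.mem_filter.1 hk
    simp only [Finset.mem_union, Finset.mem_filter, hkN, true_and]
    by_contra! hcon
    obtain ⟨ha, hb, hc, hd, he⟩ := hcon
    refine hmem fun m hm => memC_of_forall (y := y) (z := z) (R := R) (R' := R') (B := B)
      (D := 96000000 * v ^ 4) hodd hprime ?_ ?_ ?_ (by positivity) (hyR ▸ hbig) (by positivity)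
      hyR.le (by omega) ?_ hb ?_ (fun p hp h2 hpk => he p hp h2 hpk) ?_
    · exact Nat.pow_lt_pow_right one_lt_two (by omega)
    · rw [hy, hz, hR', ← pow_mul, ← pow_mul]
      exact Nat.pow_le_pow_right two_pos (by rw [sq]; nlinarith)
    · rw [hy, hB, ← pow_mul]
      exact Nat.pow_le_pow_right two_pos (by omega)
    · exact fun s hs hsk => not_le.1 fun h => ha s hs h hsk
    · exact fun l p q hp hq hpq hzl hlp hlq hpk hqk => hc l p q hp hq hpq hzl hlp hlq hpk hqk
    · exact fun p hp hpk s hs hsp => not_le.1 fun h => hd p hp hpk s hs h hsp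
  have h23 : ∀ n : ℕ, (2 / 3 : ℝ) ^ (2 * n) ≤ ((2 : ℝ) ^ n)⁻¹ := fun n => by
    rw [pow_mul, ← inv_pow]
    exact pow_le_pow_left₀ (by norm_num) (by norm_num) n
  have hpos : (0 : ℝ) < 2 ^ v := by positivity
  have hN : (0 : ℝ) ≤ N := Nat.cast_nonneg N
  have e1 : (y : ℝ) ^ 2 * (2 / 3) ^ R ≤ 1 / 2 ^ v := by
    calc (y : ℝ) ^ 2 * (2 / 3) ^ R ≤ (y : ℝ) ^ 2 * ((2 : ℝ) ^ (10000 * v ^ 2))⁻¹ := by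
          gcongr
          rw [hR, show 20000 * v ^ 2 = 2 * (10000 * v ^ 2) by ring]
          exact h23 _
      _ ≤ 1 / 2 ^ v := by
          rw [← div_eq_mul_inv, div_le_div_iff₀ (by positivity) hpos, hy]
          push_cast
          rw [← pow_mul, ← pow_add, one_mul]
          exact pow_le_pow_right₀ one_le_two (by omega)
  have e2 : (2 : ℝ) / y ≤ 1 / 2 ^ v := by
    rw [div_le_div_iff₀ (by positivity) hpos, one_mul]
    exact_mod_cast hyv
  have hH0 : 0 ≤ ∑ i ∈ Finset.Ioc 0 N, (1 : ℝ) / i := Finset.sum_nonneg fun i _ => by positivity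
  have e3 : (2 : ℝ) / z * (∑ i ∈ Finset.Ioc 0 N, (1 : ℝ) / i) ^ 2 ≤ 2 / 2 ^ v := by
    calc (2 : ℝ) / z * (∑ i ∈ Finset.Ioc 0 N, (1 : ℝ) / i) ^ 2 ≤ 2 / z * (2 ^ v) ^ 2 := by gcongr
      _ = 2 / 2 ^ v := by
          rw [hz, pow_mul']
          push_cast
          field_simp
  have e4 : (z : ℝ) ^ 2 * (2 / 3) ^ R' * ∑ i ∈ Finset.Ioc 0 N, (1 : ℝ) / i ≤ 1 / 2 ^ v := by
    calc (z : ℝ) ^ 2 * (2 / 3) ^ R' * ∑ i ∈ Finset.Ioc 0 N, (1 : ℝ) / i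
        ≤ (z : ℝ) ^ 2 * ((2 : ℝ) ^ (8 * v))⁻¹ * 2 ^ v := by
          gcongr
          rw [hR', show 16 * v = 2 * (8 * v) by ring]
          exact h23 _
      _ = 1 / 2 ^ v := by
          rw [hz, pow_mul', pow_mul']
          push_cast
          field_simp
  have e5 : (1 : ℝ) / B * ∑ i ∈ Finset.Ioc 0 N, (1 : ℝ) / i ≤ 1 / 2 ^ v := by
    calc (1 : ℝ) / B * ∑ i ∈ Finset.Ioc 0 N, (1 : ℝ) / i ≤ 1 / B * 2 ^ v := by gcongr
      _ = 1 / 2 ^ v := by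
          rw [hB, pow_mul']
          push_cast
          field_simp
  have f1 := (card_exists_smooth_dvd_le (N := N) hy2 R).trans (mul_le_mul_of_nonneg_left e1 hN)
  have f2 := (card_exists_prime_sq_dvd_le (N := N) (show 0 < y by omega)).trans
    (mul_le_mul_of_nonneg_left e2 hN)
  have f3 := (card_exists_primes_dvd_pred_le (N := N) (show 0 < z by omega)).trans
    (mul_le_mul_of_nonneg_left e3 hN)
  have f4 := (card_exists_prime_dvd_smooth_dvd_pred_le (N := N) hz2 R').trans
    (mul_le_mul_of_nonneg_left e4 hN)
  have f5 := (card_exists_prime_orderOf_sq_le (N := N) (show 0 < B by positivity)).trans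
    (mul_le_mul_of_nonneg_left e5 hN)
  refine (Nat.cast_le.2 (Finset.card_le_card hsub)).trans ?_
  refine (Nat.cast_le.2 ((Finset.card_union_le _ _).trans (Nat.add_le_add_left
    ((Finset.card_union_le _ _).trans (Nat.add_le_add_left ((Finset.card_union_le _ _).trans
    (Nat.add_le_add_left (Finset.card_union_le _ _) _)) _)) _))).trans ?_
  push_cast
  rw [show (6 : ℝ) * (N / 2 ^ v) = N * (1 / 2 ^ v) + (N * (1 / 2 ^ v) + (N * (2 / 2 ^ v) +
    (N * (1 / 2 ^ v) + N * (1 / 2 ^ v)))) by ring]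
  exact add_le_add f1 (add_le_add f2 (add_le_add f3 (add_le_add f4 f5)))

theorem sum_Ioc_one_div_le_one_add_log (N : ℕ) :
    ∑ i ∈ Finset.Ioc 0 N, (1 : ℝ) / i ≤ 1 + Real.log N := by
  refine le_trans (le_of_eq ?_) (harmonic_le_one_add_log N)
  rw [harmonic_eq_sum_Icc]
  push_cast
  exact Finset.sum_congr rfl fun i _ => one_div _

theorem pow_five_le_exp_plog {x : ℝ} (h1 : 1 ≤ Real.log x) (h2 : 1 ≤ Real.log (Real.log x)) :
    Real.log (Real.log x) ^ 5 ≤ Real.exp (4000 * plog (plog (plog x)) ^ 3) := by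
  have e1 : plog x = Real.log x := max_eq_left h1
  have e2 : plog (plog x) = Real.log (Real.log x) := by rw [e1]; exact max_eq_left h2
  rw [e2]
  set t := Real.log (Real.log x)
  have h3 : 1 ≤ plog t := le_max_right _ _
  have h4 : Real.log t ≤ plog t := le_max_left _ _
  have h5 : plog t ≤ plog t ^ 3 := le_self_pow₀ h3 (by norm_num)
  calc t ^ 5 = Real.exp (5 * Real.log t) := by
        rw [mul_comm, Real.exp_mul, Real.exp_log (by linarith)]
        exact_mod_cast rfl
    _ ≤ _ := Real.exp_le_exp.2 (by linarith)

theorem le_mfun {x : ℝ} {k n : ℕ} (hx0 : 0 < x) (hlx : 2 ≤ Real.log x)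
    (hx : 4 ≤ Real.log (Real.log x)) (hk : √x ≤ k)
    (hn : (n : ℝ) ≤ (Real.log (Real.log x) / 2) ^ 5) : n ≤ mfun k := by
  have h1 : Real.log x / 2 ≤ Real.log k := by
    rw [← Real.log_sqrt hx0.le]
    exact Real.log_le_log (Real.sqrt_pos.2 hx0) hk
  have h2 : Real.log (Real.log x) / 2 ≤ Real.log (Real.log k) := by
    have h3 := Real.log_le_log (by linarith) h1
    rw [Real.log_div (by linarith) two_ne_zero] at h3
    linarith [Real.log_two_lt_d9]
  refine Nat.le_floor (hn.trans (le_trans ?_ (pow_five_le_exp_plog (by linarith) (by linarith))))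
  gcongr

open Classical in
/-- The number of odd `k ≤ N` with `k ∉ 𝒞_(m(k))`. -/
noncomputable def exceptionCount (N : ℕ) : ℕ :=
  ((Finset.Ioc 0 N).filter fun k => Odd k ∧ ¬ memC (mfun k) k).card

theorem exceptionCount_le_self (N : ℕ) : exceptionCount N ≤ N := by
  classical
  exact (Finset.card_filter_le _ _).trans (by simp)

theorem exceptionCount_le {x : ℝ} {v : ℕ} (hx : 1 ≤ x) (hv : 0 < v)
    (hxv : 1 + Real.log x ≤ 2 ^ v) (hv4 : (2 : ℝ) ^ (96000000 * v ^ 4) ≤ √x)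
    (hm : ∀ k : ℕ, √x ≤ k → 2 ^ 34 * v ^ 4 ≤ mfun k) :
    (exceptionCount ⌊x⌋₊ : ℝ) ≤ √x + (Nat.primeCounting ⌊x⌋₊ + 6 * (x / 2 ^ v)) := by
  classical
  have hN : 0 < ⌊x⌋₊ := Nat.floor_pos.2 hx
  have hNx : (⌊x⌋₊ : ℝ) ≤ x := Nat.floor_le (by linarith)
  set N := ⌊x⌋₊
  have hsub : ((Finset.Ioc 0 N).filter fun k => Odd k ∧ ¬ memC (mfun k) k) ⊆
      Finset.Ioc 0 ⌊√x⌋₊ ∪ (N.primesLE ∪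
      ((Finset.Ioc 0 N).filter fun k => Odd k ∧ ¬ k.Prime ∧ 2 ^ (96000000 * v ^ 4) ≤ k ∧
        ¬ ∀ m, 2 ^ 34 * v ^ 4 ≤ m → memC m k)) := by
    intro k hk
    obtain ⟨hkN, hodd, hmem⟩ := Finset.mem_filter.1 hk
    rw [Finset.mem_union, Finset.mem_union]
    rcases le_or_gt (k : ℝ) √x with h | h
    · exact Or.inl (Finset.mem_Ioc.2 ⟨(Finset.mem_Ioc.1 hkN).1, Nat.le_floor h⟩)
    · by_cases hp : k.Prime
      · exact Or.inr (Or.inl (Nat.mem_primesLE.2 ⟨(Finset.mem_Ioc.1 hkN).2, hp⟩))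
      · refine Or.inr (Or.inr (Finset.mem_filter.2 ⟨hkN, hodd, hp, ?_, fun h' =>
          hmem (h' _ (hm k h.le))⟩))
        exact_mod_cast hv4.trans h.le
  have hH : ∑ i ∈ Finset.Ioc 0 N, (1 : ℝ) / i ≤ 2 ^ v := by
    refine (sum_Ioc_one_div_le_one_add_log N).trans (le_trans ?_ hxv)
    gcongr
  refine (Nat.cast_le.2 ((Finset.card_le_card hsub).trans ((Finset.card_union_le _ _).trans
    (Nat.add_le_add_left (Finset.card_union_le _ _) _)))).trans ?_
  push_cast
  rw [Nat.card_Ioc, Nat.sub_zero, Nat.primesLE_card_eq_primeCounting]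
  refine add_le_add (Nat.floor_le (Real.sqrt_nonneg x)) (add_le_add le_rfl ?_)
  refine (card_not_forall_memC_le hv hH).trans ?_
  gcongr

theorem eventually_exceptionCount_le :
    ∀ᶠ x : ℝ in atTop, (exceptionCount ⌊x⌋₊ : ℝ) ≤ 10 * (x / Real.log x) := by
  have hll : Tendsto (fun x : ℝ => Real.log (Real.log x)) atTop atTop :=
    Real.tendsto_log_atTop.comp Real.tendsto_log_atTop
  have hpow : ∀ᶠ x : ℝ in atTop, Real.log x ^ 4 ≤ 1 / 2 ^ 40 * x := by
    filter_upwards [(Real.isLittleO_pow_log_id_atTop (n := 4)).bound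
      (show (0 : ℝ) < 1 / 2 ^ 40 by norm_num), eventually_ge_atTop 0] with x hx hx0
    simpa [Real.norm_of_nonneg hx0] using (le_abs_self _).trans hx
  have hsq : ∀ᶠ x : ℝ in atTop, Real.log x ^ 2 ≤ x := by
    filter_upwards [(Real.isLittleO_pow_log_id_atTop (n := 2)).bound one_pos,
      eventually_ge_atTop 0] with x hx hx0
    simpa [abs_of_nonneg hx0] using hx
  filter_upwards [hll.eventually_ge_atTop (2 ^ 49), Real.tendsto_log_atTop.eventually hpow, hsq,
    Chebyshev.eventually_primeCounting_le one_pos, Real.tendsto_log_atTop.eventually_ge_atTop 2,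
    eventually_ge_atTop 1] with x hl hl4 hsq hprime hlog hx1
  set l := Real.log (Real.log x) with hldef
  have hx0 : 0 < x := by linarith
  have hlx0 : 0 < Real.log x := by linarith
  set v := ⌈4 * l⌉₊
  have hv1 : 4 * l ≤ v := Nat.le_ceil _
  have hv2 : (v : ℝ) ≤ 5 * l := by
    have := Nat.ceil_lt_add_one (show 0 ≤ 4 * l by linarith)
    linarith
  have hv0 : 0 < v := by exact_mod_cast (show (0 : ℝ) < v by linarith)
  have hv4 : (v : ℝ) ^ 4 ≤ 625 * l ^ 4 := by
    calc (v : ℝ) ^ 4 ≤ (5 * l) ^ 4 := by gcongr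
      _ = _ := by ring
  have h2v : Real.log x ^ 2 ≤ 2 ^ v := by
    calc Real.log x ^ 2 = Real.exp (2 * l) := by
          rw [mul_comm, Real.exp_mul, Real.exp_log hlx0]
          exact_mod_cast rfl
      _ ≤ Real.exp (Real.log 2 * v) := Real.exp_le_exp.2 (by nlinarith [Real.log_two_gt_d9])
      _ = 2 ^ v := by
          rw [Real.exp_mul, Real.exp_log two_pos]
          exact_mod_cast rfl
  have hsqrt : Real.log x ≤ √x := Real.le_sqrt_of_sq_le hsq
  have hexp : (2 : ℝ) ^ (96000000 * v ^ 4) ≤ √x := by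
    calc (2 : ℝ) ^ (96000000 * v ^ 4) ≤ Real.exp 1 ^ (96000000 * v ^ 4) := by
          gcongr
          linarith [Real.exp_one_gt_d9]
      _ = Real.exp (96000000 * v ^ 4) := by
          rw [← Real.exp_nat_mul, mul_one]
          push_cast
          rfl
      _ ≤ Real.exp (Real.log √x) := by
          rw [Real.log_sqrt hx0.le]
          exact Real.exp_le_exp.2 (by linarith)
      _ = √x := Real.exp_log (Real.sqrt_pos.2 hx0)
  have hm : ∀ k : ℕ, √x ≤ k → 2 ^ 34 * v ^ 4 ≤ mfun k := fun k hk => by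
    refine le_mfun hx0 hlog (by linarith) hk ?_
    rw [Nat.cast_mul, Nat.cast_pow, Nat.cast_pow, Nat.cast_ofNat]
    calc (2 : ℝ) ^ 34 * v ^ 4 ≤ 2 ^ 34 * (625 * l ^ 4) := by gcongr
      _ ≤ (2 ^ 49 / 32) * l ^ 4 := by
          have : 0 ≤ l ^ 4 := by positivity
          linarith
      _ ≤ (l / 32) * l ^ 4 := by gcongr
      _ = (l / 2) ^ 5 := by ring
  have hmain := exceptionCount_le hx1 hv0 (by nlinarith) hexp hm
  have e1 : √x ≤ x / Real.log x := by
    rw [le_div_iff₀ hlx0]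
    calc √x * Real.log x ≤ √x * √x := by gcongr
      _ = x := Real.mul_self_sqrt hx0.le
  have e2 : x / 2 ^ v ≤ x / Real.log x := by
    gcongr
    nlinarith
  have e3 : (Real.log 4 + 1) * x / Real.log x ≤ 3 * (x / Real.log x) := by
    rw [mul_div_assoc]
    gcongr
    rw [show (4 : ℝ) = 2 ^ 2 by norm_num, Real.log_pow]
    push_cast
    linarith [Real.log_two_lt_d9]
  linarith

theorem card_filter_odd_Ioc (N : ℕ) : ((Finset.Ioc 0 N).filter Odd).card = (N + 1) / 2 := by
  induction N with
  | zero => simp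
  | succ n ih =>
    rw [← Finset.insert_Ioc_right_eq_Ioc_add_one (Nat.zero_le n), Finset.filter_insert]
    split_ifs with h
    · rw [Finset.card_insert_of_notMem (by simp), ih]
      obtain ⟨c, hc⟩ := h
      omega
    · rw [ih]
      obtain ⟨c, hc⟩ := Nat.not_odd_iff_even.1 h
      omega

theorem ncard_not_memC_eq (x : ℝ) :
    {k : ℕ | Odd k ∧ 0 < k ∧ (k : ℝ) ≤ x ∧ ¬ memC (mfun k) k}.ncard = exceptionCount ⌊x⌋₊ := by
  classical
  rw [exceptionCount, ← Set.ncard_coe_finset]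
  congr 1
  ext k
  simp only [Set.mem_ofPred_eq, Finset.coe_filter, Finset.mem_Ioc]
  constructor
  · rintro ⟨h1, h2, h3, h4⟩
    exact ⟨⟨h2, Nat.le_floor h3⟩, h1, h4⟩
  · rintro ⟨⟨h2, h3⟩, h1, h4⟩
    exact ⟨h1, h2, (Nat.le_floor_iff' h2.ne').1 h3, h4⟩

theorem ncard_memC_add_exceptionCount (x : ℝ) :
    {k : ℕ | Odd k ∧ (k : ℝ) ≤ x ∧ memC (mfun k) k}.ncard + exceptionCount ⌊x⌋₊ =
      (⌊x⌋₊ + 1) / 2 := by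
  classical
  have h : {k : ℕ | Odd k ∧ (k : ℝ) ≤ x ∧ memC (mfun k) k}.ncard =
      (((Finset.Ioc 0 ⌊x⌋₊).filter Odd).filter fun k => memC (mfun k) k).card := by
    rw [← Set.ncard_coe_finset]
    congr 1
    ext k
    simp only [Set.mem_ofPred_eq, Finset.coe_filter, Finset.mem_filter, Finset.mem_Ioc]
    constructor
    · rintro ⟨h1, h3, h4⟩
      exact ⟨⟨⟨h1.pos, Nat.le_floor h3⟩, h1⟩, h4⟩
    · rintro ⟨⟨⟨h2, h3⟩, h1⟩, h4⟩
      exact ⟨h1, (Nat.le_floor_iff' h2.ne').1 h3, h4⟩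
  rw [h, exceptionCount, ← Finset.filter_filter, Finset.card_filter_add_card_filter_not,
    card_filter_odd_Ioc]

theorem plog_le_self {x : ℝ} (hx : 1 ≤ x) : plog x ≤ x :=
  max_le (by linarith [Real.log_le_sub_one_of_pos (show 0 < x by linarith)]) hx

theorem one_le_plog (x : ℝ) : 1 ≤ plog x := le_max_right _ _

theorem plog_plog_plog_le (x : ℝ) : plog (plog (plog x)) ≤ plog x :=
  (plog_le_self (one_le_plog _)).trans (plog_le_self (one_le_plog _))

theorem tendsto_exceptionCount_div :
    Tendsto (fun x : ℝ => (exceptionCount ⌊x⌋₊ : ℝ) / x) atTop (nhds 0) := by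
  have h : Tendsto (fun x : ℝ => 10 / Real.log x) atTop (nhds 0) :=
    Tendsto.div_atTop tendsto_const_nhds Real.tendsto_log_atTop
  refine squeeze_zero' ?_ ?_ h
  · filter_upwards [eventually_gt_atTop 0] with x hx
    positivity
  · filter_upwards [eventually_exceptionCount_le, eventually_gt_atTop 0] with x hx hx0
    rw [div_le_iff₀ hx0]
    exact hx.trans (le_of_eq (by ring))

theorem tendsto_floor_add_one_div_two_div :
    Tendsto (fun x : ℝ => (((⌊x⌋₊ + 1) / 2 : ℕ) : ℝ) / x) atTop (nhds (1 / 2)) := by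
  have h0 : Tendsto (fun x : ℝ => 1 / x) atTop (nhds 0) :=
    Tendsto.div_atTop tendsto_const_nhds tendsto_id
  have h1 := (tendsto_const_nhds (x := (1 / 2 : ℝ))).sub h0
  have h2 := (tendsto_const_nhds (x := (1 / 2 : ℝ))).add h0
  rw [sub_zero] at h1
  rw [add_zero] at h2
  refine tendsto_of_tendsto_of_tendsto_of_le_of_le' h1 h2 ?_ ?_
  all_goals
    filter_upwards [eventually_gt_atTop 0] with x hx
    have h3 := Nat.floor_le hx.le
    have h4 := Nat.lt_floor_add_one x
    have h5 : (⌊x⌋₊ : ℝ) ≤ 2 * ((⌊x⌋₊ + 1) / 2 : ℕ) := by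
      exact_mod_cast (show ⌊x⌋₊ ≤ 2 * ((⌊x⌋₊ + 1) / 2) by omega)
    have h6 : 2 * (((⌊x⌋₊ + 1) / 2 : ℕ) : ℝ) ≤ ⌊x⌋₊ + 1 := by
      exact_mod_cast (show 2 * ((⌊x⌋₊ + 1) / 2) ≤ ⌊x⌋₊ + 1 by omega)
  · rw [le_div_iff₀ hx, sub_mul, one_div_mul_cancel hx.ne']
    linarith
  · rw [div_le_iff₀ hx, add_mul, one_div_mul_cancel hx.ne']
    linarith

/-- Theorem 7 of the paper: the set of odd positive integers `k` with
`k ∈ 𝒞_(m(k))`, where `m(k) = ⌊exp(4000 (log log log k)^3)⌋`, has asymptotic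
density `1/2`; moreover the number of odd `k ≤ x` with `k ∉ 𝒞_(m(k))` is
`O(x / log log log x)`. -/
theorem density_of_C_mk :
    Tendsto (fun x : ℝ =>
        ({k : ℕ | Odd k ∧ (k : ℝ) ≤ x ∧ memC (mfun k) k}.ncard : ℝ) / x)
      atTop (nhds (1 / 2)) ∧
    ∃ C : ℝ, 0 < C ∧ ∀ x : ℝ, 1 ≤ x →
      ({k : ℕ | Odd k ∧ 0 < k ∧ (k : ℝ) ≤ x ∧ ¬ memC (mfun k) k}.ncard : ℝ) ≤
        C * x / plog (plog (plog x)) := by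
  constructor
  · have h := tendsto_floor_add_one_div_two_div.sub tendsto_exceptionCount_div
    rw [sub_zero] at h
    refine h.congr fun x => ?_
    rw [← ncard_memC_add_exceptionCount, Nat.cast_add]
    ring
  · obtain ⟨x₀, hx₀⟩ := eventually_atTop.1
      (eventually_exceptionCount_le.and (eventually_ge_atTop (Real.exp 1)))
    refine ⟨10 + plog x₀, by linarith [one_le_plog x₀], fun x hx => ?_⟩
    rw [ncard_not_memC_eq]
    have h1 := one_le_plog (plog (plog x))
    rcases le_or_gt x₀ x with h | h
    · obtain ⟨h2, h3⟩ := hx₀ x h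
      have h4 : 1 ≤ Real.log x := (Real.le_log_iff_exp_le (by linarith)).2 h3
      have h5 : plog (plog (plog x)) ≤ Real.log x :=
        (plog_plog_plog_le x).trans (max_le le_rfl h4)
      refine h2.trans ?_
      rw [mul_div_assoc]
      have := one_le_plog x₀
      gcongr
      linarith
    · have h2 : plog (plog (plog x)) ≤ plog x₀ := (plog_plog_plog_le x).trans
        (max_le_max (Real.log_le_log (by linarith) h.le) le_rfl)
      rw [le_div_iff₀ (by linarith)]
      calc (exceptionCount ⌊x⌋₊ : ℝ) * plog (plog (plog x)) ≤ x * plog x₀ := by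
            gcongr
            exact (Nat.cast_le.2 (exceptionCount_le_self _)).trans (Nat.floor_le (by linarith))
        _ ≤ (10 + plog x₀) * x := by linarith
end

section
/- There exist constants C > 0 and x_0 such that for every real x > x_0, the inequality c_k/2^k < 2^{m(k) − (log k)/(log 2)} holds for all odd positive integers k < x with at most C·x/log log log x exceptions, where m(k) = ⌊exp(4000 (log log log k)^3)⌋. -/
/-- `binDigitSum n` is the sum of the binary digits of `n`. -/
def binDigitSum (n : ℕ) : ℕ := (Nat.digits 2 n).sum

/-- `ak k` is the smallest positive multiple of `k` whose binary digit sum equals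
`k` (the minimal binary Niven number with digit sum `k`). -/
noncomputable def ak (k : ℕ) : ℕ :=
  sInf {N : ℕ | 0 < N ∧ k ∣ N ∧ binDigitSum N = k}

section

open Finset

/-- Lines `a + y * b = z` over a finite field: the second moment of the incidence counts. -/
theorem sum_sq_card_line_le {F : Type*} [Field F] [Fintype F] [DecidableEq F]
    (P : Finset (F × F)) :
    ∑ y : F, ∑ z : F, #{u ∈ P | u.1 + y * u.2 = z} ^ 2 ≤ Fintype.card F * #P + #P ^ 2 := by
  have h1 : ∀ y : F, ∑ z : F, #{u ∈ P | u.1 + y * u.2 = z} ^ 2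
      = ∑ w ∈ P ×ˢ P, if w.1.1 + y * w.1.2 = w.2.1 + y * w.2.2 then 1 else 0 := by
    intro y
    simp_rw [sq, card_filter, sum_mul_sum, ← sum_product']
    rw [sum_product_right]
    refine sum_congr rfl fun w _ => ?_
    by_cases h : w.1.1 + y * w.1.2 = w.2.1 + y * w.2.2
    · simp [h]
    · simp only [h, if_false]
      refine sum_eq_zero fun z _ => ?_
      by_cases h1 : w.1.1 + y * w.1.2 = z
      · rw [if_neg (fun h2 : w.2.1 + y * w.2.2 = z => h (h1.trans h2.symm)), mul_zero]
      · rw [if_neg h1, zero_mul]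
  simp_rw [h1]
  rw [sum_comm]
  have h2 : ∀ w ∈ P ×ˢ P, (∑ y : F, if w.1.1 + y * w.1.2 = w.2.1 + y * w.2.2 then 1 else 0)
      ≤ (if w.1 = w.2 then Fintype.card F else 0) + 1 := by
    intro w _
    split_ifs with h
    · simp [h]
    · rw [zero_add, ← card_filter, card_le_one]
      intro y hy y' hy'
      simp only [mem_filter, mem_univ, true_and] at hy hy'
      by_contra hne
      have h3 : (y - y') * (w.1.2 - w.2.2) = 0 := by linear_combination hy - hy'
      rcases mul_eq_zero.1 h3 with h4 | h4
      · exact hne (sub_eq_zero.1 h4)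
      · have h5 := sub_eq_zero.1 h4
        apply h
        refine Prod.ext ?_ h5
        rw [h5] at hy
        exact add_right_cancel hy
  refine (sum_le_sum h2).trans ?_
  rw [sum_add_distrib, sum_const, card_product, smul_eq_mul, mul_one, sq, sum_product]
  simp [mul_comm]

theorem sum_card_line {F : Type*} [Field F] [Fintype F] [DecidableEq F]
    (P : Finset (F × F)) (y : F) : ∑ z : F, #{u ∈ P | u.1 + y * u.2 = z} = #P :=
  (card_eq_sum_card_fiberwise (fun _ _ => mem_coe.2 (mem_univ _))).symm

theorem exists_slope_card_image {F : Type*} [Field F] [Fintype F] [DecidableEq F]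
    (P : Finset (F × F)) (hP : P.Nonempty) :
    ∃ y : F, Fintype.card F * #P ≤
      #(P.image fun u => u.1 + y * u.2) * (Fintype.card F + #P) := by
  obtain ⟨y, -, hy⟩ : ∃ y ∈ (univ : Finset F),
      (∑ z : F, #{u ∈ P | u.1 + y * u.2 = z} ^ 2) * Fintype.card F
        ≤ Fintype.card F * #P + #P ^ 2 := by
    by_contra! h
    have h1 := sum_lt_sum_of_nonempty (univ_nonempty (α := F)) h
    rw [← sum_mul, sum_const, smul_eq_mul, card_univ, mul_comm (Fintype.card F)] at h1
    exact absurd (Nat.mul_le_mul_right _ (sum_sq_card_line_le P)) (not_le.2 h1)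
  refine ⟨y, ?_⟩
  set I := P.image fun u => u.1 + y * u.2
  have h2 : ∑ z ∈ I, #{u ∈ P | u.1 + y * u.2 = z} = #P :=
    (card_eq_sum_card_fiberwise fun u hu => mem_image_of_mem _ hu).symm
  have h3 : #P ^ 2 ≤ #I * ∑ z ∈ I, #{u ∈ P | u.1 + y * u.2 = z} ^ 2 := by
    rw [← h2]; exact sq_sum_le_card_mul_sum_sq
  have h4 : ∑ z ∈ I, #{u ∈ P | u.1 + y * u.2 = z} ^ 2
      ≤ ∑ z : F, #{u ∈ P | u.1 + y * u.2 = z} ^ 2 :=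
    sum_le_sum_of_subset (subset_univ _)
  have h5 : 0 < #P := card_pos.2 hP
  refine Nat.le_of_mul_le_mul_left (?_ : #P * _ ≤ #P * _) h5
  calc #P * (Fintype.card F * #P) = Fintype.card F * #P ^ 2 := by ring
    _ ≤ Fintype.card F * (#I * ∑ z : F, #{u ∈ P | u.1 + y * u.2 = z} ^ 2) := by
      gcongr; exact h3.trans (by gcongr)
    _ = #I * ((∑ z : F, #{u ∈ P | u.1 + y * u.2 = z} ^ 2) * Fintype.card F) := by ring
    _ ≤ #I * (Fintype.card F * #P + #P ^ 2) := by gcongr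
    _ = #P * (#I * (Fintype.card F + #P)) := by ring

theorem card_lines_avoiding_mul_card_le {F : Type*} [Field F] [Fintype F] [DecidableEq F]
    (P S : Finset (F × F)) (h : ∀ s ∈ S, ∀ u ∈ P, u.1 + s.1 * u.2 ≠ s.2) :
    #S * #P ≤ Fintype.card F ^ 3 := by
  rcases P.eq_empty_or_nonempty with rfl | hP
  · simp
  have hP' : (0 : ℝ) < #P := by exact_mod_cast card_pos.2 hP
  obtain ⟨q, hq⟩ : ∃ q : ℝ, q = (Fintype.card F : ℝ) := ⟨_, rfl⟩
  have hq0 : 0 < q := by rw [hq]; exact_mod_cast Fintype.card_pos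
  set r : F → F → ℝ := fun y z => #{u ∈ P | u.1 + y * u.2 = z} with hr
  have h1 : ∑ y : F, ∑ z : F, r y z ^ 2 ≤ q * #P + (#P : ℝ) ^ 2 := by
    have := sum_sq_card_line_le P
    simp only [hr, hq]
    exact_mod_cast this
  have h2 : ∀ y, ∑ z : F, r y z = #P := by
    intro y
    simp only [hr]
    exact_mod_cast sum_card_line P y
  have h3 : ∑ w : F × F, (r w.1 w.2 - #P / q) ^ 2 ≤ q * #P := by
    rw [Fintype.sum_prod_type]
    have : ∀ y, ∑ z : F, (r y z - #P / q) ^ 2 = ∑ z : F, r y z ^ 2 - (#P : ℝ) ^ 2 / q := by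
      intro y
      simp_rw [sub_sq, sum_add_distrib, sum_sub_distrib, ← sum_mul, ← mul_sum, h2]
      simp only [sum_const, card_univ, nsmul_eq_mul, ← hq]
      field_simp
      ring
    simp_rw [this, sum_sub_distrib]
    simp only [sum_const, card_univ, nsmul_eq_mul, ← hq]
    have : q * ((#P : ℝ) ^ 2 / q) = (#P : ℝ) ^ 2 := by field_simp
    linarith
  have h4 : ∑ w ∈ S, (r w.1 w.2 - #P / q) ^ 2 = #S * (#P / q : ℝ) ^ 2 := by
    rw [← nsmul_eq_mul, ← sum_const]
    refine sum_congr rfl fun s hs => ?_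
    have : r s.1 s.2 = 0 := by
      simp only [hr, Nat.cast_eq_zero, card_eq_zero, filter_eq_empty_iff]
      exact fun u hu => h s hs u hu
    rw [this]; ring
  have h5 : #S * (#P / q : ℝ) ^ 2 ≤ q * #P := by
    rw [← h4]
    exact (sum_le_univ_sum_of_nonneg fun _ => sq_nonneg _).trans h3
  have h6 : (#S * #P : ℝ) ≤ q ^ 3 := by
    rw [div_pow, mul_div_assoc', div_le_iff₀ (by positivity)] at h5
    refine le_of_mul_le_mul_right (?_ : _ * (#P : ℝ) ≤ _ * (#P : ℝ)) hP'
    nlinarith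
  rw [hq] at h6
  exact_mod_cast h6

theorem exists_card_image_sub_mul_add {p : ℕ} [Fact p.Prime] (A : Finset (ZMod p))
    (hA : 2 ≤ #A) :
    ∃ a ∈ A, ∃ b ∈ A, ∃ c ∈ A, ∃ d ∈ A,
      p * #A ^ 2 ≤ #((A ×ˢ A).image fun u => (c - d) * u.1 + (a - b + c - d) * u.2)
        * (p + #A ^ 2) := by
  obtain ⟨c₀, hc₀, d₀, hd₀, hcd₀⟩ := one_lt_card.1 hA
  have hne : (A ×ˢ A).Nonempty := ⟨(c₀, c₀), by simp [hc₀]⟩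
  suffices h : ∃ a ∈ A, ∃ b ∈ A, ∃ c ∈ A, ∃ d ∈ A, ∃ ξ : ZMod p, c ≠ d ∧ ξ * (c - d) = a - b ∧
      p * #A ^ 2 ≤ #((A ×ˢ A).image fun u => u.1 + (ξ + 1) * u.2) * (p + #A ^ 2) by
    obtain ⟨a, ha, b, hb, c, hc, d, hd, ξ, hcd, hξ, h⟩ := h
    refine ⟨a, ha, b, hb, c, hc, d, hd, h.trans_eq ?_⟩
    congr 1
    have hinj : Function.Injective fun x : ZMod p => (c - d) * x :=
      mul_right_injective₀ (sub_ne_zero.2 hcd)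
    rw [← card_image_of_injective _ hinj, image_image]
    congr 2
    funext u
    simp only [Function.comp]
    linear_combination u.2 * hξ
  by_cases hQ : ∀ ξ : ZMod p, ∃ a ∈ A, ∃ b ∈ A, ∃ c ∈ A, ∃ d ∈ A, c ≠ d ∧ ξ * (c - d) = a - b
  · obtain ⟨y, hy⟩ := exists_slope_card_image (A ×ˢ A) hne
    obtain ⟨a, ha, b, hb, c, hc, d, hd, hcd, h⟩ := hQ (y - 1)
    refine ⟨a, ha, b, hb, c, hc, d, hd, y - 1, hcd, h, ?_⟩
    simpa [ZMod.card, card_product, ← sq] using hy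
  · obtain ⟨ξ, ⟨a, ha, b, hb, c, hc, d, hd, hcd, h⟩, hξ⟩ : ∃ ξ : ZMod p,
        (∃ a ∈ A, ∃ b ∈ A, ∃ c ∈ A, ∃ d ∈ A, c ≠ d ∧ ξ * (c - d) = a - b) ∧
        ¬ ∃ a ∈ A, ∃ b ∈ A, ∃ c ∈ A, ∃ d ∈ A, c ≠ d ∧ (ξ + 1) * (c - d) = a - b := by
      by_contra! hcon
      apply hQ
      have hn : ∀ n : ℕ, ∃ a ∈ A, ∃ b ∈ A, ∃ c ∈ A, ∃ d ∈ A,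
          c ≠ d ∧ (n : ZMod p) * (c - d) = a - b := by
        intro n
        induction n with
        | zero => exact ⟨c₀, hc₀, c₀, hc₀, c₀, hc₀, d₀, hd₀, hcd₀, by simp⟩
        | succ n ih => push_cast; exact hcon _ ih
      intro ξ
      have := hn ξ.val
      rwa [ZMod.natCast_zmod_val] at this
    refine ⟨a, ha, b, hb, c, hc, d, hd, ξ, hcd, h, ?_⟩
    rw [card_image_of_injOn, card_product, ← sq, mul_comm]
    · exact Nat.mul_le_mul_left _ (Nat.le_add_right _ _)
    · rintro ⟨x, y⟩ hu ⟨x', y'⟩ hu' heq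
      simp only [coe_product, Set.mem_prod, mem_coe] at hu hu' heq
      have hyy : y = y' := by
        by_contra hne
        exact hξ ⟨x, hu.1, x', hu'.1, y', hu'.2, y, hu.2, Ne.symm hne,
          by linear_combination -heq⟩
      subst hyy
      simpa using heq

/-- `c` is a sum of exactly `m` powers of `g`, with repetitions allowed. -/
def IsPowSum {R : Type*} [Semiring R] (g : R) (m : ℕ) (c : R) : Prop :=
  ∃ f : Fin m → ℕ, ∑ i, g ^ f i = c

namespace IsPowSum

theorem zero {R : Type*} [Semiring R] (g : R) : IsPowSum g 0 0 := ⟨fun _ => 0, by simp⟩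

theorem pow {R : Type*} [Semiring R] (g : R) (a : ℕ) : IsPowSum g 1 (g ^ a) :=
  ⟨fun _ => a, by simp⟩

theorem add {R : Type*} [Semiring R] {g : R} {m n : ℕ} {c d : R} (hc : IsPowSum g m c)
    (hd : IsPowSum g n d) : IsPowSum g (m + n) (c + d) := by
  obtain ⟨f, rfl⟩ := hc
  obtain ⟨f', rfl⟩ := hd
  exact ⟨Fin.append f f', by simp [Fin.sum_univ_add]⟩

theorem mul {R : Type*} [Semiring R] {g : R} {m n : ℕ} {c d : R} (hc : IsPowSum g m c)
    (hd : IsPowSum g n d) : IsPowSum g (m * n) (c * d) := by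
  obtain ⟨f, rfl⟩ := hc
  obtain ⟨f', rfl⟩ := hd
  refine ⟨fun i => f (finProdFinEquiv.symm i).1 + f' (finProdFinEquiv.symm i).2, ?_⟩
  rw [finProdFinEquiv.symm.sum_comp fun x : Fin m × Fin n => g ^ (f x.1 + f' x.2)]
  simp_rw [pow_add, sum_mul_sum, Fintype.sum_prod_type]

theorem natCast {R : Type*} [Semiring R] (g : R) (n : ℕ) : IsPowSum g n (n : R) :=
  ⟨fun _ => 0, by simp⟩

end IsPowSum

open Classical in
/-- The set of sums of exactly `m` powers of `g`. -/
noncomputable def powSums {R : Type*} [Semiring R] [Fintype R] (g : R) (m : ℕ) : Finset R :=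
  univ.filter (IsPowSum g m)

theorem mem_powSums {R : Type*} [Semiring R] [Fintype R] {g : R} {m : ℕ} {c : R} :
    c ∈ powSums g m ↔ IsPowSum g m c := by
  classical simp [powSums]

theorem card_powSums_mono {R : Type*} [Ring R] [Fintype R] (g : R) {m n : ℕ} (h : m ≤ n) :
    #(powSums g m) ≤ #(powSums g n) := by
  refine card_le_card_of_injOn (fun c => c + ((n - m : ℕ) : R)) (fun c hc => ?_)
    (fun a _ b _ hab => add_right_cancel hab)
  have := (mem_powSums.1 (mem_coe.1 hc)).add (IsPowSum.natCast g (n - m))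
  rw [Nat.add_sub_cancel' h] at this
  exact mem_powSums.2 this

open Pointwise in
theorem card_powSums_growth {p : ℕ} [Fact p.Prime] (g : ZMod p) (j : ℕ) (hj : 0 < j)
    (hA : 2 ≤ #(powSums g j)) :
    p * #(powSums g j) ^ 3 ≤ #(powSums g (6 * j ^ 2)) ^ 2 * (p + #(powSums g j) ^ 2) := by
  obtain ⟨a, ha, b, hb, c, hc, d, hd, h⟩ := exists_card_image_sub_mul_add _ hA
  set A := powSums g j with hAdef
  set B := powSums g (3 * j ^ 2) with hBdef
  have hmul : ∀ {x y}, x ∈ A → y ∈ A → IsPowSum g (j ^ 2) (x * y) := fun hx hy => by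
    rw [sq]; exact (mem_powSums.1 hx).mul (mem_powSums.1 hy)
  have hsub : ((A ×ˢ A).image fun u => (c - d) * u.1 + (a - b + c - d) * u.2) ⊆ B - B := by
    intro z hz
    obtain ⟨⟨x, y⟩, hu, rfl⟩ := mem_image.1 hz
    obtain ⟨hx, hy⟩ := mem_product.1 hu
    refine mem_sub.2 ⟨c * x + a * y + c * y, ?_, d * x + b * y + d * y, ?_, by ring⟩
    · rw [hBdef, mem_powSums, show 3 * j ^ 2 = j ^ 2 + j ^ 2 + j ^ 2 by ring]
      exact ((hmul hc hx).add (hmul ha hy)).add (hmul hc hy)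
    · rw [hBdef, mem_powSums, show 3 * j ^ 2 = j ^ 2 + j ^ 2 + j ^ 2 by ring]
      exact ((hmul hd hx).add (hmul hb hy)).add (hmul hd hy)
  have hadd : B + B ⊆ powSums g (6 * j ^ 2) := by
    intro z hz
    obtain ⟨x, hx, y, hy, rfl⟩ := mem_add.1 hz
    rw [mem_powSums, show 6 * j ^ 2 = 3 * j ^ 2 + 3 * j ^ 2 by ring]
    exact (mem_powSums.1 hx).add (mem_powSums.1 hy)
  have hAB : #A ≤ #B := card_powSums_mono g (by nlinarith)
  have hR := ruzsa_triangle_inequality_sub_add_add B B B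
  calc p * #A ^ 3 = (p * #A ^ 2) * #A := by ring
    _ ≤ (#(B - B) * (p + #A ^ 2)) * #B :=
      Nat.mul_le_mul (h.trans (Nat.mul_le_mul_right _ (card_le_card hsub))) hAB
    _ = (#(B - B) * #B) * (p + #A ^ 2) := by ring
    _ ≤ (#(B + B) * #(B + B)) * (p + #A ^ 2) := Nat.mul_le_mul_right _ hR
    _ ≤ (#(powSums g (6 * j ^ 2)) * #(powSums g (6 * j ^ 2))) * (p + #A ^ 2) := by
      have := card_le_card hadd
      gcongr
    _ = _ := by ring

theorem powSums_eq_univ_of_card {p : ℕ} [Fact p.Prime] (g : ZMod p) (n : ℕ)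
    (h : 2 * p ^ 2 < #(powSums g n) ^ 3) (c : ZMod p) : IsPowSum g (2 * (n + n ^ 2)) c := by
  set A := powSums g n with hA
  set D := powSums g (n + n ^ 2) with hD
  have h1 := card_lines_avoiding_mul_card_le (A ×ˢ A) (A ×ˢ Dᶜ) (by
    rintro ⟨y, z⟩ hs ⟨x, x'⟩ hu heq
    obtain ⟨hy, hz⟩ := mem_product.1 hs
    obtain ⟨hx, hx'⟩ := mem_product.1 hu
    apply mem_compl.1 hz
    dsimp only at heq hx hx' hy ⊢
    rw [hD, mem_powSums, ← heq, sq]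
    exact (mem_powSums.1 hx).add ((mem_powSums.1 hy).mul (mem_powSums.1 hx')))
  rw [card_product, card_product, ZMod.card] at h1
  have hp : 0 < p := (Fact.out : p.Prime).pos
  have h2 : 2 * #Dᶜ < p := by
    by_contra! hcon
    have h3 : 2 * p ^ 2 * #Dᶜ < #A ^ 3 * #Dᶜ := by
      apply Nat.mul_lt_mul_of_pos_right h; omega
    have h4 : p ^ 2 * p ≤ p ^ 2 * (2 * #Dᶜ) := by gcongr
    nlinarith
  have h3 : #Dᶜ + #D = p := by rw [card_compl_add_card, ZMod.card]
  have h4 : ¬ Disjoint D (D.image fun x => c - x) := by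
    intro hdis
    have h5 := card_le_univ (D ∪ D.image fun x => c - x)
    rw [card_union_of_disjoint hdis, card_image_of_injective _ (sub_right_injective), ZMod.card] at h5
    omega
  obtain ⟨x, hx, hx'⟩ := not_disjoint_iff.1 h4
  obtain ⟨y, hy, rfl⟩ := mem_image.1 hx'
  have := (mem_powSums.1 hx).add (mem_powSums.1 hy)
  rwa [sub_add_cancel, ← two_mul] at this

/-- The number of summands in an iterated growth argument. -/
def growthIndex : ℕ → ℕ
  | 0 => 1
  | i + 1 => 6 * growthIndex i ^ 2

theorem growthIndex_pos (i : ℕ) : 0 < growthIndex i := by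
  induction i with
  | zero => simp [growthIndex]
  | succ i ih => simp only [growthIndex]; positivity

theorem growthIndex_mono : Monotone growthIndex := by
  refine monotone_nat_of_le_succ fun i => ?_
  have := growthIndex_pos i
  simp only [growthIndex]
  nlinarith

theorem orderOf_le_card_powSums_one {p : ℕ} [Fact p.Prime] (g : (ZMod p)ˣ) :
    orderOf g ≤ #(powSums (g : ZMod p) 1) := by
  rw [← card_range (orderOf g)]
  refine card_le_card_of_injOn (fun a => (g : ZMod p) ^ a)
    (fun a _ => mem_powSums.2 (IsPowSum.pow _ a)) fun a ha b hb hab => ?_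
  refine pow_injOn_Iio_orderOf (by simpa using ha) (by simpa using hb) ?_
  apply Units.ext
  simpa using hab

/-- Every residue modulo a large prime `p` is a sum of boundedly many elements of a given
cyclic multiplicative subgroup of order at least `p ^ (1 / 8)`. -/
theorem exists_isPowSum_of_le_orderOf_pow : ∃ n : ℕ, 0 < n ∧ ∀ (p : ℕ) [Fact p.Prime],
    6562 ≤ p → ∀ g : (ZMod p)ˣ, p ≤ orderOf g ^ 8 → ∀ c : ZMod p,
      IsPowSum (g : ZMod p) n c := by
  refine ⟨2 * (growthIndex 8 + growthIndex 8 ^ 2), ?_, fun p _ hp g hg c => ?_⟩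
  · have := growthIndex_pos 8
    positivity
  set a : ℕ → ℕ := fun i => #(powSums (g : ZMod p) (growthIndex i)) with ha
  have ha0 : orderOf g ≤ a 0 := orderOf_le_card_powSums_one g
  have hmono : Monotone a := fun i j h => card_powSums_mono _ (growthIndex_mono h)
  have h4 : 4 ≤ orderOf g := by
    by_contra! h
    have : orderOf g ^ 8 ≤ 3 ^ 8 := Nat.pow_le_pow_left (by omega) 8
    omega
  have ha4 : ∀ i, 4 ≤ a i := fun i => (h4.trans ha0).trans (hmono (Nat.zero_le i))
  have hgrow : ∀ i, p * a i ^ 3 ≤ a (i + 1) ^ 2 * (p + a i ^ 2) := fun i =>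
    card_powSums_growth _ _ (growthIndex_pos i) (by have := ha4 i; simp only [ha] at this; omega)
  have h7 : p ≤ a 7 ^ 2 := by
    by_contra! hcon
    have hstep : ∀ i < 7, 5 * Real.log (a i) ≤ 4 * Real.log (a (i + 1)) := by
      intro i hi
      have h1 : a i ^ 2 ≤ p := (Nat.pow_le_pow_left (hmono hi.le) 2).trans hcon.le
      have h2 : a i ^ 3 ≤ 2 * a (i + 1) ^ 2 := by
        have : p * a i ^ 3 ≤ p * (2 * a (i + 1) ^ 2) := by
          refine (hgrow i).trans ?_
          nlinarith [Nat.zero_le (a (i + 1) ^ 2)]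
        exact Nat.le_of_mul_le_mul_left this (by omega)
      have h3 : a i ^ 5 ≤ a (i + 1) ^ 4 := by
        have h5 : (a i ^ 3) ^ 2 ≤ (2 * a (i + 1) ^ 2) ^ 2 := Nat.pow_le_pow_left h2 2
        have h6 : 4 * a i ^ 5 ≤ a i * a i ^ 5 := Nat.mul_le_mul_right _ (ha4 i)
        nlinarith
      have h5 : (0 : ℝ) < a i := by have := ha4 i; exact_mod_cast (by omega : 0 < a i)
      have h6 := Real.log_le_log (by positivity)
        (by exact_mod_cast h3 : (a i : ℝ) ^ 5 ≤ (a (i + 1) : ℝ) ^ 4)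
      rw [Real.log_pow, Real.log_pow] at h6
      exact_mod_cast h6
    have hp0 : (1 : ℝ) < p := by exact_mod_cast (by omega : 1 < p)
    have hlogp := Real.log_pos hp0
    have e0 : Real.log p ≤ 8 * Real.log (a 0) := by
      have : (p : ℝ) ≤ (a 0 : ℝ) ^ 8 := by
        exact_mod_cast hg.trans (Nat.pow_le_pow_left ha0 8)
      have := Real.log_le_log (by linarith) this
      rw [Real.log_pow] at this
      exact_mod_cast this
    have e7 : 2 * Real.log (a 7) ≤ Real.log p := by
      have h5 : (0 : ℝ) < a 7 := by have := ha4 7; exact_mod_cast (by omega : 0 < a 7)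
      have : (a 7 : ℝ) ^ 2 ≤ p := by exact_mod_cast hcon.le
      have := Real.log_le_log (by positivity) this
      rw [Real.log_pow] at this
      exact_mod_cast this
    have s0 := hstep 0 (by norm_num)
    have s1 := hstep 1 (by norm_num)
    have s2 := hstep 2 (by norm_num)
    have s3 := hstep 3 (by norm_num)
    have s4 := hstep 4 (by norm_num)
    have s5 := hstep 5 (by norm_num)
    have s6 := hstep 6 (by norm_num)
    norm_num only at s0 s1 s2 s3 s4 s5 s6
    linarith
  have h8 : p * a 7 ≤ 2 * a 8 ^ 2 := by
    have h1 := hgrow 7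
    norm_num only at h1
    have h2 : a 7 ^ 2 * (p * a 7) ≤ a 7 ^ 2 * (2 * a 8 ^ 2) := by
      nlinarith [Nat.zero_le (a 8 ^ 2)]
    exact Nat.le_of_mul_le_mul_left h2 (by have := ha4 7; positivity)
  have h9 : p ^ 3 ≤ 4 * a 8 ^ 4 := by
    have h1 : (p * a 7) ^ 2 ≤ (2 * a 8 ^ 2) ^ 2 := Nat.pow_le_pow_left h8 2
    nlinarith [Nat.mul_le_mul_left (p ^ 2) h7]
  apply powSums_eq_univ_of_card
  change 2 * p ^ 2 < a 8 ^ 3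
  by_contra! hcon
  have h10 : (p ^ 3) ^ 3 ≤ (4 * a 8 ^ 4) ^ 3 := Nat.pow_le_pow_left h9 3
  have h11 : (a 8 ^ 3) ^ 4 ≤ (2 * p ^ 2) ^ 4 := Nat.pow_le_pow_left hcon 4
  have h12 : p ^ 8 * p ≤ p ^ 8 * 1024 := by nlinarith
  have := Nat.le_of_mul_le_mul_left h12 (by positivity)
  omega

theorem binDigitSum_two_mul_add {b : ℕ} (hb : b < 2) (n : ℕ) :
    binDigitSum (b + 2 * n) = b + binDigitSum n := by
  rcases Nat.eq_zero_or_pos (b + 2 * n) with h | h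
  · obtain ⟨rfl, rfl⟩ : b = 0 ∧ n = 0 := by omega
    simp [binDigitSum]
  · rw [binDigitSum, Nat.digits_def' one_lt_two h, List.sum_cons, binDigitSum]
    congr 3 <;> omega

theorem binDigitSum_sum_range (m : ℕ) : ∀ f : ℕ → ℕ, (∀ i, f i < 2) →
    binDigitSum (∑ i ∈ range m, f i * 2 ^ i) = ∑ i ∈ range m, f i := by
  induction m with
  | zero => intro f _; simp [binDigitSum]
  | succ m ih =>
    intro f hf
    rw [sum_range_succ', sum_range_succ', pow_zero, mul_one, ← ih (fun i => f (i + 1))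
      fun i => hf _, add_comm, add_comm (binDigitSum _), ← binDigitSum_two_mul_add (hf 0), mul_sum]
    congr 2
    refine sum_congr rfl fun i _ => ?_
    ring

theorem binDigitSum_sum_two_pow (s : Finset ℕ) : binDigitSum (∑ e ∈ s, 2 ^ e) = #s := by
  obtain ⟨m, hm⟩ := exists_nat_subset_range s
  have h := binDigitSum_sum_range m (fun i => if i ∈ s then 1 else 0)
    (fun i => by split_ifs <;> norm_num)
  simp only [ite_mul, one_mul, zero_mul, sum_ite_mem, inter_eq_right.2 hm] at h
  simpa using h

theorem pow_mod_of_pow_eq_one {R : Type*} [Monoid R] {g : R} {t : ℕ} (h : g ^ t = 1) (a : ℕ) :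
    g ^ (a % t) = g ^ a := by
  conv_rhs => rw [← Nat.mod_add_div a t, pow_add, pow_mul, h, one_pow, mul_one]

theorem exists_finset_sum_add_two_pow {R : Type*} [Ring R] {t : ℕ} (ht : 0 < t)
    (h : (2 : R) ^ t = 1) (m : ℕ) : ∀ s : Finset ℕ, s ⊆ range t → #s = m → ∀ b : ℕ,
      ∃ s' ⊆ range t, s'.Nonempty ∧ #s' ≤ m + 1 ∧
        ∑ e ∈ s', (2 : R) ^ e = ∑ e ∈ s, (2 : R) ^ e + 2 ^ b := by
  induction m with
  | zero =>
    intro s hs hm b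
    rw [card_eq_zero] at hm
    subst hm
    exact ⟨{b % t}, by simpa using Nat.mod_lt _ ht, by simp, by simp,
      by simp [pow_mod_of_pow_eq_one h]⟩
  | succ m ih =>
    intro s hs hm b
    by_cases hb : b % t ∈ s
    · obtain ⟨s', h1, h2, h3, h4⟩ := ih (s.erase (b % t)) ((erase_subset _ _).trans hs)
        (by rw [card_erase_of_mem hb, hm]; rfl) (b + 1)
      refine ⟨s', h1, h2, by omega, ?_⟩
      rw [h4, ← add_sum_erase s _ hb, pow_mod_of_pow_eq_one h, pow_succ, mul_two]
      abel
    · refine ⟨insert (b % t) s, ?_, insert_nonempty _ _, ?_, ?_⟩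
      · exact insert_subset (by simpa using Nat.mod_lt _ ht) hs
      · rw [card_insert_of_notMem hb, hm]
      · rw [sum_insert hb, pow_mod_of_pow_eq_one h, add_comm]

theorem IsPowSum.exists_finset {R : Type*} [Ring R] {t : ℕ} (ht : 0 < t)
    (h : (2 : R) ^ t = 1) (n : ℕ) : ∀ c : R, IsPowSum 2 (n + 1) c →
      ∃ s ⊆ range t, s.Nonempty ∧ #s ≤ n + 1 ∧ ∑ e ∈ s, (2 : R) ^ e = c := by
  induction n with
  | zero =>
    rintro c ⟨f, rfl⟩
    simpa using exists_finset_sum_add_two_pow ht h 0 ∅ (by simp) rfl (f 0)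
  | succ n ih =>
    rintro c ⟨f, rfl⟩
    obtain ⟨s, h1, -, h3, h4⟩ := ih _ ⟨fun i => f i.castSucc, rfl⟩
    obtain ⟨s', h1', h2', h3', h4'⟩ :=
      exists_finset_sum_add_two_pow ht h _ s h1 rfl (f (Fin.last _))
    refine ⟨s', h1', h2', by omega, ?_⟩
    rw [h4', h4]
    exact (Fin.sum_univ_castSucc fun i => (2 : R) ^ f i).symm

theorem exists_finset_card_succ_s16 {R : Type*} [Ring R] {t : ℕ} (ht : 0 < t)
    (h : (2 : R) ^ t = 1) (s : Finset ℕ) (hs : s ⊆ range (2 * t)) (hne : s.Nonempty)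
    (hcard : #s < t) : ∃ s' ⊆ range (2 * t), #s' = #s + 1 ∧
      ∑ e ∈ s', (2 : R) ^ e = ∑ e ∈ s, (2 : R) ^ e := by
  obtain ⟨j, hj, hj'⟩ : ∃ j, (j + 1) % t ∈ s.image (· % t) ∧ j % t ∉ s.image (· % t) := by
    by_contra! hcon
    obtain ⟨e, he⟩ := hne
    have hdown : ∀ n, ∀ j, j + n = e + t → j % t ∈ s.image (· % t) := by
      intro n
      induction n with
      | zero =>
        rintro j hj
        rw [add_zero] at hj
        rw [hj, Nat.add_mod_right]
        exact mem_image_of_mem _ he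
      | succ n ih => exact fun j hj => hcon j (ih (j + 1) (by omega))
    have hsub : range t ⊆ s.image (· % t) := fun j hj => by
      have hjt := mem_range.1 hj
      have := hdown (e + t - j) j (by omega)
      rwa [Nat.mod_eq_of_lt hjt] at this
    have := (card_le_card hsub).trans card_image_le
    rw [card_range] at this
    omega
  obtain ⟨e, he, hej⟩ := mem_image.1 hj
  set b := j % t with hb
  have hbt : b < t := Nat.mod_lt _ ht
  have hb1 : b ∉ s := fun hbs => hj' (by
    have := mem_image_of_mem (· % t) hbs
    rwa [Nat.mod_eq_of_lt hbt] at this)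
  have hb2 : b + t ∉ s := fun hbs => hj' (by
    have := mem_image_of_mem (· % t) hbs
    rwa [Nat.add_mod_right, Nat.mod_eq_of_lt hbt] at this)
  have hb2' : b + t ∉ s.erase e := fun hx => hb2 (mem_of_mem_erase hx)
  have hb1' : b ∉ insert (b + t) (s.erase e) := by
    rw [mem_insert, not_or]
    exact ⟨by omega, fun hx => hb1 (mem_of_mem_erase hx)⟩
  refine ⟨insert b (insert (b + t) (s.erase e)), ?_, ?_, ?_⟩
  · refine insert_subset (mem_range.2 (by omega)) (insert_subset (mem_range.2 (by omega)) ?_)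
    exact (erase_subset _ _).trans hs
  · rw [card_insert_of_notMem hb1', card_insert_of_notMem hb2', card_erase_of_mem he]
    have := card_pos.2 ⟨e, he⟩
    omega
  · rw [sum_insert hb1', sum_insert hb2', ← add_sum_erase s _ he, pow_add, h, mul_one,
      hb, pow_mod_of_pow_eq_one h, ← pow_mod_of_pow_eq_one h e, hej, pow_mod_of_pow_eq_one h,
      pow_succ, mul_two, add_assoc]

theorem exists_finset_card_eq {R : Type*} [Ring R] {t : ℕ} (ht : 0 < t)
    (h : (2 : R) ^ t = 1) (s : Finset ℕ) (hs : s ⊆ range (2 * t)) (hne : s.Nonempty) (M : ℕ)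
    (hsM : #s ≤ M) (hM : M ≤ t) : ∃ s' ⊆ range (2 * t), #s' = M ∧
      ∑ e ∈ s', (2 : R) ^ e = ∑ e ∈ s, (2 : R) ^ e := by
  induction M, hsM using Nat.le_induction with
  | base => exact ⟨s, hs, rfl, rfl⟩
  | succ m hm ih =>
    obtain ⟨s', h1, h2, h3⟩ := ih (by omega)
    have hpos := card_pos.2 hne
    obtain ⟨s'', h1', h2', h3'⟩ :=
      exists_finset_card_succ_s16 ht h s' h1 (card_pos.1 (by omega)) (by omega)
    exact ⟨s'', h1', by omega, h3'.trans h3⟩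

theorem ak_lt_two_pow {k M t : ℕ} (hk : 0 < k) (ht : 0 < t) (htk : 2 * t ≤ k)
    (h : (2 : ZMod k) ^ t = 1) (hMt : M ≤ t)
    (hrep : ∀ c : ZMod k, ∃ n < M, IsPowSum 2 (n + 1) c) : ak k < 2 ^ (k + M) := by
  obtain ⟨n, hn, hc⟩ := hrep (((∑ e ∈ range (k + M), 2 ^ e : ℕ)) : ZMod k)
  obtain ⟨s, hs, hne, hcard, hsum⟩ := IsPowSum.exists_finset ht h n _ hc
  obtain ⟨s', hs', hcard', hsum'⟩ := exists_finset_card_eq ht h s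
    (hs.trans (range_mono (by omega))) hne M (by omega) hMt
  have hsub : s' ⊆ range (k + M) := hs'.trans (range_mono (by omega))
  have hN := sum_sdiff hsub (f := fun e => 2 ^ e)
  set N := ∑ e ∈ range (k + M) \ s', 2 ^ e with hNdef
  have hdig : binDigitSum N = k := by
    rw [hNdef, binDigitSum_sum_two_pow, card_sdiff_of_subset hsub, card_range, hcard']
    omega
  have hpos : 0 < N := by
    rcases Nat.eq_zero_or_pos N with h0 | h0
    · rw [h0] at hdig
      simp [binDigitSum] at hdig
      omega
    · exact h0
  have hdvd : k ∣ N := by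
    rw [← ZMod.natCast_eq_zero_iff]
    have h1 := congrArg (Nat.cast : ℕ → ZMod k) hN
    rw [Nat.cast_add, ← hsum, ← hsum'] at h1
    push_cast at h1
    simpa using h1
  refine (Nat.sInf_le (⟨hpos, hdvd, hdig⟩ : N ∈ {N : ℕ | 0 < N ∧ k ∣ N ∧ binDigitSum N = k})).trans_lt ?_
  have h1 := Nat.geomSum_lt (le_refl 2) (fun e he => mem_range.1 he : ∀ e ∈ range (k + M), e < k + M)
  omega

theorem ak_div_lt_rpow {k M : ℕ} (hk : 0 < k) (h : ak k < 2 ^ (k + M)) :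
    (ak k : ℝ) / k / 2 ^ k < (2 : ℝ) ^ ((M : ℝ) - Real.log k / Real.log 2) := by
  have hk' : (0 : ℝ) < k := by exact_mod_cast hk
  have h2 : (2 : ℝ) ^ (Real.log k / Real.log 2) = k := by
    rw [Real.log_div_log]
    exact Real.rpow_logb two_pos (by norm_num) hk'
  rw [Real.rpow_sub two_pos, h2, Real.rpow_natCast, div_right_comm, div_lt_div_iff_of_pos_right hk',
    div_lt_iff₀ (by positivity), ← pow_add, add_comm M k]
  exact_mod_cast h

theorem IsPowSum.exists_le_natCast {R : Type*} [Semiring R] (L : ℕ) : ∀ b : ℕ, b < 2 ^ L →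
    ∃ m ≤ L, IsPowSum (2 : R) m (b : R) := by
  induction L with
  | zero =>
    intro b hb
    obtain rfl : b = 0 := by simpa using hb
    exact ⟨0, le_rfl, by simpa using IsPowSum.zero (2 : R)⟩
  | succ L ih =>
    intro b hb
    obtain ⟨m, hm, h⟩ := ih (b / 2) (by rw [pow_succ] at hb; omega)
    have h1 := (IsPowSum.pow (2 : R) 1).mul h
    rw [one_mul, pow_one] at h1
    have hb2 : b = 2 * (b / 2) + b % 2 := (Nat.div_add_mod b 2).symm
    rcases Nat.mod_two_eq_zero_or_one b with h0 | h0
    · refine ⟨m, by omega, ?_⟩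
      rw [hb2, h0]
      push_cast
      simpa using h1
    · refine ⟨m + 1, by omega, ?_⟩
      rw [hb2, h0]
      push_cast
      simpa using h1.add (IsPowSum.pow (2 : R) 0)

theorem Nat.gcd_prod_le_prod_gcd {ι : Type*} (a : ℕ) (ha : 0 < a) (s : Finset ι) (f : ι → ℕ) :
    a.gcd (∏ i ∈ s, f i) ≤ ∏ i ∈ s, a.gcd (f i) := by
  classical
  induction s using Finset.induction_on with
  | empty => simp
  | insert i s hi ih =>
    rw [prod_insert hi, prod_insert hi]
    refine (Nat.le_of_dvd ?_ (Nat.gcd_mul_right_dvd_mul_gcd a _ _)).trans (Nat.mul_le_mul_left _ ih)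
    exact Nat.mul_pos (Nat.gcd_pos_of_pos_left _ ha) (Nat.gcd_pos_of_pos_left _ ha)

theorem pow_factorization_sub_one_le {k G : ℕ} (hsq : ∀ d, d ^ 2 ∣ k → d ≤ G) (p : ℕ) :
    p ^ (k.factorization p - 1) ≤ G ^ 2 := by
  rcases Nat.eq_zero_or_pos p with rfl | hp
  · have h1 : 1 ≤ G := hsq 1 (by simp)
    have h2 : k.factorization 0 = 0 := by simp
    rw [h2]
    simpa using Nat.one_le_pow 2 G h1
  set a := k.factorization p with ha
  have h1 : p ^ (a / 2) ≤ G := by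
    apply hsq
    rw [← pow_mul]
    exact (pow_dvd_pow p (Nat.div_mul_le_self a 2)).trans (Nat.ordProj_dvd k p)
  calc p ^ (a - 1) ≤ p ^ (a / 2 * 2) := Nat.pow_le_pow_right hp (by omega)
    _ = (p ^ (a / 2)) ^ 2 := pow_mul _ _ _
    _ ≤ G ^ 2 := Nat.pow_le_pow_left h1 2

theorem gcd_totient_le {k G W p : ℕ} (hk : k ≠ 0) (hG : 1 ≤ G) (hp : p.Prime) (hpk : p ∣ k)
    (hpk2 : ¬ p ^ 2 ∣ k) (hsq : ∀ d, d ^ 2 ∣ k → d ≤ G) (hW : #k.primeFactors ≤ W)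
    (hgcd : ∀ p q, p.Prime → q.Prime → p ≠ q → p * q ∣ k → (p - 1).gcd (q - 1) ≤ G) :
    (p - 1).gcd (k / p).totient ≤ G ^ (3 * W) := by
  have hm0 : k / p ≠ 0 := (Nat.div_pos (Nat.le_of_dvd (Nat.pos_of_ne_zero hk) hpk) hp.pos).ne'
  have hmk : k / p ∣ k := Nat.div_dvd_of_dvd hpk
  have hp1 : 0 < p - 1 := Nat.sub_pos_of_lt hp.one_lt
  rw [Nat.totient_eq_prod_factorization hm0, Finsupp.prod, Nat.support_factorization]
  refine (Nat.gcd_prod_le_prod_gcd _ hp1 _ _).trans ?_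
  have hterm : ∀ q ∈ (k / p).primeFactors,
      (p - 1).gcd (q ^ ((k / p).factorization q - 1) * (q - 1)) ≤ G ^ 3 := by
    intro q hq
    have hqp := Nat.prime_of_mem_primeFactors hq
    have hqm := Nat.dvd_of_mem_primeFactors hq
    have hne : p ≠ q := by
      rintro rfl
      apply hpk2
      rw [sq]
      exact (Nat.dvd_div_iff_mul_dvd hpk).1 hqm
    refine (Nat.le_of_dvd ?_ (Nat.gcd_mul_right_dvd_mul_gcd _ _ _)).trans ?_
    · exact Nat.mul_pos (Nat.gcd_pos_of_pos_left _ hp1) (Nat.gcd_pos_of_pos_left _ hp1)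
    · have h1 : (p - 1).gcd (q ^ ((k / p).factorization q - 1)) ≤ G ^ 2 :=
        (Nat.gcd_le_right _ (pow_pos hqp.pos _)).trans
          (pow_factorization_sub_one_le (fun d hd => hsq d (hd.trans hmk)) q)
      have h2 := hgcd p q hp hqp hne ((Nat.dvd_div_iff_mul_dvd hpk).1 hqm)
      calc _ ≤ G ^ 2 * G := Nat.mul_le_mul h1 h2
        _ = G ^ 3 := by ring
  refine (prod_le_prod' hterm).trans ?_
  rw [prod_const, ← pow_mul]
  refine Nat.pow_le_pow_right hG (Nat.mul_le_mul_left 3 (le_trans (card_le_card ?_) hW))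
  exact Nat.primeFactors_mono hmk hk

theorem le_orderOf_pow_pow {p e B : ℕ} [Fact p.Prime] (g : (ZMod p)ˣ)
    (hord : p ≤ orderOf g ^ 4) (hgcd : (p - 1).gcd e ≤ B) (hB : B ^ 8 ≤ p) :
    p ≤ orderOf (g ^ e) ^ 8 := by
  have hp := (Fact.out : p.Prime)
  have h1 : orderOf (g ^ e) * (orderOf g).gcd e = orderOf g := by
    rw [orderOf_pow]
    exact Nat.div_mul_cancel (Nat.gcd_dvd_left _ _)
  have h2 : (orderOf g).gcd e ≤ B := by
    refine le_trans (Nat.le_of_dvd (Nat.gcd_pos_of_pos_left _ (Nat.sub_pos_of_lt hp.one_lt)) ?_)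
      hgcd
    refine Nat.gcd_dvd_gcd_of_dvd_left _ ?_
    rw [← ZMod.card_units p]
    exact orderOf_dvd_card
  have h3 : p * p ≤ orderOf (g ^ e) ^ 8 * p := by
    calc p * p ≤ orderOf g ^ 4 * orderOf g ^ 4 := Nat.mul_le_mul hord hord
      _ = (orderOf (g ^ e) * (orderOf g).gcd e) ^ 8 := by rw [h1]; ring
      _ ≤ (orderOf (g ^ e) * B) ^ 8 := by gcongr
      _ = orderOf (g ^ e) ^ 8 * B ^ 8 := mul_pow _ _ _
      _ ≤ orderOf (g ^ e) ^ 8 * p := by gcongr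
  exact Nat.le_of_mul_le_mul_right h3 hp.pos

/-- The part of `k` supported on primes below `w`. -/
def smallPart (w k : ℕ) : ℕ := ∏ p ∈ k.primeFactors with p < w, p ^ k.factorization p

theorem smallPart_pos (w k : ℕ) : 0 < smallPart w k :=
  prod_pos fun _ hp => pow_pos (Nat.prime_of_mem_primeFactors (mem_filter.1 hp).1).pos _

theorem smallPart_le {k G W w : ℕ} (hw : 1 ≤ w) (hG : 1 ≤ G) (hsq : ∀ d, d ^ 2 ∣ k → d ≤ G)
    (hW : #k.primeFactors ≤ W) : smallPart w k ≤ (w * G ^ 2) ^ W := by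
  have h : ∀ p ∈ k.primeFactors.filter (· < w), p ^ k.factorization p ≤ w * G ^ 2 := by
    intro p hp
    obtain ⟨hp, hpw⟩ := mem_filter.1 hp
    have hpos : 0 < k.factorization p := by
      rwa [← Nat.support_factorization, Finsupp.mem_support_iff, ← Nat.pos_iff_ne_zero] at hp
    calc p ^ k.factorization p = p * p ^ (k.factorization p - 1) := by
          rw [← pow_succ', Nat.sub_add_cancel hpos]
      _ ≤ w * G ^ 2 := Nat.mul_le_mul hpw.le (pow_factorization_sub_one_le hsq p)
  refine (prod_le_prod' h).trans ?_
  rw [prod_const]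
  refine Nat.pow_le_pow_right (by positivity) ((card_le_card (filter_subset _ _)).trans hW)

theorem exists_prime_ge_of_smallPart_lt {k w : ℕ} (hk : k ≠ 0) (h : smallPart w k < k) :
    ∃ p, p.Prime ∧ p ∣ k ∧ w ≤ p := by
  by_contra! hcon
  have h1 : k.primeFactors.filter (· < w) = k.primeFactors := by
    refine filter_true_of_mem fun p hp => ?_
    exact hcon p (Nat.prime_of_mem_primeFactors hp) (Nat.dvd_of_mem_primeFactors hp)
  have h2 : smallPart w k = k := by
    rw [smallPart, h1]
    exact (Nat.prod_primeFactors_pow_factorization hk).symm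
  omega

/-- If every large prime factor `p` of `k` is such that sums of `n` powers of `2 ^ φ (k / p)` cover
`ZMod p`, then sums of few powers of `2` cover `ZMod k`. -/
theorem isPowSum_two_of_forall_prime {k w n L : ℕ} (hk : Odd k)
    (hsq : ∀ p, p.Prime → w ≤ p → ¬ p ^ 2 ∣ k) (hL : smallPart w k ≤ 2 ^ L)
    (hcov : ∀ p, p.Prime → w ≤ p → p ∣ k → ∀ c : ZMod p,
      IsPowSum ((2 : ZMod p) ^ (k / p).totient) n c) (c : ZMod k) :
    ∃ m ≤ L, IsPowSum (2 : ZMod k) (n + m) c := by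
  have hk0 : k ≠ 0 := hk.pos.ne'
  have : NeZero k := ⟨hk0⟩
  obtain ⟨c, rfl⟩ := ZMod.natCast_zmod_surjective c
  set u := smallPart w k with hu
  have hu0 : 0 < u := smallPart_pos w k
  set b := (c + (u - 1) * n) % u with hb
  have hbn : b + n ≡ c [MOD u] := by
    have h1 : b + n ≡ c + (u - 1) * n + n [MOD u] := (Nat.mod_modEq _ _).add_right n
    have h2 : c + (u - 1) * n + n = c + u * n := by
      conv_rhs => rw [← Nat.sub_add_cancel hu0]
      ring
    rw [h2] at h1
    simpa [Nat.ModEq] using h1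
  have hex : ∀ p, ∃ f : Fin n → ℕ, p.Prime → w ≤ p → p ∣ k →
      ∑ i, ((2 : ZMod p) ^ (k / p).totient) ^ f i = (c : ZMod p) - (b : ZMod p) := by
    intro p
    by_cases h : p.Prime ∧ w ≤ p ∧ p ∣ k
    · obtain ⟨f, hf⟩ := hcov p h.1 h.2.1 h.2.2 ((c : ZMod p) - (b : ZMod p))
      exact ⟨f, fun _ _ _ => hf⟩
    · exact ⟨fun _ => 0, fun h1 h2 h3 => absurd ⟨h1, h2, h3⟩ h⟩
  choose f hf using hex
  set R := k.primeFactors.filter (w ≤ ·) with hR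
  set F : Fin n → ℕ := fun i => ∑ p ∈ R, (k / p).totient * f p i with hF
  have hone : ∀ p ∈ R, ∀ d, d ∣ k → d.Coprime p → (2 : ZMod d) ^ (k / p).totient = 1 := by
    intro p hp d hd hdp
    have hpk := Nat.dvd_of_mem_primeFactors (mem_filter.1 hp).1
    have h1 : d ∣ k / p := by
      rw [Nat.dvd_div_iff_mul_dvd hpk]
      exact Nat.Coprime.mul_dvd_of_dvd_of_dvd hdp.symm hpk hd
    have h2 : Nat.Coprime 2 (k / p) :=
      (Nat.coprime_two_left.2 hk).coprime_dvd_right (Nat.div_dvd_of_dvd hpk)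
    have h3 := (Nat.ModEq.pow_totient h2).of_dvd h1
    have h4 := (ZMod.natCast_eq_natCast_iff _ _ _).2 h3
    simpa using h4
  have hT : ((b + ∑ i, 2 ^ F i : ℕ) : ZMod k) = c := by
    rw [ZMod.natCast_eq_natCast_iff, Nat.modEq_iff_dvd, Int.natCast_dvd,
      Nat.dvd_iff_prime_pow_dvd_dvd]
    intro p j hp hj
    rw [← Int.natCast_dvd, ← Nat.modEq_iff_dvd, ← ZMod.natCast_eq_natCast_iff]
    rcases Nat.eq_zero_or_pos j with rfl | hj0
    · exact (ZMod.natCast_eq_natCast_iff _ _ _).2 (by simpa using Nat.modEq_one)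
    have hpk : p ∣ k := (dvd_pow_self p hj0.ne').trans hj
    push_cast
    rcases lt_or_ge p w with hpw | hpw
    · have hju : p ^ j ∣ u := by
        have h1 : p ^ j ∣ p ^ k.factorization p :=
          pow_dvd_pow p ((hp.pow_dvd_iff_le_factorization hk0).1 hj)
        exact h1.trans (dvd_prod_of_mem (fun p => p ^ k.factorization p)
          (mem_filter.2 ⟨Nat.mem_primeFactors.2 ⟨hp, hpk, hk0⟩, hpw⟩))
      have hF1 : ∀ i, (2 : ZMod (p ^ j)) ^ F i = 1 := by
        intro i
        rw [hF, ← prod_pow_eq_pow_sum]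
        refine prod_eq_one fun q hq => ?_
        have hqR := mem_filter.1 hq
        rw [pow_mul, hone q hq _ hj (Nat.Coprime.pow_left j ((Nat.coprime_primes hp
          (Nat.prime_of_mem_primeFactors hqR.1)).2 (hpw.trans_le hqR.2).ne)), one_pow]
      simp_rw [hF1]
      simpa using (ZMod.natCast_eq_natCast_iff _ _ _).2 (hbn.of_dvd hju)
    · obtain rfl : j = 1 := by
        by_contra hne
        exact hsq p hp hpw ((pow_dvd_pow p (by omega)).trans hj)
      rw [pow_one] at hj ⊢
      have hpR : p ∈ R := mem_filter.2 ⟨Nat.mem_primeFactors.2 ⟨hp, hpk, hk0⟩, hpw⟩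
      have hF1 : ∀ i, (2 : ZMod p) ^ F i = (2 ^ (k / p).totient) ^ f p i := by
        intro i
        rw [hF, ← prod_pow_eq_pow_sum, prod_eq_single_of_mem p hpR, pow_mul]
        intro q hq hqp
        rw [pow_mul, hone q hq _ hj ((Nat.coprime_primes hp
          (Nat.prime_of_mem_primeFactors (mem_filter.1 hq).1)).2 hqp.symm), one_pow]
      simp_rw [hF1]
      rw [hf p hp hpw hpk]
      ring
  have hbL : b < 2 ^ L := (Nat.mod_lt _ hu0).trans_le hL
  obtain ⟨m, hm, h⟩ := IsPowSum.exists_le_natCast (R := ZMod k) L b hbL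
  refine ⟨m, hm, ?_⟩
  have h1 : IsPowSum (2 : ZMod k) n (∑ i, 2 ^ F i) := ⟨F, rfl⟩
  have h2 := h1.add h
  rw [← hT]
  push_cast
  rwa [add_comm (b : ZMod k)]

theorem two_pow_half_totient {p m : ℕ} (hp : p.Prime) (hp2 : p ≠ 2) (hm : Odd m)
    (hcop : p.Coprime m) (hm3 : 3 ≤ m) :
    (2 : ZMod (p * m)) ^ ((p - 1) * (m.totient / 2)) = 1 := by
  have he : 2 ∣ m.totient := (Nat.totient_even hm3).two_dvd
  have he' : 2 ∣ p - 1 := (hp.even_sub_one hp2).two_dvd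
  have h2p : Nat.Coprime 2 p := (Nat.coprime_primes Nat.prime_two hp).2 hp2.symm
  have h2m : Nat.Coprime 2 m := Nat.coprime_two_left.2 hm
  have h1 : 2 ^ ((p - 1) * (m.totient / 2)) ≡ 1 [MOD p] := by
    have := (Nat.ModEq.pow_totient h2p).pow (m.totient / 2)
    rwa [← pow_mul, Nat.totient_prime hp, one_pow] at this
  have h2 : 2 ^ ((p - 1) * (m.totient / 2)) ≡ 1 [MOD m] := by
    have := (Nat.ModEq.pow_totient h2m).pow ((p - 1) / 2)
    rw [← pow_mul, one_pow] at this
    convert this using 2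
    obtain ⟨a, ha⟩ := he
    obtain ⟨b, hb⟩ := he'
    rw [ha, hb, Nat.mul_div_cancel_left _ two_pos, Nat.mul_div_cancel_left _ two_pos]
    ring
  have h3 := (ZMod.natCast_eq_natCast_iff _ _ _).2
    ((Nat.modEq_and_modEq_iff_modEq_mul hcop).1 ⟨h1, h2⟩)
  simpa using h3

theorem ak_lt_two_pow_of_regular {k n G W v L M : ℕ} (hn : 0 < n)
    (hcov : ∀ (p : ℕ) [Fact p.Prime], 6562 ≤ p → ∀ g : (ZMod p)ˣ, p ≤ orderOf g ^ 8 →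
      ∀ c : ZMod p, IsPowSum (g : ZMod p) n c)
    (hk : Odd k) (hkp : ¬ k.Prime) (hG : 1 ≤ G) (hsq : ∀ d, d ^ 2 ∣ k → d ≤ G)
    (hW : #k.primeFactors ≤ W)
    (hgcd : ∀ p q, p.Prime → q.Prime → p ≠ q → p * q ∣ k → (p - 1).gcd (q - 1) ≤ G)
    (hord : ∀ p, p.Prime → p ∣ k → v ^ 4 ≤ p → p ≤ orderOf (2 : ZMod p) ^ 4)
    (hGv : G ^ (6 * W) ≤ v) (hGv' : G < v ^ 4) (hv : 6562 ≤ v)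
    (hk' : (v ^ 4 * G ^ 2) ^ W < k) (hL : (v ^ 4 * G ^ 2) ^ W ≤ 2 ^ L) (hM : n + L ≤ M)
    (hMv : M < v) : ak k < 2 ^ (k + M) := by
  have hk0 : k ≠ 0 := hk.pos.ne'
  have hvv : v ≤ v ^ 4 := Nat.le_self_pow (by norm_num) v
  have hsmall : smallPart (v ^ 4) k ≤ (v ^ 4 * G ^ 2) ^ W :=
    smallPart_le (by omega) hG hsq hW
  have hnsq : ∀ p, p.Prime → v ^ 4 ≤ p → ¬ p ^ 2 ∣ k := fun p _ hvp hdvd => by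
    have := hsq p hdvd
    omega
  obtain ⟨p, hp, hpk, hvp⟩ := exists_prime_ge_of_smallPart_lt hk0 (hsmall.trans_lt hk')
  obtain ⟨m, rfl⟩ := hpk
  have hm : Odd m := (Nat.odd_mul.1 hk).2
  have hcop : p.Coprime m := by
    refine (Nat.Prime.coprime_iff_not_dvd hp).2 fun hdvd => hnsq p hp hvp ?_
    rw [sq]
    exact Nat.mul_dvd_mul_left p hdvd
  have hm3 : 3 ≤ m := by
    obtain ⟨a, rfl⟩ := hm
    rcases Nat.eq_zero_or_pos a with rfl | ha
    · exact absurd (by simpa using hp) hkp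
    · omega
  have ht := two_pow_half_totient hp (by omega) hm hcop hm3
  have htot : 0 < m.totient / 2 :=
    Nat.div_pos (Nat.le_of_dvd (Nat.totient_pos.2 (by omega)) (Nat.totient_even hm3).two_dvd)
      two_pos
  have hpt : p - 1 ≤ (p - 1) * (m.totient / 2) := Nat.le_mul_of_pos_right _ htot
  refine ak_lt_two_pow hk.pos (t := (p - 1) * (m.totient / 2)) (by omega) ?_ ht (by omega) ?_
  · calc 2 * ((p - 1) * (m.totient / 2)) = (p - 1) * (2 * (m.totient / 2)) := by ring
      _ ≤ p * m := Nat.mul_le_mul (Nat.sub_le _ _)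
          ((Nat.mul_div_le _ _).trans (Nat.totient_le m))
  · intro c
    have hcov' : ∀ q, q.Prime → v ^ 4 ≤ q → q ∣ p * m → ∀ c : ZMod q,
        IsPowSum ((2 : ZMod q) ^ (p * m / q).totient) n c := by
      intro q hq hvq hqk c
      have : Fact q.Prime := ⟨hq⟩
      have h2q : Nat.Coprime 2 q := (Nat.coprime_primes Nat.prime_two hq).2 (by omega)
      set g : (ZMod q)ˣ := ZMod.unitOfCoprime 2 h2q with hg
      have hg2 : (g : ZMod q) = 2 := by simp [hg]
      have h := hcov q (by omega) (g ^ (p * m / q).totient) ?_ c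
      · rwa [Units.val_pow_eq_pow_val, hg2] at h
      · refine le_orderOf_pow_pow g ?_
          (gcd_totient_le hk0 hG hq hqk (hnsq q hq hvq) hsq hW hgcd) ?_
        · rw [← orderOf_units, hg2]
          exact hord q hq hqk hvq
        · calc (G ^ (3 * W)) ^ 8 = (G ^ (6 * W)) ^ 4 := by ring
            _ ≤ v ^ 4 := Nat.pow_le_pow_left hGv 4
            _ ≤ q := hvq
    obtain ⟨j, hj, h⟩ := isPowSum_two_of_forall_prime hk hnsq (hsmall.trans hL) hcov' c
    refine ⟨n + j - 1, by omega, ?_⟩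
    rwa [Nat.sub_add_cancel (by omega)]

open Classical in
theorem card_filter_exists_dvd_le {ι : Type*} (N : ℕ) (s : Finset ι) (f : ι → ℕ) :
    (#{k ∈ Ioc 0 N | ∃ i ∈ s, f i ∣ k} : ℝ) ≤ N * ∑ i ∈ s, (f i : ℝ)⁻¹ := by
  have h1 : {k ∈ Ioc 0 N | ∃ i ∈ s, f i ∣ k} ⊆ s.biUnion fun i => {k ∈ Ioc 0 N | f i ∣ k} := by
    intro k hk
    obtain ⟨hk, i, hi, hik⟩ := mem_filter.1 hk
    exact mem_biUnion.2 ⟨i, hi, mem_filter.2 ⟨hk, hik⟩⟩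
  calc (#{k ∈ Ioc 0 N | ∃ i ∈ s, f i ∣ k} : ℝ)
      ≤ ∑ i ∈ s, (#{k ∈ Ioc 0 N | f i ∣ k} : ℝ) := by
        exact_mod_cast (card_le_card h1).trans card_biUnion_le
    _ ≤ N * ∑ i ∈ s, (f i : ℝ)⁻¹ := by
        rw [mul_sum]
        refine sum_le_sum fun i _ => ?_
        rw [Nat.Ioc_filter_dvd_card_eq_div, ← div_eq_mul_inv]
        exact Nat.cast_div_le

theorem sum_Ioc_zero_inv_le (N : ℕ) : ∑ a ∈ Ioc 0 N, (a : ℝ)⁻¹ ≤ 1 + Real.log N := by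
  have h := harmonic_le_one_add_log N
  rw [harmonic_eq_sum_Icc] at h
  push_cast at h
  exact h

theorem sum_Ioc_inv_sq_le {G : ℕ} (hG : 0 < G) (N : ℕ) :
    ∑ d ∈ Ioc G N, ((d : ℝ) ^ 2)⁻¹ ≤ (G : ℝ)⁻¹ := by
  rcases le_or_gt G N with h | h
  · have h1 := sum_Ioc_inv_sq_le_sub (α := ℝ) hG.ne' h
    have h2 : (0 : ℝ) ≤ (N : ℝ)⁻¹ := by positivity
    linarith
  · rw [Ioc_eq_empty (by omega), sum_empty]
    positivity

open Classical in
theorem card_filter_sq_dvd_le {G : ℕ} (hG : 0 < G) (N : ℕ) :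
    (#{k ∈ Ioc 0 N | ∃ d, G < d ∧ d ^ 2 ∣ k} : ℝ) ≤ N * (G : ℝ)⁻¹ := by
  have h1 := card_filter_exists_dvd_le N (Ioc G N) (fun d => d ^ 2)
  refine le_trans (Nat.cast_le.2 (card_le_card ?_)) (h1.trans ?_)
  · intro k hk
    obtain ⟨hk, d, hd, hdk⟩ := mem_filter.1 hk
    have hk' := mem_Ioc.1 hk
    refine mem_filter.2 ⟨hk, d, mem_Ioc.2 ⟨hd, ?_⟩, hdk⟩
    exact ((Nat.le_self_pow two_ne_zero d).trans (Nat.le_of_dvd hk'.1 hdk)).trans hk'.2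
  · push_cast
    exact mul_le_mul_of_nonneg_left (sum_Ioc_inv_sq_le hG N) (Nat.cast_nonneg _)

theorem two_pow_card_primeFactors_le_card_divisors {k : ℕ} (hk : k ≠ 0) :
    2 ^ #k.primeFactors ≤ #k.divisors := by
  rw [Nat.card_divisors hk, ← prod_const]
  refine prod_le_prod' fun p hp => ?_
  have : k.factorization p ≠ 0 := by
    rwa [← Nat.support_factorization, Finsupp.mem_support_iff] at hp
  omega

theorem two_pow_card_primeFactors_le {k : ℕ} (hk : k ≠ 0) : 2 ^ #k.primeFactors ≤ k :=
  (two_pow_card_primeFactors_le_card_divisors hk).trans (Nat.card_divisors_le_self k)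

theorem sum_card_divisors_le (N : ℕ) :
    (∑ k ∈ Ioc 0 N, (#k.divisors : ℝ)) ≤ N * (1 + Real.log N) := by
  have h1 : ∑ k ∈ Ioc 0 N, #k.divisors = ∑ d ∈ Ioc 0 N, #{k ∈ Ioc 0 N | d ∣ k} := by
    simp_rw [card_filter]
    rw [sum_comm]
    refine sum_congr rfl fun k hk => ?_
    have hk' := mem_Ioc.1 hk
    rw [← card_filter]
    congr 1
    ext d
    simp only [Nat.mem_divisors, mem_filter, mem_Ioc]
    refine ⟨fun h => ⟨⟨Nat.pos_of_dvd_of_pos h.1 hk'.1, (Nat.le_of_dvd hk'.1 h.1).trans hk'.2⟩, h.1⟩,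
      fun h => ⟨h.2, hk'.1.ne'⟩⟩
  have h2 : (∑ k ∈ Ioc 0 N, (#k.divisors : ℝ)) = ∑ d ∈ Ioc 0 N, (#{k ∈ Ioc 0 N | d ∣ k} : ℝ) := by
    exact_mod_cast h1
  rw [h2]
  calc ∑ d ∈ Ioc 0 N, (#{k ∈ Ioc 0 N | d ∣ k} : ℝ) ≤ ∑ d ∈ Ioc 0 N, N * (d : ℝ)⁻¹ := by
        refine sum_le_sum fun d _ => ?_
        rw [Nat.Ioc_filter_dvd_card_eq_div, ← div_eq_mul_inv]
        exact Nat.cast_div_le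
    _ ≤ N * (1 + Real.log N) := by
        rw [← mul_sum]
        exact mul_le_mul_of_nonneg_left (sum_Ioc_zero_inv_le N) (Nat.cast_nonneg _)

theorem card_filter_lt_card_primeFactors_le (N W : ℕ) :
    (#{k ∈ Ioc 0 N | W < #k.primeFactors} : ℝ) ≤ N * (1 + Real.log N) / 2 ^ W := by
  rw [le_div_iff₀ (by positivity)]
  refine le_trans ?_ (sum_card_divisors_le N)
  calc (#{k ∈ Ioc 0 N | W < #k.primeFactors} : ℝ) * 2 ^ W
      = ∑ k ∈ Ioc 0 N with W < #k.primeFactors, (2 : ℝ) ^ W := by rw [sum_const, nsmul_eq_mul]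
    _ ≤ ∑ k ∈ Ioc 0 N with W < #k.primeFactors, (#k.divisors : ℝ) := by
        refine sum_le_sum fun k hk => ?_
        obtain ⟨hk, hW⟩ := mem_filter.1 hk
        exact_mod_cast (Nat.pow_le_pow_right two_pos hW.le).trans
          (two_pow_card_primeFactors_le_card_divisors (mem_Ioc.1 hk).1.ne')
    _ ≤ ∑ k ∈ Ioc 0 N, (#k.divisors : ℝ) :=
        sum_le_sum_of_subset_of_nonneg (filter_subset _ _) fun _ _ _ => Nat.cast_nonneg _

open Classical in
theorem card_filter_lt_gcd_le {G : ℕ} (hG : 0 < G) (N : ℕ) :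
    (#{k ∈ Ioc 0 N | ∃ p q, p.Prime ∧ q.Prime ∧ p ≠ q ∧ p * q ∣ k ∧ G < (p - 1).gcd (q - 1)} : ℝ) ≤
      N * ((G : ℝ)⁻¹ * (1 + Real.log N) ^ 2) := by
  have h1 := card_filter_exists_dvd_le N (Ioc G N ×ˢ Ioc 0 N ×ˢ Ioc 0 N)
    (fun x => (x.1 * x.2.1 + 1) * (x.1 * x.2.2 + 1))
  refine le_trans (Nat.cast_le.2 (card_le_card ?_)) (h1.trans ?_)
  · intro k hk
    obtain ⟨hk, p, q, hp, hq, -, hpq, hg⟩ := mem_filter.1 hk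
    have hk' := mem_Ioc.1 hk
    obtain ⟨a, ha⟩ := Nat.gcd_dvd_left (p - 1) (q - 1)
    obtain ⟨b, hb⟩ := Nat.gcd_dvd_right (p - 1) (q - 1)
    have hp1 := hp.one_lt
    have hq1 := hq.one_lt
    have hpN : p ≤ N := (Nat.le_of_dvd hk'.1 (dvd_of_mul_right_dvd hpq)).trans hk'.2
    have hqN : q ≤ N := (Nat.le_of_dvd hk'.1 (dvd_of_mul_left_dvd hpq)).trans hk'.2
    set g := (p - 1).gcd (q - 1) with hgdef
    have ha0 : 0 < a := Nat.pos_of_ne_zero (by rintro rfl; omega)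
    have hb0 : 0 < b := Nat.pos_of_ne_zero (by rintro rfl; omega)
    have hga : g ≤ g * a := Nat.le_mul_of_pos_right _ ha0
    have hag : a ≤ g * a := Nat.le_mul_of_pos_left _ (by omega)
    have hbg : b ≤ g * b := Nat.le_mul_of_pos_left _ (by omega)
    refine mem_filter.2 ⟨hk, (g, a, b), ?_, ?_⟩
    · simp only [mem_product, mem_Ioc]
      omega
    · rw [← ha, ← hb, Nat.sub_add_cancel hp1.le, Nat.sub_add_cancel hq1.le]
      exact hpq
  · refine mul_le_mul_of_nonneg_left ?_ (Nat.cast_nonneg _)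
    calc ∑ x ∈ Ioc G N ×ˢ Ioc 0 N ×ˢ Ioc 0 N,
          (((x.1 * x.2.1 + 1) * (x.1 * x.2.2 + 1) : ℕ) : ℝ)⁻¹
        ≤ ∑ x ∈ Ioc G N ×ˢ Ioc 0 N ×ˢ Ioc 0 N,
          ((x.1 : ℝ) ^ 2)⁻¹ * ((x.2.1 : ℝ)⁻¹ * (x.2.2 : ℝ)⁻¹) := by
          refine sum_le_sum fun x hx => ?_
          simp only [mem_product, mem_Ioc] at hx
          have hx1 : (0 : ℝ) < x.1 := by exact_mod_cast (hG.trans hx.1.1)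
          have hx2 : (0 : ℝ) < x.2.1 := by exact_mod_cast hx.2.1.1
          have hx3 : (0 : ℝ) < x.2.2 := by exact_mod_cast hx.2.2.1
          rw [← mul_inv, ← mul_inv]
          refine inv_anti₀ (by positivity) ?_
          push_cast
          nlinarith [mul_pos hx1 hx2, mul_pos hx1 hx3]
      _ = (∑ d ∈ Ioc G N, ((d : ℝ) ^ 2)⁻¹) *
          ((∑ a ∈ Ioc 0 N, (a : ℝ)⁻¹) * ∑ a ∈ Ioc 0 N, (a : ℝ)⁻¹) := by
          rw [sum_mul_sum, ← sum_product', sum_mul_sum, ← sum_product']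
      _ ≤ (G : ℝ)⁻¹ * (1 + Real.log N) ^ 2 := by
          rw [sq (1 + Real.log N)]
          have h0 : (0 : ℝ) ≤ ∑ a ∈ Ioc 0 N, (a : ℝ)⁻¹ :=
            sum_nonneg fun _ _ => by positivity
          have h2 := sum_Ioc_zero_inv_le N
          gcongr
          exact sum_Ioc_inv_sq_le hG N

theorem card_primes_orderOf_two_eq_le (s : Finset ℕ) {n : ℕ} (hn : 0 < n)
    (hs : ∀ p ∈ s, p.Prime ∧ orderOf (2 : ZMod p) = n) : #s ≤ n := by
  have h0 : 2 ^ n - 1 ≠ 0 := by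
    have := Nat.pow_le_pow_right two_pos hn
    omega
  have h1 : s ⊆ (2 ^ n - 1).primeFactors := by
    intro p hp
    obtain ⟨hpp, hpn⟩ := hs p hp
    refine Nat.mem_primeFactors.2 ⟨hpp, ?_, h0⟩
    rw [← CharP.cast_eq_zero_iff (ZMod p) p, Nat.cast_sub Nat.one_le_two_pow]
    push_cast
    rw [← hpn, pow_orderOf_eq_one, sub_self]
  have h2 : 2 ^ #s ≤ 2 ^ n :=
    ((Nat.pow_le_pow_right two_pos (card_le_card h1)).trans (two_pow_card_primeFactors_le h0)).trans
      (Nat.sub_le _ _)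
  exact (Nat.pow_le_pow_iff_right (by norm_num)).1 h2

open Classical in
theorem card_filter_orderOf_two_lt_le {v : ℕ} (hv : 2 ≤ v) (N : ℕ) :
    (#{k ∈ Ioc 0 N | ∃ p, p.Prime ∧ p ∣ k ∧ v ^ 4 ≤ p ∧ orderOf (2 : ZMod p) ^ 4 < p} : ℝ) ≤
      N * (2 * (v : ℝ)⁻¹) := by
  set s := {p ∈ Ioc 0 N | p.Prime ∧ v ^ 4 ≤ p ∧ orderOf (2 : ZMod p) ^ 4 < p} with hs
  have h1 := card_filter_exists_dvd_le N s id
  refine le_trans (Nat.cast_le.2 (card_le_card ?_)) (h1.trans ?_)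
  · intro k hk
    obtain ⟨hk, p, hp, hpk, h⟩ := mem_filter.1 hk
    have hk' := mem_Ioc.1 hk
    exact mem_filter.2 ⟨hk, p, mem_filter.2 ⟨mem_Ioc.2 ⟨hp.pos,
      (Nat.le_of_dvd hk'.1 hpk).trans hk'.2⟩, hp, h⟩, hpk⟩
  refine mul_le_mul_of_nonneg_left ?_ (Nat.cast_nonneg _)
  have hmaps : ∀ p ∈ s, orderOf (2 : ZMod p) ∈ Ioc 0 N := by
    intro p hp
    obtain ⟨hpN, hp, hvp, hord⟩ := mem_filter.1 hp
    have : Fact p.Prime := ⟨hp⟩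
    have hp2 : 2 < p := by
      have := Nat.pow_le_pow_left hv 4
      omega
    refine mem_Ioc.2 ⟨?_, ?_⟩
    · have h2q : Nat.Coprime 2 p := (Nat.coprime_primes Nat.prime_two hp).2 (by omega)
      have hg2 : ((ZMod.unitOfCoprime 2 h2q : (ZMod p)ˣ) : ZMod p) = 2 := by simp
      rw [← hg2, orderOf_units]
      exact orderOf_pos _
    · exact (Nat.le_self_pow (n := 4) (by norm_num) _).trans (hord.le.trans (mem_Ioc.1 hpN).2)
  rw [← sum_fiberwise_of_maps_to hmaps]
  calc ∑ n ∈ Ioc 0 N, ∑ p ∈ s with orderOf (2 : ZMod p) = n, ((id p : ℕ) : ℝ)⁻¹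
      ≤ ∑ n ∈ Ioc 0 N, (v : ℝ)⁻¹ * ((n : ℝ) ^ 2)⁻¹ := by
        refine sum_le_sum fun n hn => ?_
        have hn0 : (0 : ℝ) < n := by exact_mod_cast (mem_Ioc.1 hn).1
        have hv0 : (0 : ℝ) < v := by exact_mod_cast (by omega : 0 < v)
        have hterm : ∀ p ∈ s.filter (fun p => orderOf (2 : ZMod p) = n),
            ((id p : ℕ) : ℝ)⁻¹ ≤ ((v : ℝ) * n ^ 3)⁻¹ := by
          intro p hp
          obtain ⟨hps, hpn⟩ := mem_filter.1 hp
          obtain ⟨-, -, hvp, hord⟩ := mem_filter.1 hps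
          rw [hpn] at hord
          refine inv_anti₀ (by positivity) ?_
          have h4 : (v * n ^ 3) ^ 4 ≤ p ^ 4 := by
            calc (v * n ^ 3) ^ 4 = v ^ 4 * (n ^ 4) ^ 3 := by ring
              _ ≤ p * p ^ 3 := Nat.mul_le_mul hvp (Nat.pow_le_pow_left hord.le 3)
              _ = p ^ 4 := by ring
          exact_mod_cast (Nat.pow_le_pow_iff_left (by norm_num)).1 h4
        have hcard : (#{p ∈ s | orderOf (2 : ZMod p) = n} : ℝ) ≤ n := by
          exact_mod_cast card_primes_orderOf_two_eq_le _ (mem_Ioc.1 hn).1 fun p hp => by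
            obtain ⟨hps, hpn⟩ := mem_filter.1 hp
            exact ⟨(mem_filter.1 hps).2.1, hpn⟩
        calc _ ≤ ∑ p ∈ s with orderOf (2 : ZMod p) = n, ((v : ℝ) * n ^ 3)⁻¹ := sum_le_sum hterm
          _ = #{p ∈ s | orderOf (2 : ZMod p) = n} * ((v : ℝ) * n ^ 3)⁻¹ := by
              rw [sum_const, nsmul_eq_mul]
          _ ≤ n * ((v : ℝ) * n ^ 3)⁻¹ := by gcongr
          _ = (v : ℝ)⁻¹ * ((n : ℝ) ^ 2)⁻¹ := by field_simp
    _ ≤ 2 * (v : ℝ)⁻¹ := by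
        rw [← mul_sum, mul_comm]
        refine mul_le_mul_of_nonneg_right ?_ (by positivity)
        rcases Nat.eq_zero_or_pos N with rfl | hN
        · simp
        · rw [← sum_Ioc_consecutive _ zero_le_one hN]
          have h2 := sum_Ioc_inv_sq_le zero_lt_one N
          have h3 : ∑ n ∈ Ioc (0 : ℕ) 1, ((n : ℝ) ^ 2)⁻¹ = 1 := by
            rw [show Ioc (0 : ℕ) 1 = {1} from rfl, sum_singleton]
            norm_num
          rw [h3]
          norm_num at h2
          linarith

open Classical in
theorem card_filter_not_ak_lt_le {n G W v L Y N : ℕ} {M : ℕ → ℕ} (hn : 0 < n)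
    (hcov : ∀ (p : ℕ) [Fact p.Prime], 6562 ≤ p → ∀ g : (ZMod p)ˣ, p ≤ orderOf g ^ 8 →
      ∀ c : ZMod p, IsPowSum (g : ZMod p) n c)
    (hG : 1 ≤ G) (hGv : G ^ (6 * W) ≤ v) (hGv' : G < v ^ 4) (hv : 6562 ≤ v)
    (hY : (v ^ 4 * G ^ 2) ^ W ≤ Y) (hL : (v ^ 4 * G ^ 2) ^ W ≤ 2 ^ L)
    (hM : ∀ k, Y < k → k ≤ N → n + L ≤ M k ∧ M k < v) :
    (#{k ∈ Ioc 0 N | Odd k ∧ ¬ ak k < 2 ^ (k + M k)} : ℝ) ≤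
      Y + Nat.primeCounting N + N * (G : ℝ)⁻¹ + N * (1 + Real.log N) / 2 ^ W +
        N * ((G : ℝ)⁻¹ * (1 + Real.log N) ^ 2) + N * (2 * (v : ℝ)⁻¹) := by
  set E₁ := {k ∈ Ioc 0 N | ∃ d, G < d ∧ d ^ 2 ∣ k} with hE₁
  set E₂ := {k ∈ Ioc 0 N | W < #k.primeFactors} with hE₂
  set E₃ := {k ∈ Ioc 0 N | ∃ p q, p.Prime ∧ q.Prime ∧ p ≠ q ∧ p * q ∣ k ∧
    G < (p - 1).gcd (q - 1)} with hE₃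
  set E₄ := {k ∈ Ioc 0 N | ∃ p, p.Prime ∧ p ∣ k ∧ v ^ 4 ≤ p ∧ orderOf (2 : ZMod p) ^ 4 < p}
    with hE₄
  have hsub : {k ∈ Ioc 0 N | Odd k ∧ ¬ ak k < 2 ^ (k + M k)} ⊆
      Ioc 0 Y ∪ (range (N + 1)).filter Nat.Prime ∪ E₁ ∪ E₂ ∪ E₃ ∪ E₄ := by
    intro k hk
    obtain ⟨hkN, hodd, hak⟩ := mem_filter.1 hk
    have hkN' := mem_Ioc.1 hkN
    by_contra hcon
    simp only [hE₁, hE₂, hE₃, hE₄, mem_union, mem_filter, hkN, mem_Ioc, hkN'.1, mem_range,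
      Nat.lt_succ_of_le hkN'.2, true_and, not_or, not_le, not_exists, not_and, not_lt] at hcon
    obtain ⟨⟨⟨⟨⟨hYk, hprime⟩, h1⟩, h2⟩, h3⟩, h4⟩ := hcon
    obtain ⟨hM1, hM2⟩ := hM k hYk hkN'.2
    refine hak (ak_lt_two_pow_of_regular hn hcov hodd hprime hG ?_ h2 h3 h4 hGv hGv' hv
      (hY.trans_lt hYk) hL hM1 hM2)
    intro d hd
    by_contra hlt
    exact h1 d (not_le.1 hlt) hd
  have hcard : #{k ∈ Ioc 0 N | Odd k ∧ ¬ ak k < 2 ^ (k + M k)} ≤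
      Y + Nat.primeCounting N + #E₁ + #E₂ + #E₃ + #E₄ := by
    have hY' : #(Ioc 0 Y) = Y := by simp
    have hpi : #((range (N + 1)).filter Nat.Prime) = Nat.primeCounting N := by
      rw [Nat.primeCounting, Nat.primeCounting', Nat.count_eq_card_filter_range]
    rw [← hpi]
    conv_rhs => rw [← hY']
    refine (card_le_card hsub).trans ?_
    refine (card_union_le _ _).trans (Nat.add_le_add_right ?_ _)
    refine (card_union_le _ _).trans (Nat.add_le_add_right ?_ _)
    refine (card_union_le _ _).trans (Nat.add_le_add_right ?_ _)
    refine (card_union_le _ _).trans (Nat.add_le_add_right ?_ _)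
    exact card_union_le _ _
  refine (Nat.cast_le.2 hcard).trans ?_
  push_cast
  have h1 := card_filter_sq_dvd_le hG N
  have h2 := card_filter_lt_card_primeFactors_le N W
  have h3 := card_filter_lt_gcd_le hG N
  have h4 := card_filter_orderOf_two_lt_le (v := v) (by omega) N
  gcongr

theorem exists_parameters {s : ℝ} (n : ℕ) (hs : 96 ≤ s) (hn : (n : ℝ) + 2 ≤ s)
    (hexp : 72 * s ^ 4 ≤ Real.exp s) : ∃ G W v L : ℕ, 1 ≤ G ∧ G ^ (6 * W) ≤ v ∧ G < v ^ 4 ∧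
      6562 ≤ v ∧ (((v ^ 4 * G ^ 2) ^ W : ℕ) : ℝ) ≤ Real.exp (Real.exp s / 2) ∧
      (v ^ 4 * G ^ 2) ^ W ≤ 2 ^ L ∧ ((n + L : ℕ) : ℝ) ≤ s ^ 6 ∧ Real.exp (s ^ 3) ≤ v ∧
      Real.exp (2 * s) ≤ 2 ^ W ∧ Real.exp (3 * s) ≤ G := by
  have hlog := Real.log_two_gt_d9
  have hs3 : 96 * s ^ 2 ≤ s ^ 3 := by nlinarith [sq_nonneg s]
  have hs2 : 96 * s ≤ s ^ 2 := by nlinarith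
  have hG1 : Real.exp (3 * s) ≤ ⌈Real.exp (3 * s)⌉₊ := Nat.le_ceil _
  have hG2 : (⌈Real.exp (3 * s)⌉₊ : ℝ) ≤ Real.exp (4 * s) := by
    have h1 := (Nat.ceil_lt_add_one (Real.exp_pos (3 * s)).le).le
    have h2 : Real.exp (4 * s) = Real.exp (3 * s) * Real.exp s := by
      rw [← Real.exp_add]; ring_nf
    have h3 := Real.add_one_le_exp s
    have h4 := Real.one_le_exp (by linarith : 0 ≤ 3 * s)
    nlinarith
  have hW1 : 3 * s ≤ ⌈3 * s⌉₊ := Nat.le_ceil _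
  have hW2 : (⌈3 * s⌉₊ : ℝ) ≤ 4 * s := by
    have h1 := (Nat.ceil_lt_add_one (by linarith : 0 ≤ 3 * s)).le
    linarith
  have hv1 : Real.exp (s ^ 3) ≤ ⌈Real.exp (s ^ 3)⌉₊ := Nat.le_ceil _
  have hv2 : (⌈Real.exp (s ^ 3)⌉₊ : ℝ) ≤ Real.exp (2 * s ^ 3) := by
    have h1 := (Nat.ceil_lt_add_one (Real.exp_pos (s ^ 3)).le).le
    have h2 : Real.exp (2 * s ^ 3) = Real.exp (s ^ 3) * Real.exp (s ^ 3) := by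
      rw [← Real.exp_add]; ring_nf
    have h3 := Real.add_one_le_exp (s ^ 3)
    nlinarith
  have hL1 : s ^ 5 ≤ ⌈s ^ 5⌉₊ := Nat.le_ceil _
  have hL2 : (⌈s ^ 5⌉₊ : ℝ) ≤ s ^ 5 + 1 :=
    (Nat.ceil_lt_add_one (by positivity : 0 ≤ s ^ 5)).le
  have hs5 : 1 ≤ s ^ 5 := one_le_pow₀ (by linarith)
  generalize ⌈Real.exp (3 * s)⌉₊ = G at *
  generalize ⌈3 * s⌉₊ = W at *
  generalize ⌈Real.exp (s ^ 3)⌉₊ = v at *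
  generalize ⌈s ^ 5⌉₊ = L at *
  have hpow : (((v ^ 4 * G ^ 2) ^ W : ℕ) : ℝ) ≤ Real.exp (36 * s ^ 4) := by
    push_cast
    calc ((v : ℝ) ^ 4 * G ^ 2) ^ W
        ≤ (Real.exp (2 * s ^ 3) ^ 4 * Real.exp (4 * s) ^ 2) ^ W := by gcongr
      _ = Real.exp (W * (8 * s ^ 3 + 8 * s)) := by
          rw [← Real.exp_nat_mul, ← Real.exp_nat_mul, ← Real.exp_add, ← Real.exp_nat_mul]
          push_cast
          ring_nf
      _ ≤ Real.exp (36 * s ^ 4) := by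
          refine Real.exp_le_exp.2 ?_
          calc (W : ℝ) * (8 * s ^ 3 + 8 * s) ≤ (4 * s) * (9 * s ^ 3) := by
                gcongr
                nlinarith
            _ = 36 * s ^ 4 := by ring
  have two_pow_ge : ∀ m : ℕ, (2 : ℝ) ^ m = Real.exp (m * Real.log 2) := fun m => by
    rw [Real.exp_nat_mul, Real.exp_log two_pos]
  refine ⟨G, W, v, L, ?_, ?_, ?_, ?_, ?_, ?_, ?_, hv1, ?_, hG1⟩
  · have : (0 : ℝ) < G := (Real.exp_pos _).trans_le hG1
    exact_mod_cast this
  · suffices h : ((G ^ (6 * W) : ℕ) : ℝ) ≤ v by exact_mod_cast h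
    push_cast
    calc (G : ℝ) ^ (6 * W) ≤ Real.exp (4 * s) ^ (6 * W) := by gcongr
      _ = Real.exp (W * (24 * s)) := by
          rw [← Real.exp_nat_mul]
          push_cast
          ring_nf
      _ ≤ Real.exp (s ^ 3) := by
          refine Real.exp_le_exp.2 ?_
          nlinarith
      _ ≤ v := hv1
  · suffices h : (G : ℝ) < ((v ^ 4 : ℕ) : ℝ) by exact_mod_cast h
    push_cast
    calc (G : ℝ) ≤ Real.exp (4 * s) := hG2
      _ < Real.exp (4 * s ^ 3) := Real.exp_lt_exp.2 (by nlinarith)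
      _ = Real.exp (s ^ 3) ^ 4 := by
          rw [← Real.exp_nat_mul]
          push_cast
          rfl
      _ ≤ (v : ℝ) ^ 4 := by gcongr
  · have h1 := Real.add_one_le_exp (s ^ 3)
    have h2 : (6562 : ℝ) ≤ v := by nlinarith
    exact_mod_cast h2
  · exact hpow.trans (Real.exp_le_exp.2 (by linarith))
  · suffices h : (((v ^ 4 * G ^ 2) ^ W : ℕ) : ℝ) ≤ ((2 ^ L : ℕ) : ℝ) by exact_mod_cast h
    refine hpow.trans ?_
    push_cast
    rw [two_pow_ge]
    refine Real.exp_le_exp.2 ?_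
    have h1 : 96 * s ^ 4 ≤ s ^ 5 := by nlinarith [pow_pos (by linarith : 0 < s) 4]
    nlinarith [pow_pos (by linarith : 0 < s) 4]
  · push_cast
    have h1 : ((n : ℝ) + 2) * s ^ 5 ≤ s * s ^ 5 := by gcongr
    have h2 : (n : ℝ) ≤ n * s ^ 5 := le_mul_of_one_le_right (Nat.cast_nonneg _) hs5
    nlinarith
  · rw [two_pow_ge]
    refine Real.exp_le_exp.2 ?_
    nlinarith

theorem plog_mono {x y : ℝ} (hx : 0 ≤ x) (hxy : x ≤ y) : plog x ≤ plog y := by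
  rcases hx.eq_or_lt with rfl | hx
  · simp [plog]
  · exact max_le_max_right _ (Real.log_le_log hx hxy)

theorem plog_pos (x : ℝ) : 0 < plog x := zero_lt_one.trans_le (le_max_right _ _)

theorem plog_exp {x : ℝ} (hx : 1 ≤ x) : plog (Real.exp x) = x := by
  rw [plog, Real.log_exp, max_eq_left hx]

theorem mfun_bounds {s : ℝ} {k : ℕ} (hs : 96 ≤ s) (hr : 4000 * Real.log s ^ 3 < s ^ 3)
    (hk : Real.exp (Real.exp s / 2) ≤ k) (hk' : (k : ℝ) ≤ Real.exp (Real.exp s)) :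
    s ^ 6 < mfun k + 1 ∧ (mfun k : ℝ) < Real.exp (s ^ 3) := by
  have hs0 : 0 < s := by linarith
  have hlog := Real.log_two_gt_d9
  have hlog' := Real.log_two_lt_d9
  have hr4 : 4 ≤ Real.log s := by
    have h1 : Real.log ((2 : ℝ) ^ 6) ≤ Real.log s := Real.log_le_log (by norm_num) (by linarith)
    rw [Real.log_pow] at h1
    push_cast at h1
    linarith
  have hes := Real.add_one_le_exp s
  have hup : plog (plog (plog (k : ℝ))) ≤ Real.log s := by
    have h1 := plog_mono (Nat.cast_nonneg k) hk'
    rw [plog_exp (by linarith)] at h1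
    have h2 := plog_mono (plog_pos _).le h1
    rw [plog_exp (by linarith)] at h2
    have h3 := plog_mono (plog_pos _).le h2
    exact h3.trans (max_le le_rfl (by linarith))
  have hlow : Real.log s / 2 ≤ plog (plog (plog (k : ℝ))) := by
    have h1 := plog_mono (Real.exp_pos _).le hk
    rw [plog_exp (by linarith)] at h1
    have h2 := plog_mono (by positivity) h1
    have h3 : s / 2 ≤ plog (Real.exp s / 2) := by
      refine le_trans ?_ (le_max_left _ _)
      rw [Real.log_div (Real.exp_pos s).ne' two_ne_zero, Real.log_exp]
      linarith
    have h4 := plog_mono (by positivity) (h3.trans h2)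
    refine le_trans ?_ h4
    refine le_trans ?_ (le_max_left _ _)
    rw [Real.log_div hs0.ne' two_ne_zero]
    linarith
  constructor
  · refine lt_of_le_of_lt ?_ (Nat.lt_floor_add_one _)
    calc s ^ 6 = Real.exp (6 * Real.log s) := by
          rw [mul_comm, Real.exp_mul, Real.exp_log hs0]
          norm_cast
      _ ≤ Real.exp (4000 * (Real.log s / 2) ^ 3) := by
          refine Real.exp_le_exp.2 ?_
          nlinarith [sq_nonneg (Real.log s - 4)]
      _ ≤ _ := by gcongr
  · refine (Nat.floor_le (Real.exp_pos _).le).trans_lt (Real.exp_lt_exp.2 (lt_of_le_of_lt ?_ hr))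
    have := (plog_pos (plog (plog (k : ℝ)))).le
    gcongr

theorem eventually_atTop_forall_le_log_log (n : ℕ) : ∀ᶠ s : ℝ in Filter.atTop,
    96 ≤ s ∧ (n : ℝ) + 2 ≤ s ∧ 72 * s ^ 4 ≤ Real.exp s ∧ 4000 * Real.log s ^ 3 < s ^ 3 := by
  refine (Filter.eventually_ge_atTop _).and ((Filter.eventually_ge_atTop _).and (.and ?_ ?_))
  · filter_upwards [(Real.isLittleO_pow_exp_atTop (n := 4)).bound (c := 1 / 72) (by norm_num)]
      with s h
    rw [Real.norm_of_nonneg (by positivity), Real.norm_of_nonneg (Real.exp_pos _).le] at h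
    linarith
  · filter_upwards [Real.isLittleO_log_id_atTop.bound (c := 1 / 20) (by norm_num),
      Filter.eventually_gt_atTop 1] with s h h1
    rw [Real.norm_of_nonneg (Real.log_nonneg h1.le), id, Real.norm_of_nonneg (by linarith)] at h
    have h2 : Real.log s ^ 3 ≤ (1 / 20 * s) ^ 3 := pow_le_pow_left₀ (Real.log_nonneg h1.le) h 3
    have h3 : 0 < s ^ 3 := by positivity
    nlinarith

theorem card_exceptions_le {n : ℕ} {s : ℝ} (hn : 0 < n)
    (hcov : ∀ (p : ℕ) [Fact p.Prime], 6562 ≤ p → ∀ g : (ZMod p)ˣ, p ≤ orderOf g ^ 8 →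
      ∀ c : ZMod p, IsPowSum (g : ZMod p) n c)
    (hs : 96 ≤ s) (hns : (n : ℝ) + 2 ≤ s) (hexp : 72 * s ^ 4 ≤ Real.exp s)
    (hr : 4000 * Real.log s ^ 3 < s ^ 3)
    (hpi : (Nat.primeCounting ⌊Real.exp (Real.exp s)⌋₊ : ℝ) ≤
      (Real.log 4 + 1) * Real.exp (Real.exp s) / Real.exp s) :
    ({k : ℕ | Odd k ∧ 0 < k ∧ (k : ℝ) < Real.exp (Real.exp s) ∧
      ¬ ((ak k : ℝ) / k / 2 ^ k < (2 : ℝ) ^ ((mfun k : ℝ) - Real.log k / Real.log 2))}.ncard : ℝ) ≤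
      13 * Real.exp (Real.exp s) / s := by
  classical
  obtain ⟨G, W, v, L, hG, hGv, hGv', hv, hY, hL, hnL, hv', hW', hG'⟩ :=
    exists_parameters n hs hns hexp
  set x := Real.exp (Real.exp s) with hx
  set N := ⌊x⌋₊ with hN
  set Y := ⌊Real.exp (Real.exp s / 2)⌋₊ with hYdef
  have hx0 : 0 < x := Real.exp_pos _
  have hx1 : 1 ≤ x := Real.one_le_exp (Real.exp_pos s).le
  have hNx : (N : ℝ) ≤ x := Nat.floor_le hx0.le
  have hM : ∀ k, Y < k → k ≤ N → n + L ≤ mfun k ∧ mfun k < v := by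
    intro k hYk hkN
    have h1 : Real.exp (Real.exp s / 2) ≤ k := (Nat.lt_of_floor_lt hYk).le
    have h2 : (k : ℝ) ≤ x := (Nat.cast_le.2 hkN).trans hNx
    obtain ⟨h3, h4⟩ := mfun_bounds hs hr h1 h2
    constructor
    · have h5 : ((n + L : ℕ) : ℝ) < ((mfun k + 1 : ℕ) : ℝ) := by
        push_cast at hnL ⊢
        linarith
      exact Nat.lt_succ_iff.1 (by exact_mod_cast h5)
    · exact_mod_cast h4.trans_le hv'
  have hmain := card_filter_not_ak_lt_le (Y := Y) hn hcov hG hGv hGv' hv (Nat.le_floor hY) hL hM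
  have hsub : {k : ℕ | Odd k ∧ 0 < k ∧ (k : ℝ) < x ∧
      ¬ ((ak k : ℝ) / k / 2 ^ k < (2 : ℝ) ^ ((mfun k : ℝ) - Real.log k / Real.log 2))} ⊆
      (({k ∈ Ioc 0 N | Odd k ∧ ¬ ak k < 2 ^ (k + mfun k)} : Finset ℕ) : Set ℕ) := by
    rintro k ⟨hodd, hk0, hkx, hk⟩
    rw [coe_filter]
    exact ⟨mem_Ioc.2 ⟨hk0, Nat.le_floor hkx.le⟩, hodd, fun h => hk (ak_div_lt_rpow hk0 h)⟩
  have hcard := Set.ncard_le_ncard hsub (finite_toSet _)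
  rw [Set.ncard_coe_finset] at hcard
  refine (Nat.cast_le.2 hcard).trans (hmain.trans ?_)
  have hs0 : 0 < s := by linarith
  have hse : s ≤ Real.exp s := by linarith [Real.add_one_le_exp s]
  have he0 := Real.exp_pos s
  have hN1 : 1 ≤ N := Nat.le_floor (by simpa using hx1)
  have hlogN : 1 + Real.log N ≤ 2 * Real.exp s := by
    have h1 : Real.log N ≤ Real.log x := Real.log_le_log (by exact_mod_cast hN1) hNx
    rw [hx, Real.log_exp] at h1
    linarith
  have hlogN0 : 0 ≤ 1 + Real.log N := by
    have := Real.log_natCast_nonneg N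
    linarith
  have he2 : Real.exp (2 * s) = Real.exp s ^ 2 := by
    rw [← Real.exp_nat_mul]
    norm_num
  have he3 : Real.exp (3 * s) = Real.exp s ^ 3 := by
    rw [← Real.exp_nat_mul]
    norm_num
  rw [he2] at hW'
  rw [he3] at hG'
  have hxs : x / Real.exp s ≤ x / s := by gcongr
  have hGinv : (G : ℝ)⁻¹ ≤ (Real.exp s ^ 3)⁻¹ := inv_anti₀ (by positivity) hG'
  have b0 : (Y : ℝ) ≤ x / s := by
    refine (Nat.floor_le (Real.exp_pos _).le).trans ?_
    rw [le_div_iff₀ hs0]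
    have h1 : x = Real.exp (Real.exp s / 2) * Real.exp (Real.exp s / 2) := by
      rw [hx, ← Real.exp_add, add_halves]
    rw [h1]
    have h2 := Real.add_one_le_exp (Real.exp s / 2)
    have h3 : s ≤ Real.exp s / 2 := by nlinarith [pow_le_pow_left₀ (by norm_num) hs 3]
    gcongr
    linarith
  have b1 : (Nat.primeCounting N : ℝ) ≤ 3 * (x / s) := by
    have h4 : Real.log 4 ≤ 2 := by
      rw [show (4 : ℝ) = 2 ^ 2 by norm_num, Real.log_pow]
      push_cast
      linarith [Real.log_two_lt_d9]
    calc (Nat.primeCounting N : ℝ) ≤ (Real.log 4 + 1) * (x / Real.exp s) := by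
          rwa [← mul_div_assoc]
      _ ≤ 3 * (x / s) := by
          gcongr
          linarith
  have b2 : (N : ℝ) * (G : ℝ)⁻¹ ≤ x / s := by
    calc (N : ℝ) * (G : ℝ)⁻¹ ≤ x * (Real.exp s ^ 3)⁻¹ := by gcongr
      _ ≤ x * s⁻¹ := by
          gcongr
          exact hse.trans (le_self_pow₀ (by linarith) (by norm_num))
      _ = x / s := rfl
  have b3 : N * (1 + Real.log N) / 2 ^ W ≤ 2 * (x / s) := by
    calc N * (1 + Real.log N) / 2 ^ W ≤ x * (2 * Real.exp s) / Real.exp s ^ 2 := by gcongr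
      _ = 2 * (x / Real.exp s) := by field_simp
      _ ≤ 2 * (x / s) := by gcongr
  have b4 : N * ((G : ℝ)⁻¹ * (1 + Real.log N) ^ 2) ≤ 4 * (x / s) := by
    calc N * ((G : ℝ)⁻¹ * (1 + Real.log N) ^ 2)
        ≤ x * ((Real.exp s ^ 3)⁻¹ * (2 * Real.exp s) ^ 2) := by gcongr
      _ = 4 * (x / Real.exp s) := by
          field_simp
          ring
      _ ≤ 4 * (x / s) := by gcongr
  have b5 : N * (2 * (v : ℝ)⁻¹) ≤ 2 * (x / s) := by
    have h1 : s ≤ v := by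
      refine le_trans ?_ hv'
      have h2 := Real.add_one_le_exp (s ^ 3)
      have h3 := le_self_pow₀ (by linarith : 1 ≤ s) (by norm_num : 3 ≠ 0)
      linarith
    calc N * (2 * (v : ℝ)⁻¹) ≤ x * (2 * s⁻¹) := by gcongr
      _ = 2 * (x / s) := by ring
  rw [mul_div_assoc 13]
  linarith

end

/-- Corollary: for large `x`, the inequality `c_k/2^k < 2^(m(k) - log k / log 2)`
(where `c_k = a_k / k`) holds for all odd positive `k < x` with at most
`O(x / log log log x)` exceptions. -/
theorem ck_bound_for_most_odd_k :
    ∃ C : ℝ, 0 < C ∧ ∃ x₀ : ℝ, ∀ x : ℝ, x > x₀ →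
      ({k : ℕ | Odd k ∧ 0 < k ∧ (k : ℝ) < x ∧
          ¬ ((ak k : ℝ) / k / 2 ^ k <
              (2 : ℝ) ^ ((mfun k : ℝ) - Real.log k / Real.log 2))}.ncard : ℝ) ≤
        C * x / plog (plog (plog x)) := by
  obtain ⟨n, hn, hcov⟩ := exists_isPowSum_of_le_orderOf_pow
  have hlim : Filter.Tendsto (fun x => Real.log (Real.log x)) Filter.atTop Filter.atTop :=
    Real.tendsto_log_atTop.comp Real.tendsto_log_atTop
  obtain ⟨x₀, hx₀⟩ := Filter.eventually_atTop.1
    ((hlim.eventually (eventually_atTop_forall_le_log_log n)).and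
      ((Chebyshev.eventually_primeCounting_le one_pos).and
        ((Real.tendsto_log_atTop.eventually (Filter.eventually_gt_atTop 0)).and
          (Filter.eventually_gt_atTop 0))))
  refine ⟨13, by norm_num, x₀, fun x hx => ?_⟩
  obtain ⟨⟨hs, hns, hexp, hr⟩, hpi, hlog, hx0⟩ := hx₀ x hx.le
  have h1 : Real.exp (Real.log (Real.log x)) = Real.log x := Real.exp_log hlog
  have hxe : x = Real.exp (Real.exp (Real.log (Real.log x))) := by rw [h1, Real.exp_log hx0]
  set s := Real.log (Real.log x) with hsdef
  rw [← h1] at hpi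
  have hes := Real.add_one_le_exp s
  have hplog : plog (plog (plog x)) ≤ s := by
    rw [hxe, plog_exp (by linarith), plog_exp (by linarith)]
    exact max_le (Real.log_le_self (by linarith)) (by linarith)
  have hpos := plog_pos (plog (plog x))
  clear_value s
  subst hxe
  refine (card_exceptions_le hn hcov hs hns hexp hr hpi).trans ?_
  gcongr
end
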